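/- arXiv:1602.01085 — 5 statements merged into one kernel-verified Lean document; each statement's English description precedes it below -/
import Mathlib

section
/- Fix x ∈ ℝ with 0 < x ≤ 1 and fix N ∈ ℕ with N ≥ 2. Then, as q → 1⁻ (with q ∈ (0,1)), (q^x; q)_∞ = (√(2π)/Γ(x)) · (log(1/q))^(1/2 − x) · exp( ∑_{k=0, k≠1}^{N} (ζ(2−k)/k!)·B_k(x)·(log q)^(k−1) ) · (1 + O((log(1/q))^N)). -/
open Filter Topology Asymptotics Finset Real

/-- A continuous function of mean zero with oscillation at most `C` is bounded by `C`. -/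
lemma abs_le_of_mean_zero (φ : ℝ → ℝ) (hφ : Continuous φ) (C : ℝ)
    (h0 : ∫ y in (0:ℝ)..1, φ y = 0)
    (hC : ∀ x ∈ Set.Icc (0:ℝ) 1, ∀ y ∈ Set.Icc (0:ℝ) 1, |φ x - φ y| ≤ C)
    (x : ℝ) (hx : x ∈ Set.Icc (0:ℝ) 1) : |φ x| ≤ C := by
  have h1 : ∫ y in (0:ℝ)..1, (φ x - φ y) = φ x := by
    rw [intervalIntegral.integral_sub (by simp) (hφ.intervalIntegrable _ _), h0]
    simp
  have h2 : ‖∫ y in (0:ℝ)..1, (φ x - φ y)‖ ≤ C * |(1:ℝ) - 0| := by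
    apply intervalIntegral.norm_integral_le_of_norm_le_const
    intro y hy
    rw [Set.uIoc_of_le zero_le_one] at hy
    exact hC x hx y ⟨hy.1.le, hy.2⟩
  rw [h1] at h2
  simpa using h2

/-- The Euler-Maclaurin defect on the unit interval. -/
noncomputable def emD (N : ℕ) (H : ℕ → ℝ → ℝ) (x : ℝ) : ℝ :=
  H 0 x - (∫ y in (0:ℝ)..1, H 0 y) -
    ∑ k ∈ Finset.range N, bernoulliFun (k+1) x / (Nat.factorial (k+1)) * (H k 1 - H k 0)

lemma emD_bound (N : ℕ) : ∀ (H : ℕ → ℝ → ℝ) (_ : ∀ k x, HasDerivAt (H k) (H (k+1) x) x)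
    (x : ℝ) (_ : x ∈ Set.Icc (0:ℝ) 1), |emD N H x| ≤ ∫ u in (0:ℝ)..1, |H (N+1) u| := by
  induction N with
  | zero =>
    intro H hH x hx
    have hc : ∀ k, Continuous (H k) := fun k =>
      continuous_iff_continuousAt.2 fun x => (hH k x).continuousAt
    have : ∀ x, emD 0 H x = H 0 x - (∫ y in (0:ℝ)..1, H 0 y) := by intro x; simp [emD]
    apply abs_le_of_mean_zero (emD 0 H) _ _ _ _ x hx
    · rw [funext this]; exact (hc 0).sub continuous_const
    · simp_rw [this]
      rw [intervalIntegral.integral_sub ((hc 0).intervalIntegrable _ _) (by simp)]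
      simp
    · intro a ha b hb
      rw [this, this, sub_sub_sub_cancel_right]
      have e := intervalIntegral.integral_eq_sub_of_hasDerivAt (a := b) (b := a)
        (fun y _ => hH 0 y) ((hc 1).intervalIntegrable _ _)
      rw [← e, zero_add]
      refine (intervalIntegral.norm_integral_le_integral_norm_uIoc (f := H 1) (μ := MeasureTheory.volume)).trans ?_
      rw [intervalIntegral.integral_of_le zero_le_one]
      apply MeasureTheory.setIntegral_mono_set
      · exact ((hc 1).abs.intervalIntegrable 0 1).1
      · exact Filter.Eventually.of_forall fun _ => abs_nonneg _
      · apply LE.le.eventuallyLE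
        intro y hy
        rw [Set.mem_uIoc] at hy
        rcases hy with h | h
        · exact ⟨by linarith [hb.1], by linarith [ha.2]⟩
        · exact ⟨by linarith [ha.1], by linarith [hb.2]⟩
  | succ N ih =>
    intro H hH x hx
    have hc : ∀ k, Continuous (H k) := fun k =>
      continuous_iff_continuousAt.2 fun x => (hH k x).continuousAt
    have hd : ∀ x, HasDerivAt (emD (N+1) H) (emD N (fun k => H (k+1)) x) x := by
      intro x
      have h1 : HasDerivAt (fun x => ∑ k ∈ Finset.range (N+1),
          bernoulliFun (k+1) x / (Nat.factorial (k+1)) * (H k 1 - H k 0))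
          (∑ k ∈ Finset.range (N+1),
            (((k+1:ℕ):ℝ) * bernoulliFun (k+1-1) x) / (Nat.factorial (k+1)) * (H k 1 - H k 0)) x := by
        apply HasDerivAt.fun_sum
        intro k _
        exact ((hasDerivAt_bernoulliFun (k+1) x).div_const _).mul_const _
      have h2 := ((hH 0 x).sub_const (∫ y in (0:ℝ)..1, H 0 y)).sub h1
      convert! h2 using 1
      rw [Finset.sum_range_succ']
      have e := intervalIntegral.integral_eq_sub_of_hasDerivAt (a := 0) (b := 1)
        (fun y _ => hH 0 y) ((hc 1).intervalIntegrable _ _)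
      simp only [emD, zero_add] at e ⊢
      rw [e]
      have : ∀ k : ℕ, ((k+1+1:ℕ):ℝ) * bernoulliFun (k+1+1-1) x / (Nat.factorial (k+1+1)) =
          bernoulliFun (k+1) x / (Nat.factorial (k+1)) := by
        intro k
        rw [Nat.factorial_succ (k+1)]
        have : (Nat.factorial (k+1) : ℝ) ≠ 0 := by positivity
        push_cast
        field_simp
      simp_rw [this]
      simp
      ring
    have hcE : Continuous (emD (N+1) H) :=
      continuous_iff_continuousAt.2 fun x => (hd x).continuousAt
    apply abs_le_of_mean_zero (emD (N+1) H) hcE _ _ _ x hx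
    · unfold emD
      rw [intervalIntegral.integral_sub, intervalIntegral.integral_sub
        ((hc 0).intervalIntegrable _ _) (by simp), intervalIntegral.integral_finsetSum]
      · have : ∀ k : ℕ, ∫ y in (0:ℝ)..1,
            bernoulliFun (k+1) y / (Nat.factorial (k+1)) * (H k 1 - H k 0) = 0 := by
          intro k
          rw [intervalIntegral.integral_mul_const, intervalIntegral.integral_div,
            integral_bernoulliFun_eq_zero (by omega)]
          simp
        simp [this]
      · intro i _
        exact (((continuous_bernoulliFun _).div_const _).mul_const _).intervalIntegrable _ _
      · exact ((hc 0).sub continuous_const).intervalIntegrable _ _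
      · refine Continuous.intervalIntegrable ?_ _ _
        exact continuous_finsetSum _ fun i _ =>
          (((continuous_bernoulliFun _).div_const _).mul_const _)
    · intro a ha b hb
      have hb' := Convex.norm_image_sub_le_of_norm_hasDerivWithin_le (f := emD (N+1) H)
        (f' := emD N (fun k => H (k+1))) (s := Set.Icc (0:ℝ) 1) (x := b) (y := a)
        (C := ∫ u in (0:ℝ)..1, |H (N+1+1) u|)
        (fun y _ => (hd y).hasDerivWithinAt)
        (fun y hy => ih (fun k => H (k+1)) (fun k => hH (k+1)) y hy) (convex_Icc 0 1) hb ha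
      rw [Real.norm_eq_abs, Real.norm_eq_abs] at hb'
      refine hb'.trans ?_
      have h0 : 0 ≤ ∫ u in (0:ℝ)..1, |H (N+1+1) u| :=
        intervalIntegral.integral_nonneg zero_le_one fun _ _ => abs_nonneg _
      have : |a - b| ≤ 1 := by rw [abs_le]; constructor <;> linarith [ha.1, ha.2, hb.1, hb.2]
      nlinarith

/-- Euler-Maclaurin on `[0, M]`. -/
lemma em_sum (N : ℕ) (H : ℕ → ℝ → ℝ) (hH : ∀ k x, HasDerivAt (H k) (H (k+1) x) x)
    (x : ℝ) (hx : x ∈ Set.Icc (0:ℝ) 1) (M : ℕ) :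
    |(∑ n ∈ Finset.range M, H 0 (n + x)) - (∫ y in (0:ℝ)..M, H 0 y) -
      ∑ k ∈ Finset.range N, bernoulliFun (k+1) x / (Nat.factorial (k+1)) * (H k M - H k 0)|
      ≤ ∫ u in (0:ℝ)..M, |H (N+1) u| := by
  have hc : ∀ k, Continuous (H k) := fun k =>
    continuous_iff_continuousAt.2 fun x => (hH k x).continuousAt
  induction M with
  | zero => simp
  | succ M ih =>
    have h1 := emD_bound N (fun k y => H k (y + M))
      (fun k y => (hH k (y + M)).comp_add_const y M) x hx
    unfold emD at h1
    simp only [zero_add] at h1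
    rw [intervalIntegral.integral_comp_add_right (fun y => H 0 y),
      intervalIntegral.integral_comp_add_right (fun y => |H (N+1) y|)] at h1
    have e1 := intervalIntegral.integral_add_adjacent_intervals
      ((hc 0).intervalIntegrable (μ := MeasureTheory.volume) 0 M) ((hc 0).intervalIntegrable M (M+1))
    have e2 := intervalIntegral.integral_add_adjacent_intervals
      ((hc (N+1)).abs.intervalIntegrable (μ := MeasureTheory.volume) 0 M)
      ((hc (N+1)).abs.intervalIntegrable M (M+1))
    rw [Finset.sum_range_succ]
    push_cast
    rw [← e1, ← e2]
    rw [zero_add, add_comm (1:ℝ), add_comm x] at h1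
    refine le_trans (le_of_eq ?_) ((abs_add_le _ _).trans (add_le_add ih h1))
    congr 1
    have : ∑ k ∈ Finset.range N, bernoulliFun (k+1) x / (Nat.factorial (k+1)) *
          (H k (M+1) - H k 0) =
        ∑ k ∈ Finset.range N, bernoulliFun (k+1) x / (Nat.factorial (k+1)) * (H k M - H k 0) +
        ∑ k ∈ Finset.range N, bernoulliFun (k+1) x / (Nat.factorial (k+1)) *
          (H k (M+1) - H k M) := by
      rw [← Finset.sum_add_distrib]
      exact Finset.sum_congr rfl fun k _ => by ring
    rw [this]
    ring

/-- `E s = (1 - exp (-s)) / s`, extended smoothly to `s = 0`. -/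
noncomputable def qE : ℝ → ℝ := dslope (fun s : ℝ => 1 - Real.exp (-s)) 0

lemma qE_mul (s : ℝ) : s * qE s = 1 - Real.exp (-s) := by
  have := sub_smul_dslope (fun s : ℝ => 1 - Real.exp (-s)) 0 s
  simpa [qE] using this

lemma qE_zero : qE 0 = 1 := by
  have h : HasDerivAt (fun s : ℝ => 1 - Real.exp (-s)) (-(Real.exp (-0) * (-1))) 0 :=
    ((hasDerivAt_neg (0:ℝ)).exp).const_sub 1
  rw [qE, dslope_same, h.deriv]
  simp

lemma qE_pos (s : ℝ) : 0 < qE s := by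
  rcases lt_trichotomy s 0 with h | h | h
  · have h1 := qE_mul s
    have h2 : 1 < Real.exp (-s) := by rw [Real.one_lt_exp_iff]; linarith
    by_contra h3
    push Not at h3
    nlinarith
  · rw [h, qE_zero]; exact one_pos
  · have h1 := qE_mul s
    have h2 : Real.exp (-s) < 1 := by rw [Real.exp_lt_one_iff]; linarith
    by_contra h3
    push Not at h3
    nlinarith

lemma qE_contDiff : ContDiff ℝ ⊤ qE := by
  rw [contDiff_iff_contDiffAt]
  intro s
  have ha : ∀ s, AnalyticAt ℝ (fun s : ℝ => 1 - Real.exp (-s)) s := fun s => by fun_prop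
  rcases eq_or_ne s 0 with h | h
  · subst h
    obtain ⟨p, hp⟩ := ha 0
    exact (hp.has_fpower_series_dslope_fslope).analyticAt.contDiffAt
  · have h1 : (fun s : ℝ => (1 - Real.exp (-s)) / s) =ᶠ[𝓝 s] qE := by
      filter_upwards [isOpen_ne.mem_nhds h] with y hy
      rw [← qE_mul y]
      exact mul_div_cancel_left₀ _ hy
    exact (((ha s).div analyticAt_id h).contDiffAt).congr_of_eventuallyEq h1.symm

/-- `h s = log ((1 - exp (-s)) / s)`. -/
noncomputable def qh (s : ℝ) : ℝ := Real.log (qE s)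

lemma qh_contDiff : ContDiff ℝ ⊤ qh :=
  qE_contDiff.log fun s => (qE_pos s).ne'

noncomputable def qH (k : ℕ) : ℝ → ℝ := iteratedDeriv k qh

lemma qH_zero : qH 0 = qh := iteratedDeriv_zero

lemma qH_hasDerivAt (k : ℕ) (s : ℝ) : HasDerivAt (qH k) (qH (k+1) s) s := by
  unfold qH
  rw [iteratedDeriv_succ]
  apply DifferentiableAt.hasDerivAt
  exact (qh_contDiff.differentiable_iteratedDeriv k
    (by exact_mod_cast WithTop.coe_lt_top _)).differentiableAt

lemma qh_zero : qh 0 = 0 := by simp [qh, qE_zero]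

lemma qh_of_pos (s : ℝ) (hs : 0 < s) : qh s = Real.log (1 - Real.exp (-s)) - Real.log s := by
  rw [← qE_mul, Real.log_mul hs.ne' (qE_pos s).ne', qh]; ring

lemma qu_eq' (s : ℝ) : s * qH 1 s + 1 = Real.exp (-s) / qE s := by
  have hE : HasDerivAt qE (deriv qE s) s :=
    (qE_contDiff.differentiable (by simp)).differentiableAt.hasDerivAt
  have h1 : qH 1 s = deriv qE s / qE s := by
    have := (qH_hasDerivAt 0 s).unique (by rw [qH_zero]; exact hE.log (qE_pos s).ne')
    simpa using this
  have h2 : HasDerivAt (fun s : ℝ => s * qE s) (1 * qE s + s * deriv qE s) s :=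
    (hasDerivAt_id s).mul hE
  rw [funext qE_mul] at h2
  have h3 : HasDerivAt (fun s : ℝ => 1 - Real.exp (-s)) (-(Real.exp (-s) * (-1))) s :=
    ((hasDerivAt_neg s).exp).const_sub 1
  have h4 := h2.unique h3
  rw [h1]
  have := (qE_pos s).ne'
  field_simp
  linarith

/-- `u s = s / (exp s - 1)` -/
lemma qu_eq (s : ℝ) : (s * qH 1 s + 1) * (Real.exp s - 1) = s := by
  have h5 := qu_eq' s
  have h6 : Real.exp s - 1 = Real.exp s * (s * qE s) := by
    rw [qE_mul, mul_sub, ← Real.exp_add]; simp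
  rw [h5, h6]
  have := (qE_pos s).ne'
  have h7 : Real.exp (-s) * Real.exp s = 1 := by rw [← Real.exp_add]; simp
  field_simp
  linear_combination s * h7

noncomputable def qu (s : ℝ) : ℝ := s * qH 1 s + 1

lemma qu_contDiff : ContDiff ℝ ⊤ qu := by
  have : qu = fun s => Real.exp (-s) / qE s := funext qu_eq'
  rw [this]
  exact (contDiff_neg.exp).div qE_contDiff fun s => (qE_pos s).ne'

lemma qu_iter (k : ℕ) (s : ℝ) :
    iteratedDeriv (k+1) qu s = s * qH (k+2) s + (k+1) * qH (k+1) s := by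
  induction k generalizing s with
  | zero =>
    rw [zero_add, iteratedDeriv_one]
    have := (((hasDerivAt_id s).mul (qH_hasDerivAt 1 s)).add_const 1)
    refine (this.deriv).trans ?_
    simp; ring
  | succ k ih =>
    rw [iteratedDeriv_succ, funext ih]
    have := ((hasDerivAt_id s).mul (qH_hasDerivAt (k+2) s)).add
      ((qH_hasDerivAt (k+1) s).const_mul ((k:ℝ)+1))
    refine (this.deriv).trans ?_
    simp; ring

lemma qu_bernoulli (n : ℕ) : iteratedDeriv n qu 0 = bernoulli n := by
  induction n using Nat.strong_induction_on with
  | _ n ih =>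
    have h1 : (qu * fun s => Real.exp s - 1) = fun s => s := funext qu_eq
    have h2 := iteratedDeriv_mul (n := n+1) (x := (0:ℝ)) (f := qu) (g := fun s => Real.exp s - 1)
      (qu_contDiff.contDiffAt.of_le (by exact_mod_cast le_top))
      ((Real.contDiff_exp.sub contDiff_const).contDiffAt)
    rw [h1, iteratedDeriv_fun_id_zero, Finset.sum_range_succ] at h2
    have h3 : ∀ m : ℕ, 0 < m → iteratedDeriv m (fun s => Real.exp s - 1) 0 = 1 := by
      intro m hm
      obtain ⟨m, rfl⟩ := Nat.exists_eq_succ_of_ne_zero hm.ne'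
      rw [Nat.succ_eq_add_one, iteratedDeriv_succ']
      have : deriv (fun s : ℝ => Real.exp s - 1) = Real.exp := by ext s; simp
      rw [this, iteratedDeriv_eq_iterate, Real.iter_deriv_exp]
      simp
    have h4 := _root_.sum_bernoulli (n+1)
    rw [Finset.sum_range_succ] at h2 h4
    have h5 : ∀ i ∈ Finset.range n, ((n+1).choose i : ℝ) * iteratedDeriv i qu 0 *
        iteratedDeriv (n + 1 - i) (fun s => Real.exp s - 1) 0
        = ((n+1).choose i : ℝ) * bernoulli i := by
      intro i hi
      have := Finset.mem_range.1 hi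
      rw [ih i this, h3 _ (by omega), mul_one]
    rw [Finset.sum_congr rfl h5, h3 _ (by omega)] at h2
    have h6 : (((∑ k ∈ Finset.range n, ((n+1).choose k : ℚ) * bernoulli k) +
      ((n+1).choose n : ℚ) * bernoulli n : ℚ) : ℝ) = (if n + 1 = 1 then 1 else 0 : ℝ) := by
      rw [h4]; split_ifs <;> simp
    push_cast at h6
    have h7 : ((n+1).choose n : ℝ) ≠ 0 := by
      have := Nat.choose_pos (Nat.le_succ n)
      positivity
    have h8 : ((n+1).choose n : ℝ) * iteratedDeriv n qu 0 = ((n+1).choose n : ℝ) * bernoulli n := by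
      simp at h2 h6
      rw [Nat.choose_succ_self_right]
      push_cast
      linarith
    exact mul_left_cancel₀ h7 h8

lemma qH_bernoulli (n : ℕ) : qH (n+1) 0 = bernoulli (n+1) / (n+1) := by
  rw [← qu_bernoulli, qu_iter]
  have : (n:ℝ) + 1 ≠ 0 := by positivity
  field_simp
  ring

noncomputable def qy (s : ℝ) : ℝ := (Real.exp s - 1)⁻¹

lemma qexp_pos (s : ℝ) (hs : 0 < s) : 0 < Real.exp s - 1 := by
  have := Real.one_lt_exp_iff.2 hs
  linarith

lemma qy_hasDerivAt (s : ℝ) (hs : 0 < s) : HasDerivAt qy (-(qy s + qy s ^ 2)) s := by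
  have h := ((Real.hasDerivAt_exp s).sub_const 1).inv (qexp_pos s hs).ne'
  convert! h using 1
  have := (qexp_pos s hs).ne'
  unfold qy
  field_simp
  ring

lemma qH_formula (k : ℕ) : ∃ (Q : Polynomial ℝ) (c : ℝ), ∀ s : ℝ, 0 < s →
    qH (k+1) s = qy s * Q.eval (qy s) + c / s ^ (k+1) := by
  induction k with
  | zero =>
    refine ⟨1, -1, fun s hs => ?_⟩
    have h := qu_eq s
    have h1 := (qexp_pos s hs).ne'
    unfold qy
    simp only [zero_add, Polynomial.eval_one, pow_one]
    have h2 : s * qH 1 s = s / (Real.exp s - 1) - 1 := by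
      rw [eq_sub_iff_add_eq, eq_div_iff h1, h]
    field_simp
    field_simp at h2
    linarith
  | succ k ih =>
    obtain ⟨Q, c, h⟩ := ih
    refine ⟨-(1 + Polynomial.X) * (Q + Polynomial.X * Polynomial.derivative Q), -(k+1) * c, ?_⟩
    intro s hs
    have h1 := qH_hasDerivAt (k+1) s
    have hy := qy_hasDerivAt s hs
    have h2 := hy.mul ((Q.hasDerivAt (qy s)).comp s hy)
    have h3 : HasDerivAt (fun s : ℝ => c / s ^ (k+1))
        ((0 * s^(k+1) - c * (((k+1:ℕ):ℝ) * s ^ (k+1-1))) / (s ^ (k+1)) ^ 2) s :=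
      (hasDerivAt_const s c).div (hasDerivAt_pow (k+1) s) (by positivity)
    have h4 := h2.add h3
    have h5 : qH (k+1) =ᶠ[𝓝 s] (qy * (fun x => Polynomial.eval x Q) ∘ qy) + fun s : ℝ => c / s ^ (k+1) := by
      filter_upwards [lt_mem_nhds hs] with z hz
      rw [h z hz]; rfl
    have h6 := h1.unique (h4.congr_of_eventuallyEq h5)
    rw [h6]
    simp
    field_simp
    ring

lemma qy_nonneg (s : ℝ) (hs : 0 < s) : 0 ≤ qy s := (inv_pos.2 (qexp_pos s hs)).le

lemma qy_le (s : ℝ) (hs : 0 < s) : qy s ≤ 2 / s ^ 2 := by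
  have h := Real.quadratic_le_exp_of_nonneg hs.le
  unfold qy
  rw [inv_eq_one_div, div_le_div_iff₀ (qexp_pos s hs) (by positivity)]
  linarith

lemma qy_tendsto : Tendsto qy atTop (𝓝 0) := by
  unfold qy
  apply Tendsto.inv_tendsto_atTop
  exact tendsto_atTop_add_const_right _ _ Real.tendsto_exp_atTop

lemma qH_tendsto (k : ℕ) : Tendsto (qH (k+1)) atTop (𝓝 0) := by
  obtain ⟨Q, c, h⟩ := qH_formula k
  have h1 : Tendsto (fun s => qy s * Q.eval (qy s) + c / s ^ (k+1)) atTop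
      (𝓝 (0 * Q.eval 0 + 0)) := by
    refine (qy_tendsto.mul ((Q.continuous.tendsto 0).comp qy_tendsto)).add ?_
    exact tendsto_const_nhds.div_atTop (tendsto_pow_atTop (by omega))
  simp only [zero_mul, add_zero] at h1
  refine h1.congr' ?_
  filter_upwards [eventually_gt_atTop 0] with s hs
  exact (h s hs).symm

lemma qH_continuous (k : ℕ) : Continuous (qH k) :=
  continuous_iff_continuousAt.2 fun x => (qH_hasDerivAt k x).continuousAt

lemma qH_bound (k : ℕ) : ∃ C : ℝ, ∀ s : ℝ, 1 < s → |qH (k+2) s| ≤ C * s ^ (-2:ℝ) := by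
  obtain ⟨Q, c, h⟩ := qH_formula (k+1)
  obtain ⟨B, hB⟩ := (isCompact_Icc (a := (0:ℝ)) (b := 2)).exists_bound_of_continuousOn
    Q.continuous.continuousOn
  refine ⟨2 * B + |c|, fun s hs => ?_⟩
  have hs0 : 0 < s := by linarith
  have h0 := qy_nonneg s hs0
  have h1 := qy_le s hs0
  have h2 : (2:ℝ) / s ^ 2 ≤ 2 := div_le_self (by norm_num) (one_le_pow₀ hs.le)
  have h3 := hB (qy s) ⟨h0, h1.trans h2⟩
  rw [Real.norm_eq_abs] at h3
  have hB0 : 0 ≤ B := (abs_nonneg _).trans h3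
  rw [h s hs0]
  have e : s ^ (-2:ℝ) = 1 / s ^ 2 := by
    rw [Real.rpow_neg hs0.le]; norm_num
  rw [e]
  refine (abs_add_le _ _).trans ?_
  rw [abs_mul, abs_div, abs_of_nonneg h0, abs_of_nonneg (by positivity : 0 ≤ s ^ (k+1+1))]
  have h4 : |c| / s ^ (k+1+1) ≤ |c| / s ^ 2 := by
    apply div_le_div_of_nonneg_left (abs_nonneg _) (by positivity)
    exact pow_le_pow_right₀ hs.le (by omega)
  have h5 : qy s * |Q.eval (qy s)| ≤ 2 / s ^ 2 * B := mul_le_mul h1 h3 (abs_nonneg _) (by positivity)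
  calc _ ≤ 2 / s ^ 2 * B + |c| / s ^ 2 := add_le_add h5 h4
    _ = _ := by ring

lemma qH_integral_bound (k : ℕ) : ∃ C : ℝ, ∀ T : ℝ, 0 ≤ T → ∫ s in (0:ℝ)..T, |qH (k+2) s| ≤ C := by
  obtain ⟨C, hC⟩ := qH_bound k
  have hi1 : MeasureTheory.IntegrableOn (fun s => |qH (k+2) s|) (Set.Ioi 1) := by
    refine MeasureTheory.Integrable.mono'
      ((integrableOn_Ioi_rpow_of_lt (by norm_num : (-2:ℝ) < -1) one_pos).const_mul C)
      ((qH_continuous _).abs.aestronglyMeasurable) ?_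
    refine (MeasureTheory.ae_restrict_mem measurableSet_Ioi).mono fun s hs => ?_
    rw [Real.norm_eq_abs, abs_abs]
    exact hC s hs
  have hi0 : MeasureTheory.IntegrableOn (fun s => |qH (k+2) s|) (Set.Ioc 0 1) :=
    ((qH_continuous _).abs.intervalIntegrable 0 1).1
  have hi := hi0.union hi1
  rw [Set.Ioc_union_Ioi_eq_Ioi zero_le_one] at hi
  refine ⟨∫ s in Set.Ioi 0, |qH (k+2) s|, fun T hT => ?_⟩
  rw [intervalIntegral.integral_of_le hT]
  apply MeasureTheory.setIntegral_mono_set hi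
  · exact Filter.Eventually.of_forall fun _ => abs_nonneg _
  · exact (Set.Ioc_subset_Ioi_self).eventuallyLE

/-- `Li₂ (exp (-s))`. -/
noncomputable def qG (s : ℝ) : ℝ := ∑' n : ℕ, Real.exp (-((n+1) * s)) / ((n:ℝ)+1)^2

lemma qsummable : Summable fun n : ℕ => 1 / ((n:ℝ)+1)^2 := by
  have := (summable_nat_add_iff 1).2 (Real.summable_one_div_nat_pow.2 one_lt_two)
  simpa using this

lemma qG_zero : qG 0 = π^2/6 := by
  unfold qG
  have h := (hasSum_nat_add_iff' 1).2 hasSum_zeta_two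
  simp only [Finset.range_one, Finset.sum_singleton] at h
  push_cast at h
  have := h.tsum_eq
  simpa using this

lemma qG_term_le (n : ℕ) (s : ℝ) (hs : 0 ≤ s) :
    Real.exp (-((n+1) * s)) / ((n:ℝ)+1)^2 ≤ Real.exp (-s) * (1 / ((n:ℝ)+1)^2) := by
  rw [mul_one_div]
  gcongr
  have : (0:ℝ) ≤ n := Nat.cast_nonneg n
  nlinarith

lemma qG_term_nonneg (n : ℕ) (s : ℝ) : 0 ≤ Real.exp (-((n+1) * s)) / ((n:ℝ)+1)^2 := by positivity

lemma qG_summable (s : ℝ) (hs : 0 ≤ s) :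
    Summable fun n : ℕ => Real.exp (-((n+1) * s)) / ((n:ℝ)+1)^2 :=
  Summable.of_nonneg_of_le (fun n => qG_term_nonneg n s) (fun n => qG_term_le n s hs)
    (qsummable.mul_left _)

lemma qG_tendsto : Tendsto qG atTop (𝓝 0) := by
  have h1 : Tendsto (fun s : ℝ => Real.exp (-s) * ∑' n : ℕ, 1 / ((n:ℝ)+1)^2) atTop (𝓝 0) := by
    have := (Real.tendsto_exp_neg_atTop_nhds_zero).mul_const (∑' n : ℕ, 1 / ((n:ℝ)+1)^2)
    simpa using this
  refine tendsto_of_tendsto_of_tendsto_of_le_of_le' tendsto_const_nhds h1 ?_ ?_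
  · exact Filter.Eventually.of_forall fun s => tsum_nonneg fun n => qG_term_nonneg n s
  · filter_upwards [eventually_ge_atTop 0] with s hs
    rw [← tsum_mul_left]
    exact (qG_summable s hs).tsum_le_tsum (fun n => qG_term_le n s hs) (qsummable.mul_left _)

lemma qG_continuousOn : ContinuousOn qG (Set.Ici 0) := by
  unfold qG
  refine continuousOn_tsum (u := fun n : ℕ => 1 / ((n:ℝ)+1)^2) ?_ qsummable ?_
  · intro n
    fun_prop
  · intro n s hs
    rw [Real.norm_eq_abs, abs_of_nonneg (qG_term_nonneg n s)]
    refine (qG_term_le n s hs).trans ?_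
    have : Real.exp (-s) ≤ 1 := by rw [Real.exp_le_one_iff]; simpa using hs
    have h2 : (0:ℝ) ≤ 1 / ((n:ℝ)+1)^2 := by positivity
    nlinarith

lemma qG_hasDerivAt (s : ℝ) (hs : 0 < s) : HasDerivAt qG (Real.log (1 - Real.exp (-s))) s := by
  have hr : Real.exp (-(s/2)) < 1 := by rw [Real.exp_lt_one_iff]; linarith
  have h := hasDerivAt_tsum_of_isPreconnected
    (g := fun (n : ℕ) (s : ℝ) => Real.exp (-((n+1) * s)) / ((n:ℝ)+1)^2)
    (g' := fun (n : ℕ) (s : ℝ) => -(Real.exp (-s) ^ (n+1) / ((n:ℝ)+1)))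
    (u := fun n : ℕ => Real.exp (-(s/2)) ^ n) (t := Set.Ioi (s/2)) (y₀ := s) (y := s)
    (summable_geometric_of_lt_one (Real.exp_pos _).le hr) isOpen_Ioi isPreconnected_Ioi ?_ ?_
    (by simpa using hs) (qG_summable s hs.le) (by simpa using hs)
  · have hx : |Real.exp (-s)| < 1 := by
      rw [abs_of_pos (Real.exp_pos _), Real.exp_lt_one_iff]; linarith
    have h2 := (Real.hasSum_pow_div_log_of_abs_lt_one hx).neg
    rw [neg_neg] at h2
    rw [h2.tsum_eq] at h
    exact h
  · intro n y _
    have h1 : HasDerivAt (fun s : ℝ => -(((n:ℝ)+1) * s)) (-(((n:ℝ)+1) * 1)) y :=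
      ((hasDerivAt_id y).const_mul ((n:ℝ)+1)).neg
    have h2 := h1.exp.div_const (((n:ℝ)+1)^2)
    convert! h2 using 1
    rw [← Real.exp_nat_mul]
    push_cast
    have : (n:ℝ) + 1 ≠ 0 := by positivity
    rw [mul_neg]
    field_simp
  · intro n y hy
    have hy' : s/2 < y := hy
    rw [norm_neg, Real.norm_eq_abs, abs_of_nonneg (by positivity)]
    calc Real.exp (-y) ^ (n+1) / ((n:ℝ)+1) ≤ Real.exp (-y) ^ (n+1) :=
          div_le_self (by positivity) (by linarith [(Nat.cast_nonneg n : (0:ℝ) ≤ n)])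
      _ ≤ Real.exp (-(s/2)) ^ (n+1) := by gcongr
      _ ≤ Real.exp (-(s/2)) ^ n := pow_le_pow_of_le_one (Real.exp_pos _).le hr.le (Nat.le_succ n)

lemma qh_integral (T : ℝ) (hT : 0 < T) :
    ∫ s in (0:ℝ)..T, qh s = qG T - π^2/6 - T * Real.log T + T := by
  have h := intervalIntegral.integral_eq_sub_of_hasDerivAt_of_le
    (f := fun s => qG s - s * Real.log s + s) (f' := qh) hT.le ?_ ?_ ?_
  · rw [h, qG_zero]; simp; ring
  · refine ((qG_continuousOn.mono Set.Icc_subset_Ici_self).sub ?_).add continuousOn_id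
    exact Real.continuous_mul_log.continuousOn
  · intro s hs
    have h1 := ((qG_hasDerivAt s hs.1).sub (Real.hasDerivAt_mul_log hs.1.ne')).add (hasDerivAt_id s)
    convert! h1 using 1
    rw [qh_of_pos s hs.1]
    ring
  · exact (qH_zero ▸ qH_continuous 0).intervalIntegrable _ _

/-- The main term of the logarithm. -/
noncomputable def qmain (N : ℕ) (x t : ℝ) : ℝ :=
  Real.log (√(2*π)) - Real.log (Real.Gamma x) + (1/2 - x) * Real.log t - (π^2/6) / t -
    ∑ k ∈ Finset.range N, bernoulliFun (k+1) x / (Nat.factorial (k+1)) * (t^k * qH k 0)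

noncomputable def qW (N : ℕ) (x t : ℝ) (M : ℕ) : ℝ :=
  M * Real.log t + (∑ n ∈ Finset.range M, Real.log (n + x)) + (∫ y in (0:ℝ)..M, qh (t * y)) +
    ∑ k ∈ Finset.range N, bernoulliFun (k+1) x / (Nat.factorial (k+1)) *
      (t^k * qH k (t * M) - t^k * qH k 0)

lemma qW_approx (N : ℕ) : ∃ C : ℝ, ∀ (x t : ℝ) (_ : 0 < x) (_ : x ≤ 1) (_ : 0 < t) (M : ℕ),
    |(∑ n ∈ Finset.range M, Real.log (1 - Real.exp (-(t * (n + x))))) - qW (N+1) x t M|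
      ≤ C * t^(N+1) := by
  obtain ⟨C, hC⟩ := qH_integral_bound N
  refine ⟨C, fun x t hx0 hx1 ht M => ?_⟩
  have h := em_sum (N+1) (fun k u => t^k * qH k (t * u)) ?_ x ⟨hx0.le, hx1⟩ M
  · have e1 : ∑ n ∈ Finset.range M, Real.log (1 - Real.exp (-(t * (n + x)))) =
        M * Real.log t + (∑ n ∈ Finset.range M, Real.log (n + x)) +
        ∑ n ∈ Finset.range M, qh (t * (n + x)) := by
      have : ∀ n ∈ Finset.range M, Real.log (1 - Real.exp (-(t * (n + x)))) =
          Real.log t + Real.log (n + x) + qh (t * (n+x)) := by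
        intro n _
        have hp : 0 < (n:ℝ) + x := by positivity
        rw [qh_of_pos _ (mul_pos ht hp), Real.log_mul ht.ne' hp.ne']
        ring
      rw [Finset.sum_congr rfl this, Finset.sum_add_distrib, Finset.sum_add_distrib]
      simp
    have e2 : ∫ u in (0:ℝ)..M, |t^(N+1+1) * qH (N+1+1) (t * u)| ≤ C * t^(N+1) := by
      have : ∀ u, |t^(N+1+1) * qH (N+1+1) (t * u)| = t^(N+1+1) * |qH (N+2) (t * u)| := by
        intro u; rw [abs_mul, abs_of_pos (by positivity)]
      simp_rw [this]
      rw [intervalIntegral.integral_const_mul,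
        intervalIntegral.integral_comp_mul_left (fun u => |qH (N+2) u|) ht.ne', mul_zero, smul_eq_mul]
      have h3 := hC (t * M) (by positivity)
      calc _ = t^(N+1) * ∫ u in (0:ℝ)..t*M, |qH (N+2) u| := by field_simp; ring
        _ ≤ t^(N+1) * C := by gcongr
        _ = _ := by ring
    refine le_trans (le_of_eq ?_) (h.trans e2)
    rw [e1]
    unfold qW
    simp only [pow_zero, one_mul, qH_zero, mul_zero]
    congr 1
    ring
  · intro k u
    have h1 : HasDerivAt (fun u : ℝ => t * u) (t * 1) u := (hasDerivAt_id u).const_mul t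
    have h2 := ((qH_hasDerivAt k (t*u)).comp u h1).const_mul (t^k)
    convert! h2 using 1
    ring

lemma qlog_tendsto (t : ℝ) (ht : 0 < t) :
    Tendsto (fun M : ℕ => Real.log (1 - Real.exp (-(t * M)))) atTop (𝓝 0) := by
  have h1 : Tendsto (fun M : ℕ => t * (M:ℝ)) atTop atTop :=
    tendsto_natCast_atTop_atTop.const_mul_atTop ht
  have h2 : Tendsto (fun M : ℕ => 1 - Real.exp (-(t * M))) atTop (𝓝 (1 - 0)) :=
    (Real.tendsto_exp_neg_atTop_nhds_zero.comp h1).const_sub 1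
  have h3 := h2.log (by norm_num)
  simpa using h3

lemma qlog2_tendsto (x : ℝ) (hx : 0 < x) :
    Tendsto (fun M : ℕ => Real.log (x + M) - Real.log M) atTop (𝓝 0) := by
  have h1 : Tendsto (fun M : ℕ => x / (M:ℝ) + 1) atTop (𝓝 (0 + 1)) :=
    (tendsto_const_nhds.div_atTop tendsto_natCast_atTop_atTop).add_const 1
  have h3 := h1.log (by norm_num)
  simp only [zero_add, Real.log_one] at h3
  refine h3.congr' ?_
  filter_upwards [eventually_gt_atTop 0] with M hM
  have : (0:ℝ) < M := by exact_mod_cast hM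
  rw [← Real.log_div (by positivity) this.ne', add_div, div_self this.ne']

lemma qW_tendsto (N : ℕ) (x t : ℝ) (hx0 : 0 < x) (ht : 0 < t) :
    Tendsto (qW (N+1) x t) atTop (𝓝 (qmain (N+1) x t)) := by
  have hT : Tendsto (fun M : ℕ => t * (M:ℝ)) atTop atTop :=
    tendsto_natCast_atTop_atTop.const_mul_atTop ht
  have l1 := Real.BohrMollerup.tendsto_log_gamma hx0
  have l2 : Tendsto (fun M : ℕ => Real.log (Stirling.stirlingSeq M)) atTop (𝓝 (Real.log (√π))) :=
    Stirling.tendsto_stirlingSeq_sqrt_pi.log (by positivity)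
  have l3 := qlog2_tendsto x hx0
  have l4 : Tendsto (fun M : ℕ => qG (t * M) / t) atTop (𝓝 (0 / t)) :=
    (qG_tendsto.comp hT).div_const t
  have l5 := (qlog_tendsto t ht).const_mul (x - 1/2)
  have l6 : Tendsto (fun M : ℕ => ∑ k ∈ Finset.range N,
      bernoulliFun (k+1+1) x / (Nat.factorial (k+1+1)) *
      (t^(k+1) * qH (k+1) (t * M) - t^(k+1) * qH (k+1) 0)) atTop
      (𝓝 (∑ k ∈ Finset.range N, bernoulliFun (k+1+1) x / (Nat.factorial (k+1+1)) *
      (t^(k+1) * 0 - t^(k+1) * qH (k+1) 0))) := by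
    apply tendsto_finsetSum
    intro k _
    exact ((((qH_tendsto k).comp hT).const_mul (t^(k+1))).sub_const _).const_mul _
  have l := (((((l2.sub l1).sub l3).add l4).add l5).add l6).add_const
    (Real.log 2 / 2 - (π^2/6)/t - (x-1/2) * Real.log t)
  refine (l.congr' ?_).trans (le_of_eq ?_)
  · filter_upwards [eventually_gt_atTop 0] with M hM
    have hM' : (0:ℝ) < M := by exact_mod_cast hM
    have htM : 0 < t * M := by positivity
    unfold qW Real.BohrMollerup.logGammaSeq
    rw [Finset.sum_range_succ' _ N, Finset.sum_range_succ _ M, Stirling.log_stirlingSeq_formula,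
      intervalIntegral.integral_comp_mul_left (fun u => qh u) ht.ne', mul_zero,
      qh_integral _ htM, smul_eq_mul, qH_zero, qh_zero, qh_of_pos _ htM,
      Real.log_mul ht.ne' hM'.ne', Real.log_mul two_ne_zero hM'.ne',
      Real.log_div hM'.ne' (Real.exp_pos 1).ne', Real.log_exp]
    have : ∑ n ∈ Finset.range M, Real.log (n + x) = ∑ n ∈ Finset.range M, Real.log (x + n) :=
      Finset.sum_congr rfl fun n _ => by rw [add_comm]
    rw [this]
    simp only [zero_add, bernoulliFun_one, Nat.factorial_one, Nat.cast_one, pow_zero]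
    field_simp
    ring
  · congr 1
    unfold qmain
    rw [Finset.sum_range_succ' _ N, qH_zero, qh_zero, Real.sqrt_mul zero_le_two,
      Real.log_mul (by positivity) (by positivity), Real.log_sqrt zero_le_two]
    have : ∑ k ∈ Finset.range N, bernoulliFun (k+1+1) x / (Nat.factorial (k+1+1)) *
      (t^(k+1) * 0 - t^(k+1) * qH (k+1) 0) = - ∑ k ∈ Finset.range N,
      bernoulliFun (k+1+1) x / (Nat.factorial (k+1+1)) * (t^(k+1) * qH (k+1) 0) := by
      rw [← Finset.sum_neg_distrib]
      exact Finset.sum_congr rfl fun k _ => by ring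
    rw [this]
    ring

lemma qabs_exp (y : ℝ) : |Real.exp y - 1| ≤ Real.exp |y| - 1 := by
  rcases le_total 0 y with h | h
  · rw [abs_of_nonneg h, abs_of_nonneg]
    linarith [Real.one_le_exp h]
  · have h1 : Real.exp y ≤ 1 := Real.exp_le_one_iff.2 h
    rw [abs_of_nonpos h, abs_of_nonpos (by linarith)]
    have h2 := Real.exp_pos y
    have h3 : Real.exp y * Real.exp (-y) = 1 := by rw [← Real.exp_add]; simp
    have h4 := Real.exp_pos (-y)
    nlinarith [sq_nonneg (Real.exp y - 1), sq_nonneg (Real.exp (-y) - 1),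
      sq_nonneg (Real.exp y - Real.exp (-y)), mul_nonneg (sub_nonneg.2 h1) h4.le]

lemma qprod_bound (N : ℕ) : ∃ C : ℝ, ∀ (x t : ℝ) (_ : 0 < x) (_ : x ≤ 1) (_ : 0 < t),
    |(∏' n : ℕ, (1 - Real.exp (-t) ^ ((n : ℝ) + x))) / Real.exp (qmain (N+1) x t) - 1| ≤
      Real.exp (C * t^(N+1)) - 1 := by
  obtain ⟨C, hC⟩ := qW_approx N
  refine ⟨C, fun x t hx0 hx1 ht => ?_⟩
  have hpow : ∀ n : ℕ, Real.exp (-t) ^ ((n:ℝ) + x) = Real.exp (-(t * (n + x))) := by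
    intro n; rw [← Real.exp_mul]; congr 1; ring
  have hm : Multipliable fun n : ℕ => (1 - Real.exp (-t) ^ ((n : ℝ) + x)) := by
    have hs : Summable fun n : ℕ => ‖-(Real.exp (-t) ^ ((n : ℝ) + x))‖ := by
      have h1 : Summable fun n : ℕ => Real.exp (-t) ^ n * Real.exp (-(t*x)) :=
        (summable_geometric_of_lt_one (Real.exp_pos _).le
          (by rw [Real.exp_lt_one_iff]; linarith)).mul_right _
      refine h1.congr fun n => ?_
      rw [norm_neg, hpow, Real.norm_eq_abs, abs_of_pos (Real.exp_pos _), ← Real.exp_nat_mul,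
        ← Real.exp_add]
      congr 1; ring
    simpa [sub_eq_add_neg] using multipliable_one_add_of_summable hs
  have l1 := (hm.hasProd.tendsto_prod_nat.div_const (Real.exp (qmain (N+1) x t))).sub_const 1
  have l2 : Tendsto (fun M : ℕ => Real.exp (C * t^(N+1) + |qW (N+1) x t M - qmain (N+1) x t|) - 1)
      atTop (𝓝 (Real.exp (C * t^(N+1) + |qmain (N+1) x t - qmain (N+1) x t|) - 1)) :=
    ((Real.continuous_exp.tendsto _).comp
      ((((qW_tendsto N x t hx0 ht).sub_const _).abs).const_add _)).sub_const 1
  rw [sub_self, abs_zero, add_zero] at l2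
  refine le_of_tendsto_of_tendsto' l1.abs l2 fun M => ?_
  have e : ∏ n ∈ Finset.range M, (1 - Real.exp (-t) ^ ((n : ℝ) + x)) =
      Real.exp (∑ n ∈ Finset.range M, Real.log (1 - Real.exp (-(t * (n + x))))) := by
    rw [Real.exp_sum]
    refine Finset.prod_congr rfl fun n _ => ?_
    have hp : 0 < (n:ℝ) + x := by positivity
    rw [hpow, Real.exp_log]
    have : Real.exp (-(t * (n + x))) < 1 := by
      rw [Real.exp_lt_one_iff]; have := mul_pos ht hp; linarith
    linarith
  rw [e, ← Real.exp_sub]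
  refine (qabs_exp _).trans ?_
  have h1 := abs_sub_le (∑ n ∈ Finset.range M, Real.log (1 - Real.exp (-(t * (n + x)))))
    (qW (N+1) x t M) (qmain (N+1) x t)
  have h2 := hC x t hx0 hx1 ht M
  have := Real.exp_le_exp.2 (h1.trans (add_le_add_left h2 _))
  linarith

lemma qmain_eq (N : ℕ) (x t : ℝ) (hx0 : 0 < x) (ht : 0 < t) :
    ((((Real.sqrt (2 * Real.pi) / Real.Gamma x) * t ^ ((1 : ℝ) / 2 - x) : ℝ) : ℂ) *
            Complex.exp (∑ k ∈ (Finset.range (N + 1 + 1)).erase 1,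
              riemannZeta (2 - (k : ℂ)) / (Nat.factorial k : ℂ) *
                ((Polynomial.aeval x (Polynomial.bernoulli k) : ℝ) : ℂ) *
                (((-t : ℝ) : ℂ)) ^ ((k : ℤ) - 1))) = ((Real.exp (qmain (N+1) x t) : ℝ) : ℂ) := by
  have hB : ∀ k, (Polynomial.aeval x (Polynomial.bernoulli k) : ℝ) = bernoulliFun k x := by
    intro k
    rw [bernoulliFun, Polynomial.eval_map_algebraMap]
  have htC : (t : ℂ) ≠ 0 := by exact_mod_cast ht.ne'
  have hsum : (∑ k ∈ (Finset.range (N + 1 + 1)).erase 1,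
              riemannZeta (2 - (k : ℂ)) / (Nat.factorial k : ℂ) *
                ((Polynomial.aeval x (Polynomial.bernoulli k) : ℝ) : ℂ) *
                (((-t : ℝ) : ℂ)) ^ ((k : ℤ) - 1)) =
      ((- (π^2/6) / t - ∑ k ∈ Finset.range (N+1),
        bernoulliFun (k+1) x / (Nat.factorial (k+1)) * (t^k * qH k 0) : ℝ) : ℂ) := by
    have hmem : 1 ∈ Finset.range (N+1+1) := by simp
    rw [Finset.sum_erase_eq_sub hmem, Finset.sum_range_succ', Finset.sum_range_succ',
      Finset.sum_range_succ' _ N, qH_zero, qh_zero]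
    have hk : ∀ k ∈ Finset.range N, riemannZeta (2 - ((k+1+1 : ℕ) : ℂ)) / (Nat.factorial (k+1+1) : ℂ) *
                ((Polynomial.aeval x (Polynomial.bernoulli (k+1+1)) : ℝ) : ℂ) *
                (((-t : ℝ) : ℂ)) ^ (((k+1+1 : ℕ) : ℤ) - 1) =
          ((-(bernoulliFun (k+1+1) x / (Nat.factorial (k+1+1)) * (t^(k+1) * qH (k+1) 0)) : ℝ) : ℂ) := by
      intro k _
      have e1 : (2 - ((k+1+1 : ℕ) : ℂ)) = -(k:ℂ) := by push_cast; ring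
      have e2 : (((k+1+1 : ℕ) : ℤ) - 1) = ((k+1 : ℕ) : ℤ) := by push_cast; ring
      rw [e1, e2, zpow_natCast, riemannZeta_neg_nat_eq_bernoulli, hB, qH_bernoulli]
      push_cast
      rw [neg_pow (t:ℂ) (k+1)]
      have : ((-1:ℂ))^k * (-1)^(k+1) = -1 := by
        rw [pow_succ, ← mul_assoc, ← mul_pow]; simp
      linear_combination ((bernoulli (k+1) : ℂ) / (k+1) / (Nat.factorial (k+1+1) : ℂ) *
        (bernoulliFun (k+1+1) x : ℂ) * (t:ℂ)^(k+1)) * this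
    rw [Finset.sum_congr rfl hk]
    rw [hB 0]
    simp only [Nat.cast_zero, sub_zero, riemannZeta_two, bernoulliFun_zero, zero_add]
    push_cast
    rw [Finset.sum_neg_distrib]
    simp only [Nat.factorial_zero, zpow_neg, zpow_one, Nat.cast_one]
    field_simp
    ring
  rw [hsum, ← Complex.ofReal_exp, ← Complex.ofReal_mul]
  congr 1
  have hG := Real.Gamma_pos_of_pos hx0
  have e1 : qmain (N+1) x t = Real.log (√(2*π)) - Real.log (Real.Gamma x) +
      Real.log t * (1/2 - x) + (- (π^2/6) / t - ∑ k ∈ Finset.range (N+1),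
        bernoulliFun (k+1) x / (Nat.factorial (k+1)) * (t^k * qH k 0)) := by
    unfold qmain; ring
  rw [e1, Real.exp_add, Real.exp_add, Real.exp_sub (Real.log √(2*π)), Real.exp_log (by positivity), Real.exp_log hG,
    Real.rpow_def_of_pos ht]

/-- Asymptotic expansion of the q-Pochhammer symbol `(q^x; q)_∞` near
`q = 1`: it equals
`(√(2π)/Γ(x)) (log(1/q))^{1/2-x} exp(∑_{k=0,k≠1}^N (ζ(2-k)/k!) B_k(x) (log q)^{k-1})`
up to a multiplicative error `1 + O((log(1/q))^N)`. -/
theorem qPochhammer_asymptotic (x : ℝ) (hx0 : 0 < x) (hx1 : x ≤ 1)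
    (N : ℕ) (hN : 2 ≤ N) :
    (fun q : ℝ =>
        (((∏' n : ℕ, (1 - q ^ ((n : ℝ) + x))) : ℝ) : ℂ) /
          ((((Real.sqrt (2 * Real.pi) / Real.Gamma x) *
              (Real.log (1 / q)) ^ ((1 : ℝ) / 2 - x) : ℝ) : ℂ) *
            Complex.exp (∑ k ∈ (Finset.range (N + 1)).erase 1,
              riemannZeta (2 - (k : ℂ)) / (Nat.factorial k : ℂ) *
                ((Polynomial.aeval x (Polynomial.bernoulli k) : ℝ) : ℂ) *
                ((Real.log q : ℂ)) ^ ((k : ℤ) - 1))) - 1)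
      =O[𝓝[Set.Ioo (0 : ℝ) 1] 1] fun q : ℝ => (Real.log (1 / q)) ^ N := by
  obtain ⟨N, rfl⟩ : ∃ n, N = n + 1 := ⟨N - 1, by omega⟩
  obtain ⟨C, hC⟩ := qprod_bound N
  have hlim : Tendsto (fun q : ℝ => C * (Real.log (1 / q)) ^ (N+1)) (𝓝[Set.Ioo (0 : ℝ) 1] 1)
      (𝓝 0) := by
    have h1 : ContinuousAt (fun q : ℝ => C * (Real.log (1 / q)) ^ (N+1)) 1 := by
      refine continuousAt_const.mul (ContinuousAt.pow (ContinuousAt.log ?_ (by norm_num)) _)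
      exact continuousAt_const.div continuousAt_id one_ne_zero
    have h2 := h1.tendsto.mono_left (nhdsWithin_le_nhds (s := Set.Ioo (0:ℝ) 1))
    simpa using h2
  have hev : ∀ᶠ q in 𝓝[Set.Ioo (0 : ℝ) 1] 1, |C * (Real.log (1 / q)) ^ (N+1)| ≤ 1 := by
    have := hlim.abs
    rw [abs_zero] at this
    exact this.eventually (ge_mem_nhds one_pos)
  refine IsBigO.of_bound (2 * |C|) ?_
  filter_upwards [hev, self_mem_nhdsWithin] with q hq1 hq
  have ht : 0 < Real.log (1 / q) := Real.log_pos (by rw [lt_div_iff₀ hq.1]; linarith [hq.2])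
  have hlq : Real.log q = -Real.log (1 / q) := by simp
  have hqe : q = Real.exp (-Real.log (1 / q)) := by rw [← hlq, Real.exp_log hq.1]
  rw [hlq]
  have hb := hC x (Real.log (1/q)) hx0 hx1 ht
  rw [← hqe] at hb
  rw [qmain_eq N x _ hx0 ht, ← Complex.ofReal_div, ← Complex.ofReal_one, ← Complex.ofReal_sub,
    Complex.norm_real, Real.norm_eq_abs, Real.norm_eq_abs]
  refine hb.trans ((le_abs_self _).trans ((Real.abs_exp_sub_one_le hq1).trans ?_))
  rw [abs_mul, mul_assoc]
end

section
/- Fix x ∈ ℝ with 0 < x < 1. Then, as q → 1⁻ (with q ∈ (0,1)), the ratio (q^x; q)_∞ · (q^(1−x); q)_∞ / [ 2·sin(πx) · exp(π²/(3·log q)) · q^(−(1/6 − x + x²)/2) ] tends to 1. -/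
open Filter Topology Real

noncomputable def qA (t x : ℝ) : ℝ := ∏' n : ℕ, (1 - Real.exp (-(t * ((n : ℝ) + x))))

lemma qA_summable {t : ℝ} (ht : 0 < t) (x : ℝ) :
    Summable (fun n : ℕ => Real.exp (-(t * ((n : ℝ) + x)))) := by
  have h := (summable_geometric_of_lt_one (Real.exp_pos (-t)).le
    (by rw [Real.exp_lt_one_iff]; linarith)).mul_left (Real.exp (-(t * x)))
  refine h.congr fun n => ?_
  rw [← Real.exp_nat_mul, ← Real.exp_add]
  congr 1; ring

lemma qA_mult {t : ℝ} (ht : 0 < t) (x : ℝ) :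
    Multipliable (fun n : ℕ => 1 - Real.exp (-(t * ((n : ℝ) + x)))) := by
  have := Real.multipliable_one_add_of_summable (qA_summable ht x).neg
  simpa [sub_eq_add_neg] using this

lemma qA_term_pos {t x : ℝ} (ht : 0 < t) (hx : 0 < x) (n : ℕ) :
    0 < 1 - Real.exp (-(t * ((n : ℝ) + x))) := by
  rw [sub_pos, Real.exp_lt_one_iff]
  have : 0 < t * ((n : ℝ) + x) := by positivity
  linarith

lemma qA_summable_log {t : ℝ} (ht : 0 < t) (x : ℝ) :
    Summable (fun n : ℕ => Real.log (1 - Real.exp (-(t * ((n : ℝ) + x))))) := by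
  have := Real.summable_log_one_add_of_summable (qA_summable ht x).neg
  simpa [sub_eq_add_neg] using this

lemma qA_eq_exp {t x : ℝ} (ht : 0 < t) (hx : 0 < x) :
    qA t x = Real.exp (∑' n : ℕ, Real.log (1 - Real.exp (-(t * ((n : ℝ) + x))))) :=
  (Real.rexp_tsum_eq_tprod (qA_term_pos ht hx) (qA_summable_log ht x)).symm

lemma qA_pos {t x : ℝ} (ht : 0 < t) (hx : 0 < x) : 0 < qA t x := by
  rw [qA_eq_exp ht hx]; exact Real.exp_pos _

lemma qA_log {t x : ℝ} (ht : 0 < t) (hx : 0 < x) :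
    Real.log (qA t x) = ∑' n : ℕ, Real.log (1 - Real.exp (-(t * ((n : ℝ) + x)))) := by
  rw [qA_eq_exp ht hx, Real.log_exp]

/-- peel off first factor -/
lemma qA_succ {t : ℝ} (ht : 0 < t) (x : ℝ) :
    qA t x = (1 - Real.exp (-(t * x))) * qA t (1 + x) := by
  have hm : Multipliable (fun n : ℕ => 1 - Real.exp (-(t * (((n + 1 : ℕ) : ℝ) + x)))) := by
    refine (qA_mult ht (1 + x)).congr fun n => ?_
    congr 3; push_cast; ring
  have h := tprod_eq_zero_mul' (f := fun n : ℕ => 1 - Real.exp (-(t * ((n : ℝ) + x)))) hm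
  unfold qA
  rw [h]
  congr 1
  · simp
  · refine tprod_congr fun n => ?_
    congr 3; push_cast; ring

/-- duplication -/
lemma qA_dup {t : ℝ} (ht : 0 < t) : qA t (1/4) * qA t (3/4) = qA (t/2) (1/2) := by
  unfold qA
  rw [← tprod_even_mul_odd (f := fun n : ℕ => 1 - Real.exp (-(t / 2 * ((n : ℝ) + 1/2))))]
  · congr 1 <;> refine tprod_congr fun n => ?_ <;> congr 3 <;> push_cast <;> ring
  · refine (qA_mult ht (1/4)).congr fun n => ?_
    congr 3; push_cast; ring
  · refine (qA_mult ht (3/4)).congr fun n => ?_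
    congr 3; push_cast; ring

lemma term_id (t x m : ℝ) (hm : Real.sinh (t * m / 2) ≠ 0) :
    (1 - Real.exp (-(t * (m + x)))) * (1 - Real.exp (-(t * (m - x)))) =
    (1 + -(Real.sinh (t * x / 2) / Real.sinh (t * m / 2)) ^ 2) * (1 - Real.exp (-(t * m))) ^ 2 := by
  have e : (1 - Real.exp (-(t * m))) = 2 * Real.exp (-(t*m/2)) * Real.sinh (t * m / 2) := by
    rw [Real.sinh_eq, show -(t*m) = -(t*m/2) + -(t*m/2) by ring, Real.exp_add]
    have : Real.exp (-(t*m/2)) * Real.exp (t*m/2) = 1 := by rw [← Real.exp_add]; simp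
    linear_combination -this
  have e1 : (1 + -(Real.sinh (t * x / 2) / Real.sinh (t * m / 2)) ^ 2) * (1 - Real.exp (-(t * m))) ^ 2
      = (1 - Real.exp (-(t * m))) ^ 2 - 4 * Real.exp (-(t*m/2)) ^ 2 * Real.sinh (t * x / 2) ^ 2 := by
    rw [e]; field_simp; ring
  rw [e1, Real.sinh_eq]
  set a := Real.exp (-(t*m/2)) with ha
  have h1 : Real.exp (-(t * m)) = a ^ 2 := by rw [ha, ← Real.exp_nat_mul]; congr 1; push_cast; ring
  set b := Real.exp (t*x/2) with hb
  set c := Real.exp (-(t*x/2)) with hc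
  have hbc : b * c = 1 := by rw [hb, hc, ← Real.exp_add]; simp
  have h2 : Real.exp (-(t * (m + x))) = a ^ 2 * c ^ 2 := by
    rw [ha, hc, ← Real.exp_nat_mul, ← Real.exp_nat_mul, ← Real.exp_add]; congr 1; push_cast; ring
  have h3 : Real.exp (-(t * (m - x))) = a ^ 2 * b ^ 2 := by
    rw [ha, hb, ← Real.exp_nat_mul, ← Real.exp_nat_mul, ← Real.exp_add]; congr 1; push_cast; ring
  rw [h1, h2, h3]
  linear_combination (a^4 * (b * c + 1) - 2 * a^2) * hbc

lemma iter_lemma (B : ℝ → ℝ) (h1 : Tendsto (fun t => t * B t) (𝓝[>] 0) (𝓝 0))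
    (h2 : Tendsto (fun t => B (t/2) - 2 * B t) (𝓝[>] 0) (𝓝 0)) :
    Tendsto B (𝓝[>] 0) (𝓝 0) := by
  rw [Metric.tendsto_nhds] at h2 ⊢
  intro ε hε
  have h3 := h2 (ε/2) (by positivity)
  rw [eventually_nhdsWithin_iff, Metric.eventually_nhds_iff] at h3 ⊢
  obtain ⟨δ, hδ, H⟩ := h3
  refine ⟨δ, hδ, fun t ht ht0 => ?_⟩
  have ht0' : 0 < t := ht0
  have hk : ∀ k : ℕ, |B t| - ε/2 ≤ (|B (t / 2^k)| - ε/2) / 2^k := by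
    intro k
    induction k with
    | zero => simp
    | succ k ih =>
      refine ih.trans ?_
      have hpos : 0 < t / 2^k := by positivity
      have hle : t / 2^k ≤ t := div_le_self ht0'.le (one_le_pow₀ (by norm_num))
      have := @H (t/2^k) (by
        rw [Real.dist_eq, sub_zero, abs_of_pos] at ht ⊢ <;> linarith) hpos
      rw [Real.dist_eq, sub_zero] at this
      have e : t / 2^k / 2 = t / 2^(k+1) := by rw [pow_succ]; field_simp
      rw [e] at this
      have h5 : 2 * |B (t/2^k)| ≤ |B (t / 2^(k+1))| + ε/2 := by
        have h6 := abs_sub_abs_le_abs_sub (2 * B (t/2^k)) (B (t / 2^(k+1)))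
        rw [abs_mul, abs_two, abs_sub_comm] at h6
        linarith
      have e2 : (|B (t / 2 ^ (k + 1))| - ε / 2) / 2 ^ (k + 1)
          = ((|B (t / 2 ^ (k + 1))| - ε / 2) / 2) / 2 ^ k := by
        rw [pow_succ (2:ℝ) k]; field_simp
      rw [e2]
      gcongr
      linarith
  have ht2 : Tendsto (fun k : ℕ => t / 2^k) atTop (𝓝[>] 0) := by
    rw [tendsto_nhdsWithin_iff]
    refine ⟨?_, Eventually.of_forall fun k => by simp only [Set.mem_Ioi]; positivity⟩
    have := (tendsto_pow_atTop_nhds_zero_of_lt_one (r := (1/2:ℝ)) (by norm_num) (by norm_num)).const_mul t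
    simpa [div_eq_mul_inv] using this
  have h4 := ((h1.comp ht2).abs).const_mul (1/t)
  have h5 : ∀ k : ℕ, |B t| ≤ 1 / t * |t / 2 ^ k * B (t / 2 ^ k)| + ε/2 := by
    intro k
    have := hk k
    have hpk : (0:ℝ) < 2^k := by positivity
    rw [abs_mul, abs_of_pos (by positivity : 0 < t/2^k)]
    have e : 1 / t * (t / 2 ^ k * |B (t / 2 ^ k)|) = |B (t / 2 ^ k)| / 2^k := by field_simp
    rw [e]
    rw [sub_div] at this
    have : 0 ≤ ε / 2 / 2^k := by positivity
    linarith
  have h6 := ge_of_tendsto' (h4.add_const (ε/2)) h5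
  simp at h6
  rw [Real.dist_eq, sub_zero]; linarith

lemma sinh_div_tendsto (c : ℝ) :
    Tendsto (fun t : ℝ => Real.sinh (t * c) / t) (𝓝[>] 0) (𝓝 c) := by
  have h : HasDerivAt (fun t : ℝ => Real.sinh (t * c)) c 0 := by
    have := (Real.hasDerivAt_sinh (0 * c)).comp (0:ℝ) ((hasDerivAt_id (0:ℝ)).mul_const c)
    simpa [Function.comp_def] using! this
  have := h.tendsto_slope_zero_right
  simpa [div_eq_inv_mul] using this

lemma sin_tprod {x : ℝ} (hx0 : 0 < x) :
    ∏' n : ℕ, (1 + -(x / ((n:ℝ) + 1)) ^ 2) = Real.sin (π * x) / (π * x) := by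
  have hs : Summable (fun n : ℕ => -(x / ((n:ℝ) + 1)) ^ 2) := by
    have := ((summable_nat_add_iff 1).2 (Real.summable_one_div_nat_pow.2 one_lt_two)).mul_left (-x^2)
    refine this.congr fun n => ?_
    push_cast; field_simp
  have h := (Real.multipliable_one_add_of_summable hs).hasProd.tendsto_prod_nat
  have h2 := (Real.tendsto_euler_sin_prod x).div_const (π * x)
  have hne : π * x ≠ 0 := by positivity
  refine tendsto_nhds_unique h (h2.congr fun n => ?_)
  rw [mul_div_cancel_left₀ _ hne]
  refine Finset.prod_congr rfl fun i _ => ?_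
  rw [div_pow]; ring

lemma sinh_ge {u : ℝ} (hu : 0 ≤ u) : u ≤ Real.sinh u := Real.self_le_sinh_iff.2 hu

lemma sinh_ratio_tendsto (x : ℝ) (n : ℕ) :
    Tendsto (fun t : ℝ => Real.sinh (t * x / 2) / Real.sinh (t * ((n:ℝ) + 1) / 2)) (𝓝[>] 0)
      (𝓝 (x / ((n:ℝ) + 1))) := by
  have h1 := sinh_div_tendsto (x / 2)
  have h2 := sinh_div_tendsto (((n:ℝ) + 1) / 2)
  have h3 := h1.div h2 (by positivity)
  have e : x / 2 / (((n:ℝ) + 1) / 2) = x / ((n:ℝ) + 1) := by field_simp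
  rw [e] at h3
  refine h3.congr' ?_
  filter_upwards [self_mem_nhdsWithin] with t ht
  have ht : t ≠ 0 := ne_of_gt ht
  simp only [Pi.div_apply, mul_div_assoc]
  rw [div_div_div_cancel_right₀ ht]

lemma summable_inv_sq : Summable (fun n : ℕ => 1 / ((n:ℝ) + 1) ^ 2) := by
  have := ((summable_nat_add_iff 1).2 (Real.summable_one_div_nat_pow.2 one_lt_two))
  refine this.congr fun n => ?_
  push_cast; rfl

lemma prod_tendsto {x : ℝ} (hx0 : 0 < x) (hx1 : x < 1) :
    Tendsto (fun t : ℝ => ∏' n : ℕ,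
      (1 + -(Real.sinh (t * x / 2) / Real.sinh (t * ((n:ℝ) + 1) / 2)) ^ 2)) (𝓝[>] 0)
      (𝓝 (Real.sin (π * x) / (π * x))) := by
  rw [← sin_tprod hx0]
  refine tendsto_tprod_one_add_of_dominated_convergence
    (bound := fun n : ℕ => 4 * (1 / ((n:ℝ) + 1) ^ 2)) (summable_inv_sq.mul_left 4) ?_ ?_
  · intro n
    exact ((sinh_ratio_tendsto x n).pow 2).neg
  · have h := (sinh_div_tendsto (x / 2)).eventually_le_const (show x / 2 < 1 by linarith)
    filter_upwards [self_mem_nhdsWithin, h] with t ht h n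
    have ht : 0 < t := ht
    rw [div_le_one ht, ← mul_div_assoc] at h
    have h0 : 0 ≤ Real.sinh (t * x / 2) := Real.sinh_nonneg_iff.2 (by positivity)
    have h1 := sinh_ge (u := t * ((n:ℝ) + 1) / 2) (by positivity)
    have h2 : Real.sinh (t * x / 2) / Real.sinh (t * ((n:ℝ) + 1) / 2) ≤ t / (t * ((n:ℝ) + 1) / 2) := by
      gcongr
    have e : t / (t * ((n:ℝ) + 1) / 2) = 2 / ((n:ℝ) + 1) := by field_simp
    rw [e] at h2
    have h3 : 0 ≤ Real.sinh (t * x / 2) / Real.sinh (t * ((n:ℝ) + 1) / 2) :=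
      div_nonneg h0 (le_trans (by positivity) h1)
    rw [norm_neg, Real.norm_of_nonneg (by positivity)]
    calc _ ≤ (2 / ((n:ℝ) + 1)) ^ 2 := by gcongr
      _ = _ := by rw [div_pow]; ring

lemma qA_pair {t : ℝ} (ht : 0 < t) {x : ℝ} (hx0 : 0 < x) (hx1 : x < 1) :
    qA t x * qA t (1 - x) = (1 - Real.exp (-(t * x))) * (∏' n : ℕ,
      (1 + -(Real.sinh (t * x / 2) / Real.sinh (t * ((n:ℝ) + 1) / 2)) ^ 2)) * qA t 1 ^ 2 := by
  have hs : Summable (fun n : ℕ =>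
      -(Real.sinh (t * x / 2) / Real.sinh (t * ((n:ℝ) + 1) / 2)) ^ 2) := by
    refine Summable.neg ?_
    refine Summable.of_nonneg_of_le (fun n => by positivity) (fun n => ?_)
      (summable_inv_sq.mul_left ((2 * Real.sinh (t * x / 2) / t) ^ 2))
    have h0 : 0 ≤ Real.sinh (t * x / 2) := Real.sinh_nonneg_iff.2 (by positivity)
    have h1 := sinh_ge (u := t * ((n:ℝ) + 1) / 2) (by positivity)
    have hp : 0 < t * ((n:ℝ) + 1) / 2 := by positivity
    have hp' := lt_of_lt_of_le hp h1
    calc _ ≤ (Real.sinh (t * x / 2) / (t * ((n:ℝ) + 1) / 2)) ^ 2 := by gcongr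
      _ = _ := by field_simp
  have hm := Real.multipliable_one_add_of_summable hs
  rw [qA_succ ht x, mul_assoc, mul_assoc, sq]
  congr 1
  unfold qA
  rw [← (qA_mult ht (1 + x)).tprod_mul (qA_mult ht (1 - x)),
    ← (qA_mult ht 1).tprod_mul (qA_mult ht 1), ← hm.tprod_mul ((qA_mult ht 1).mul (qA_mult ht 1))]
  refine tprod_congr fun n => ?_
  have := term_id t x ((n:ℝ) + 1) (by
    have h1 := sinh_ge (u := t * ((n:ℝ) + 1) / 2) (by positivity)
    have hp : 0 < t * ((n:ℝ) + 1) / 2 := by positivity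
    linarith)
  rw [← add_assoc, ← add_sub_assoc, ← sq]
  exact this

lemma one_sub_exp_div (x : ℝ) :
    Tendsto (fun t : ℝ => (1 - Real.exp (-(t * x))) / t) (𝓝[>] 0) (𝓝 x) := by
  have h : HasDerivAt (fun t : ℝ => 1 - Real.exp (-(t * x))) x 0 := by
    have := (((hasDerivAt_id (0:ℝ)).mul_const x).neg.exp).const_sub 1
    simpa using! this
  have := h.tendsto_slope_zero_right
  simpa [div_eq_inv_mul] using this

lemma pair_tendsto {x : ℝ} (hx0 : 0 < x) (hx1 : x < 1) :
    Tendsto (fun t : ℝ => qA t x * qA t (1 - x) / (t * qA t 1 ^ 2)) (𝓝[>] 0)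
      (𝓝 (Real.sin (π * x) / π)) := by
  have h := (one_sub_exp_div x).mul (prod_tendsto hx0 hx1)
  have e : x * (Real.sin (π * x) / (π * x)) = Real.sin (π * x) / π := by field_simp
  rw [e] at h
  refine h.congr' ?_
  filter_upwards [self_mem_nhdsWithin] with t ht
  have ht : 0 < t := ht
  have := qA_pos ht one_pos
  rw [qA_pair ht hx0 hx1]
  field_simp

lemma ratio_tendsto {x : ℝ} (hx0 : 0 < x) (hx1 : x < 1) :
    Tendsto (fun t : ℝ => qA t x * qA t (1 - x) / qA t (1/2) ^ 2) (𝓝[>] 0)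
      (𝓝 (Real.sin (π * x))) := by
  have h2 := pair_tendsto (x := 1/2) (by norm_num) (by norm_num)
  have e0 : Real.sin (π * (1/2)) = 1 := by rw [mul_one_div, Real.sin_pi_div_two]
  rw [e0] at h2
  have h := (pair_tendsto hx0 hx1).div h2 (by positivity)
  have e : Real.sin (π * x) / π / (1 / π) = Real.sin (π * x) := by field_simp
  rw [e] at h
  refine h.congr' ?_
  filter_upwards [self_mem_nhdsWithin] with t ht
  have ht : 0 < t := ht
  have := qA_pos ht one_pos
  have := qA_pos ht (show (0:ℝ) < 1/2 by norm_num)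
  rw [Pi.div_apply, show (1:ℝ) - 1/2 = 1/2 by norm_num]
  field_simp

lemma log_qA_half {t : ℝ} (ht : 0 < t) :
    Real.log (qA t (1/2)) = -∑' k : ℕ, 1 / (2 * ((k:ℝ) + 1) * Real.sinh (t * ((k:ℝ) + 1) / 2)) := by
  rw [qA_log ht (by norm_num)]
  let f : ℕ → ℕ → ℝ := fun n k => Real.exp (-(t * ((n:ℝ) + 1/2))) ^ (k + 1) / ((k:ℝ) + 1)
  have hf0 : ∀ n k, 0 ≤ f n k := fun n k => by simp only [f]; positivity
  have hrow : ∀ n, HasSum (f n) (-Real.log (1 - Real.exp (-(t * ((n:ℝ) + 1/2))))) := by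
    intro n
    apply Real.hasSum_pow_div_log_of_abs_lt_one
    rw [abs_of_pos (Real.exp_pos _), Real.exp_lt_one_iff]
    have : 0 < t * ((n:ℝ) + 1/2) := by positivity
    linarith
  have hcol : ∀ k, HasSum (fun n => f n k) (1 / (2 * ((k:ℝ) + 1) * Real.sinh (t * ((k:ℝ) + 1) / 2))) := by
    intro k
    have hlt : Real.exp (-(t * ((k:ℝ) + 1))) < 1 := by
      rw [Real.exp_lt_one_iff]
      have : 0 < t * ((k:ℝ) + 1) := by positivity
      linarith
    have h := (hasSum_geometric_of_lt_one (Real.exp_pos (-(t * ((k:ℝ) + 1)))).le hlt).mul_left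
      (Real.exp (-(t * ((k:ℝ) + 1) / 2)) / ((k:ℝ) + 1))
    have e : Real.exp (-(t * ((k:ℝ) + 1) / 2)) / ((k:ℝ) + 1) * (1 - Real.exp (-(t * ((k:ℝ) + 1))))⁻¹
        = 1 / (2 * ((k:ℝ) + 1) * Real.sinh (t * ((k:ℝ) + 1) / 2)) := by
      have e : (1 - Real.exp (-(t * ((k:ℝ) + 1)))) =
          2 * Real.exp (-(t*((k:ℝ) + 1)/2)) * Real.sinh (t * ((k:ℝ) + 1) / 2) := by
        rw [Real.sinh_eq, show -(t*((k:ℝ) + 1)) = -(t*((k:ℝ) + 1)/2) + -(t*((k:ℝ) + 1)/2) by ring,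
          Real.exp_add]
        have : Real.exp (-(t*((k:ℝ) + 1)/2)) * Real.exp (t*((k:ℝ) + 1)/2) = 1 := by
          rw [← Real.exp_add]; simp
        linear_combination -this
      have h1 := sinh_ge (u := t * ((k:ℝ) + 1) / 2) (by positivity)
      have hp : 0 < t * ((k:ℝ) + 1) / 2 := by positivity
      have hp' := lt_of_lt_of_le hp h1
      rw [e]
      field_simp
    rw [e] at h
    have hfun : (fun n => f n k) = fun i : ℕ => Real.exp (-(t * ((k:ℝ) + 1) / 2)) / ((k:ℝ) + 1)
        * Real.exp (-(t * ((k:ℝ) + 1))) ^ i := by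
      funext n
      simp only [f]
      rw [div_mul_eq_mul_div, ← Real.exp_nat_mul, ← Real.exp_nat_mul, ← Real.exp_add]
      congr 2
      push_cast
      ring
    rw [hfun]
    exact h
  have hsum : Summable (Function.uncurry f) := by
    refine (summable_prod_of_nonneg (f := Function.uncurry f) (fun p => hf0 p.1 p.2)).2 ⟨fun n => (hrow n).summable, ?_⟩
    refine ((qA_summable_log ht (1/2)).neg).congr fun n => ?_
    exact (hrow n).tsum_eq.symm
  have hc := hsum.tsum_comm
  rw [tsum_congr (fun k => (hcol k).tsum_eq), tsum_congr (fun n => (hrow n).tsum_eq), tsum_neg] at hc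
  rw [hc, neg_neg]

lemma lead_tendsto :
    Tendsto (fun t : ℝ => t * Real.log (qA t (1/2))) (𝓝[>] 0) (𝓝 (-(π ^ 2 / 6))) := by
  have hz : ∑' k : ℕ, 1 / ((k:ℝ) + 1) ^ 2 = π ^ 2 / 6 := by
    have := hasSum_zeta_two.tsum_eq
    rw [hasSum_zeta_two.summable.tsum_eq_zero_add] at this
    simpa using this
  have h : Tendsto (fun t : ℝ => ∑' k : ℕ,
      t / (2 * ((k:ℝ) + 1) * Real.sinh (t * ((k:ℝ) + 1) / 2))) (𝓝[>] 0)
      (𝓝 (∑' k : ℕ, 1 / ((k:ℝ) + 1) ^ 2)) := by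
    refine tendsto_tsum_of_dominated_convergence summable_inv_sq ?_ ?_
    · intro k
      have h1 := ((sinh_div_tendsto (((k:ℝ) + 1)/2)).inv₀ (by positivity)).mul_const (1 / (2 * ((k:ℝ)+1)))
      have e : (((k:ℝ) + 1)/2)⁻¹ * (1 / (2 * ((k:ℝ)+1))) = 1 / ((k:ℝ) + 1) ^ 2 := by field_simp
      rw [e] at h1
      refine h1.congr fun t => ?_
      rw [inv_div, div_mul_div_comm, mul_one, mul_comm (Real.sinh _), ← mul_div_assoc]
    · filter_upwards [self_mem_nhdsWithin] with t ht k
      have ht : 0 < t := ht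
      have h1 := sinh_ge (u := t * ((k:ℝ) + 1) / 2) (by positivity)
      have hp : 0 < t * ((k:ℝ) + 1) / 2 := by positivity
      have hp' := lt_of_lt_of_le hp h1
      rw [Real.norm_of_nonneg (by positivity)]
      calc _ ≤ t / (2 * ((k:ℝ) + 1) * (t * ((k:ℝ) + 1) / 2)) := by gcongr
        _ = _ := by field_simp
  rw [hz] at h
  refine h.neg.congr' ?_
  filter_upwards [self_mem_nhdsWithin] with t ht
  rw [log_qA_half ht, mul_neg, ← tsum_mul_left]
  congr 1
  refine tsum_congr fun k => ?_
  ring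

lemma log_half_tendsto :
    Tendsto (fun t : ℝ => Real.log (qA t (1/2)) + π ^ 2 / (6 * t) - Real.log 2 / 2)
      (𝓝[>] 0) (𝓝 0) := by
  apply iter_lemma
  · have hid : Tendsto (fun t : ℝ => t) (𝓝[>] 0) (𝓝 0) := tendsto_id.mono_left nhdsWithin_le_nhds
    have h := (lead_tendsto.add_const (π ^ 2 / 6)).sub (hid.mul_const (Real.log 2 / 2))
    simp only [neg_add_cancel, zero_mul, sub_zero] at h
    refine h.congr' ?_
    filter_upwards [self_mem_nhdsWithin] with t ht
    have ht : t ≠ 0 := ne_of_gt ht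
    field_simp
  · have h := ratio_tendsto (x := 1/4) (by norm_num) (by norm_num)
    have e : Real.sin (π * (1/4)) = Real.sqrt 2 / 2 := by rw [mul_one_div, Real.sin_pi_div_four]
    rw [e] at h
    have h2 := (h.log (by positivity)).add_const (Real.log 2 / 2)
    have e2 : Real.log (Real.sqrt 2 / 2) + Real.log 2 / 2 = 0 := by
      rw [Real.log_div (by positivity) (by norm_num), Real.log_sqrt (by norm_num)]; ring
    rw [e2] at h2
    refine h2.congr' ?_
    filter_upwards [self_mem_nhdsWithin] with t ht
    have ht : 0 < t := ht
    have p1 := qA_pos ht (show (0:ℝ) < 1/2 by norm_num)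
    have p2 := qA_pos (half_pos ht) (show (0:ℝ) < 1/2 by norm_num)
    rw [show (1:ℝ) - 1/4 = 3/4 by norm_num, qA_dup ht, Real.log_div p2.ne' (by positivity),
      Real.log_pow]
    push_cast
    field_simp
    ring

lemma main_t {x : ℝ} (hx0 : 0 < x) (hx1 : x < 1) :
    Tendsto (fun t : ℝ => qA t x * qA t (1 - x) / (2 * Real.sin (π * x) * Real.exp (-(π ^ 2 / (3 * t)))
      * Real.exp (-t * (-(1 / 6 - x + x ^ 2) / 2)))) (𝓝[>] 0) (𝓝 1) := by
  have hs : 0 < Real.sin (π * x) :=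
    Real.sin_pos_of_pos_of_lt_pi (by positivity) (by nlinarith [Real.pi_pos])
  have hid : Tendsto (fun t : ℝ => Real.exp (-(-t * (-(1 / 6 - x + x ^ 2) / 2)))) (𝓝[>] 0) (𝓝 1) := by
    have : Continuous (fun t : ℝ => Real.exp (-(-t * (-(1 / 6 - x + x ^ 2) / 2)))) := by fun_prop
    have h := this.tendsto 0
    simp only [neg_zero, zero_mul, Real.exp_zero] at h
    exact h.mono_left nhdsWithin_le_nhds
  have h1 := (log_half_tendsto.const_mul 2).rexp
  have h := (((ratio_tendsto hx0 hx1).mul h1).mul hid).div_const (Real.sin (π * x))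
  simp only [mul_zero, Real.exp_zero, mul_one, div_self hs.ne'] at h
  refine h.congr' ?_
  filter_upwards [self_mem_nhdsWithin] with t ht
  have ht : 0 < t := ht
  have p1 := qA_pos ht (show (0:ℝ) < 1/2 by norm_num)
  have e : Real.exp (2 * (Real.log (qA t (1/2)) + π ^ 2 / (6 * t) - Real.log 2 / 2))
      = qA t (1/2) ^ 2 * Real.exp (π ^ 2 / (3 * t)) / 2 := by
    rw [show 2 * (Real.log (qA t (1/2)) + π ^ 2 / (6 * t) - Real.log 2 / 2)
      = Real.log (qA t (1/2)) + Real.log (qA t (1/2)) + π ^ 2 / (3 * t) - Real.log 2 by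
        field_simp; ring, Real.exp_sub, Real.exp_add, Real.exp_add, Real.exp_log p1,
        Real.exp_log two_pos, sq (qA t (1/2))]
  rw [e, Real.exp_neg, Real.exp_neg (π ^ 2 / (3 * t))]
  field_simp

theorem qPochhammer_reflection (x : ℝ) (hx0 : 0 < x) (hx1 : x < 1) :
    Tendsto (fun q : ℝ =>
        (∏' n : ℕ, (1 - q ^ ((n : ℝ) + x))) * (∏' n : ℕ, (1 - q ^ ((n : ℝ) + (1 - x)))) /
          (2 * Real.sin (Real.pi * x) * Real.exp (Real.pi ^ 2 / (3 * Real.log q)) *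
            q ^ (-(1 / 6 - x + x ^ 2) / 2)))
      (𝓝[Set.Ioo (0 : ℝ) 1] 1) (𝓝 1) := by
  have hlog : Tendsto (fun q : ℝ => -Real.log q) (𝓝[Set.Ioo (0 : ℝ) 1] 1) (𝓝[>] 0) := by
    rw [tendsto_nhdsWithin_iff]
    constructor
    · have := (Real.continuousAt_log (one_ne_zero)).neg.tendsto
      rw [Pi.neg_apply, Real.log_one, neg_zero] at this
      exact this.mono_left nhdsWithin_le_nhds
    · filter_upwards [self_mem_nhdsWithin] with q hq
      have := Real.log_neg hq.1 hq.2
      simp only [Set.mem_Ioi]; linarith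
  refine ((main_t hx0 hx1).comp hlog).congr' ?_
  filter_upwards [self_mem_nhdsWithin] with q hq
  have e : ∀ y : ℝ, qA (-Real.log q) y = ∏' n : ℕ, (1 - q ^ ((n : ℝ) + y)) := by
    intro y
    refine tprod_congr fun n => ?_
    rw [Real.rpow_def_of_pos hq.1]
    congr 2; ring
  simp only [Function.comp_apply, e]
  rw [Real.rpow_def_of_pos hq.1 (-(1 / 6 - x + x ^ 2) / 2), neg_neg, mul_neg, div_neg, neg_neg]
end

section
/- Fix x ∈ ℝ with 0 < x ≤ 1 and fix N ∈ ℕ with N ≥ 3. Then, as q → 1⁻ (with q ∈ (0,1)), Γ_q(x) = Γ(x) · ( (log q)/(q−1) · q^(x/4) )^(x−1) · exp( −∑_{k=3}^{N} (ζ(2−k)/k!)·B_k(x)·(log q)^(k−1) ) · (1 + O((log(1/q))^N)). -/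
open Filter Topology Asymptotics Finset Real

/-- The q-gamma function `Γ_q(x) = (1-q)^{1-x} (q;q)_∞ / (q^x;q)_∞`. -/
noncomputable def qGamma (q x : ℝ) : ℝ :=
  (1 - q) ^ (1 - x) * (∏' n : ℕ, (1 - q ^ (n + 1))) / ∏' n : ℕ, (1 - q ^ ((n : ℝ) + x))


theorem em_bound (K : ℕ) : ∀ (F : ℕ → ℝ → ℝ) (_ : ∀ k u, HasDerivAt (F k) (F (k+1) u) u) (C : ℝ)
    (_ : ∀ u ∈ Set.Icc (0:ℝ) 1, |F K u| ≤ C), ∀ x ∈ Set.Icc (0:ℝ) 1,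
    |F 0 x - (∫ u in (0:ℝ)..1, F 0 u) - ∑ j ∈ Finset.range K,
      bernoulliFun (j+1) x / ((j+1).factorial : ℝ) * (F j 1 - F j 0)| ≤ 2 * C := by
  induction K with
  | zero =>
    intro F hF C hC x hx
    have h1 : ‖∫ u in (0:ℝ)..1, F 0 u‖ ≤ C * |1 - 0| := by
      apply intervalIntegral.norm_integral_le_of_norm_le_const
      intro u hu
      rw [Set.uIoc_of_le zero_le_one] at hu
      exact hC u ⟨hu.1.le, hu.2⟩
    have h2 := hC x hx
    simp only [Finset.range_zero, Finset.sum_empty, sub_zero]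
    calc |F 0 x - ∫ u in (0:ℝ)..1, F 0 u| ≤ |F 0 x| + |∫ u in (0:ℝ)..1, F 0 u| := abs_sub _ _
      _ ≤ 2 * C := by
        rw [Real.norm_eq_abs] at h1
        simp at h1
        linarith
  | succ K ih =>
    intro F hF C hC x hx
    have ih' := ih (fun k => F (k+1)) (fun k u => hF (k+1) u) C hC
    have hcont : ∀ k, Continuous (F k) := fun k =>
      continuous_iff_continuousAt.2 fun u => (hF k u).continuousAt
    set h : ℝ → ℝ := fun x => F 0 x - (∫ u in (0:ℝ)..1, F 0 u) - ∑ j ∈ Finset.range (K+1),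
      bernoulliFun (j+1) x / ((j+1).factorial : ℝ) * (F j 1 - F j 0) with hh
    have hI : ∫ u in (0:ℝ)..1, F 1 u = F 0 1 - F 0 0 :=
      intervalIntegral.integral_eq_sub_of_hasDerivAt (fun u _ => hF 0 u)
        ((hcont 1).intervalIntegrable _ _)
    have hder : ∀ y, HasDerivAt h (F 1 y - (∫ u in (0:ℝ)..1, F 1 u) - ∑ j ∈ Finset.range K,
      bernoulliFun (j+1) y / ((j+1).factorial : ℝ) * (F (j+1) 1 - F (j+1) 0)) y := by
      intro y
      have h1 : HasDerivAt (fun x => ∑ j ∈ Finset.range (K+1),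
          bernoulliFun (j+1) x / ((j+1).factorial : ℝ) * (F j 1 - F j 0))
          (∑ j ∈ Finset.range (K+1), bernoulliFun j y / (j.factorial : ℝ) * (F j 1 - F j 0)) y := by
        apply HasDerivAt.fun_sum
        intro j _
        have := ((hasDerivAt_bernoulliFun (j+1) y).div_const ((j+1).factorial : ℝ)).mul_const
          (F j 1 - F j 0)
        refine this.congr_deriv ?_
        rw [Nat.factorial_succ, Nat.add_sub_cancel]
        have : ((j:ℝ)+1) ≠ 0 := by positivity
        push_cast
        field_simp
      refine (((hF 0 y).sub_const _).sub h1).congr_deriv ?_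
      rw [Finset.sum_range_succ', hI]
      simp
      ring
    have hlip : ∀ y ∈ Set.Icc (0:ℝ) 1, |h x - h y| ≤ 2 * C := by
      intro y hy
      have := Convex.norm_image_sub_le_of_norm_hasDerivWithin_le (f := h) (s := Set.Icc (0:ℝ) 1)
        (fun z _ => (hder z).hasDerivWithinAt) (C := 2 * C) (fun z hz => ih' z hz)
        (convex_Icc 0 1) hy hx
      have h3 : ‖x - y‖ ≤ 1 := by
        rw [Real.norm_eq_abs, abs_le]; constructor <;> linarith [hx.1, hx.2, hy.1, hy.2]
      have h4 : 0 ≤ 2 * C := le_trans (abs_nonneg _) (ih' x hx)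
      calc |h x - h y| ≤ 2 * C * ‖x - y‖ := this
        _ ≤ 2 * C * 1 := by gcongr
        _ = 2 * C := mul_one _
    have hch : Continuous h := continuous_iff_continuousAt.2 fun u => (hder u).continuousAt
    have hint : ∫ y in (0:ℝ)..1, h y = 0 := by
      simp only [hh]
      rw [intervalIntegral.integral_sub, intervalIntegral.integral_sub,
        intervalIntegral.integral_finsetSum]
      · simp [intervalIntegral.integral_mul_const, intervalIntegral.integral_div,
          integral_bernoulliFun_eq_zero]
      · intro j _
        apply Continuous.intervalIntegrable
        fun_prop
      · exact (hcont 0).intervalIntegrable _ _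
      · exact continuous_const.intervalIntegrable _ _
      · exact ((hcont 0).sub continuous_const).intervalIntegrable _ _
      · apply Continuous.intervalIntegrable
        fun_prop
    have hrep : h x = ∫ y in (0:ℝ)..1, (h x - h y) := by
      rw [intervalIntegral.integral_sub (continuous_const.intervalIntegrable _ _)
        (hch.intervalIntegrable _ _), hint]
      simp
    change |h x| ≤ _
    rw [hrep]
    have : ‖∫ y in (0:ℝ)..1, (h x - h y)‖ ≤ 2 * C * |1 - 0| := by
      apply intervalIntegral.norm_integral_le_of_norm_le_const
      intro u hu
      rw [Set.uIoc_of_le zero_le_one] at hu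
      exact hlip u ⟨hu.1.le, hu.2⟩
    simpa using this

noncomputable def GQ (u : ℝ) : ℝ := dslope (fun v : ℝ => 1 - Real.exp (-v)) 0 u

theorem GQ_mul (u : ℝ) : u * GQ u = 1 - Real.exp (-u) := by
  have := sub_smul_dslope (fun v : ℝ => 1 - Real.exp (-v)) 0 u
  simpa [GQ] using this

theorem GQ_zero : GQ 0 = 1 := by
  have h : HasDerivAt (fun v : ℝ => 1 - Real.exp (-v)) 1 0 := by
    have := ((hasDerivAt_neg (0:ℝ)).exp).const_sub 1
    simpa using this
  rw [GQ, dslope_same, h.deriv]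

theorem GQ_pos (u : ℝ) : 0 < GQ u := by
  rcases lt_trichotomy u 0 with h | h | h
  · have h1 := GQ_mul u
    have h2 : 1 - Real.exp (-u) < 0 := by
      have := Real.one_lt_exp_iff.2 (by linarith : 0 < -u); linarith
    by_contra h3
    nlinarith [mul_nonneg_of_nonpos_of_nonpos h.le (not_lt.1 h3)]
  · rw [h, GQ_zero]; norm_num
  · have h1 := GQ_mul u
    have h2 : 0 < 1 - Real.exp (-u) := by
      have := Real.exp_lt_one_iff.2 (by linarith : -u < 0); linarith
    by_contra h3
    nlinarith [mul_nonpos_of_nonneg_of_nonpos h.le (not_lt.1 h3)]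

theorem GQ_analytic (u : ℝ) : AnalyticAt ℝ GQ u := by
  have hf : ∀ u, AnalyticAt ℝ (fun v : ℝ => 1 - Real.exp (-v)) u := by
    intro u
    exact analyticAt_const.sub (analyticAt_id.neg.rexp)
  by_cases h : u = 0
  · subst h
    obtain ⟨p, hp⟩ := hf 0
    exact ⟨_, hp.has_fpower_series_dslope_fslope⟩
  · have : AnalyticAt ℝ (fun v : ℝ => (1 - Real.exp (-v)) / v) u := (hf u).div analyticAt_id h
    apply this.congr
    filter_upwards [isOpen_ne.mem_nhds h] with v hv
    rw [← GQ_mul, mul_div_cancel_left₀ _ hv]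

noncomputable def gQ (u : ℝ) : ℝ := Real.log (GQ u)

theorem gQ_contDiff : ContDiff ℝ ⊤ gQ := by
  have : AnalyticOnNhd ℝ gQ Set.univ := fun u _ => (GQ_analytic u).log (GQ_pos u)
  exact contDiffOn_univ.1 this.contDiffOn_of_completeSpace

theorem gQ_hasDeriv (k : ℕ) (u : ℝ) :
    HasDerivAt (iteratedDeriv k gQ) (iteratedDeriv (k+1) gQ u) u := by
  rw [iteratedDeriv_succ]
  exact (gQ_contDiff.differentiable_iteratedDeriv k (by exact WithTop.coe_lt_top _) u).hasDerivAt

theorem gQ_eq (u : ℝ) (hu : 0 < u) : gQ u = Real.log (1 - Real.exp (-u)) - Real.log u := by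
  rw [← GQ_mul, Real.log_mul hu.ne' (GQ_pos u).ne', gQ]; ring

theorem gQ_deriv_eq (u : ℝ) : (Real.exp u - 1) * (1 + u * deriv gQ u) = u := by
  have hG : HasDerivAt GQ (deriv GQ u) u := (GQ_analytic u).differentiableAt.hasDerivAt
  have h1 : HasDerivAt gQ (deriv GQ u / GQ u) u := hG.log (GQ_pos u).ne'
  have h2 : HasDerivAt (fun u => u * GQ u) (1 * GQ u + u * deriv GQ u) u :=
    (hasDerivAt_id u).mul hG
  have h3 : HasDerivAt (fun u : ℝ => 1 - Real.exp (-u)) (Real.exp (-u)) u := by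
    have := ((hasDerivAt_neg u).exp).const_sub 1
    simpa using this
  rw [funext GQ_mul] at h2
  have h4 := h2.unique h3
  have h5 := GQ_mul u
  rw [h1.deriv]
  have hp := GQ_pos u
  have h6 : Real.exp u * Real.exp (-u) = 1 := by rw [← Real.exp_add]; simp
  have h7 : Real.exp u - 1 = Real.exp u * (u * GQ u) := by rw [h5, mul_sub, h6, mul_one]
  rw [h7]
  field_simp
  linear_combination u * Real.exp u * h4 + u * h6

open scoped ContDiff in
theorem gQ_taylor (n : ℕ) (hn : 1 ≤ n) : iteratedDeriv n gQ 0 = (bernoulli n : ℝ) / n := by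
  set h : ℝ → ℝ := (fun _ => 1) + (fun u => u) * deriv gQ with hh
  have hd : ContDiff ℝ ∞ (deriv gQ) := by
    have : ContDiff ℝ ∞ gQ := gQ_contDiff.of_le le_top
    exact (contDiff_infty_iff_deriv.1 this).2
  have hidd : ContDiff ℝ ∞ (fun u : ℝ => u) := contDiff_id
  have hhc : ContDiff ℝ ∞ h := contDiff_const.add (hidd.mul hd)
  have hexp : ContDiff ℝ ∞ (fun u : ℝ => Real.exp u - 1) := Real.contDiff_exp.sub contDiff_const
  have hprod : (fun u : ℝ => Real.exp u - 1) * h = fun u => u := by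
    ext u
    simpa [hh] using gQ_deriv_eq u
  have hid : ∀ n, iteratedDeriv n (fun u : ℝ => u) 0 = if n = 1 then 1 else 0 := by
    intro n
    exact iteratedDeriv_fun_id_zero
  have hex : ∀ n, iteratedDeriv n (fun u : ℝ => Real.exp u - 1) 0 = if n = 0 then 0 else 1 := by
    intro n
    rcases n with _ | n
    · simp
    · have : deriv (fun u : ℝ => Real.exp u - 1) = Real.exp := by
        ext u; simp
      rw [iteratedDeriv_succ', this, iteratedDeriv_eq_iterate, Real.iter_deriv_exp]; simp
  have hB : ∀ n, iteratedDeriv n h 0 = (bernoulli n : ℝ) := by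
    intro n
    induction n using Nat.strong_induction_on with
    | _ n ih =>
    have h1 : iteratedDeriv (n+1) ((fun u : ℝ => Real.exp u - 1) * h) 0 = _ :=
      iteratedDeriv_mul (hexp.contDiffAt.of_le (by exact_mod_cast le_top))
        (hhc.contDiffAt.of_le (by exact_mod_cast le_top))
    rw [hprod, hid, ← Finset.sum_range_reflect] at h1
    have h2 := sum_bernoulli (n+1)
    have h2' : ∑ k ∈ Finset.range (n+1), ((n+1).choose k : ℝ) * (bernoulli k : ℝ)
      = if n + 1 = 1 then 1 else 0 := by
      have := congrArg (Rat.cast : ℚ → ℝ) h2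
      rw [Rat.cast_sum] at this
      simp only [Rat.cast_mul, Rat.cast_natCast] at this
      rw [this]
      split_ifs <;> simp
    rw [Finset.sum_range_succ] at h1
    have h3 : ∑ j ∈ Finset.range (n+1), ((n+1).choose (n + 1 + 1 - 1 - j) : ℝ) *
        iteratedDeriv (n + 1 + 1 - 1 - j) (fun u : ℝ => Real.exp u - 1) 0 *
        iteratedDeriv (n + 1 - (n + 1 + 1 - 1 - j)) h 0
        = ∑ j ∈ Finset.range (n+1), ((n+1).choose j : ℝ) * iteratedDeriv j h 0 := by
      apply Finset.sum_congr rfl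
      intro j hj
      rw [Finset.mem_range] at hj
      rw [hex, if_neg (by omega), mul_one, show n + 1 + 1 - 1 - j = n + 1 - j by omega,
        Nat.choose_symm (by omega), show n + 1 - (n + 1 - j) = j by omega]
    rw [h3] at h1
    simp only [hex, Nat.add_sub_cancel, Nat.sub_self, if_true, mul_zero, zero_mul, add_zero] at h1
    rw [h1, Finset.sum_range_succ, Finset.sum_range_succ] at h2'
    have h4 : ∑ k ∈ Finset.range n, ((n+1).choose k : ℝ) * (bernoulli k : ℝ) =
        ∑ k ∈ Finset.range n, ((n+1).choose k : ℝ) * iteratedDeriv k h 0 := by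
      apply Finset.sum_congr rfl
      intro k hk
      rw [ih k (Finset.mem_range.1 hk)]
    rw [h4] at h2'
    have h5 : ((n+1).choose n : ℝ) ≠ 0 := by
      exact_mod_cast (Nat.choose_pos (Nat.le_succ n)).ne'
    have h6 := add_left_cancel h2'
    exact (mul_left_cancel₀ h5 h6).symm
  obtain ⟨m, rfl⟩ : ∃ m, n = m + 1 := ⟨n - 1, by omega⟩
  have h1 : iteratedDeriv (m+1) h 0 = (m+1) * iteratedDeriv (m+1) gQ 0 := by
    have h2 : iteratedDeriv (m+1) h 0 = iteratedDeriv (m+1) ((fun u : ℝ => u) * deriv gQ) 0 := by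
      have hmul : ContDiff ℝ ∞ ((fun u : ℝ => u) * deriv gQ) := hidd.mul hd
      rw [hh, iteratedDeriv_add contDiff_const.contDiffAt
        (hmul.contDiffAt.of_le (by exact_mod_cast le_top)), iteratedDeriv_const]
      simp
    rw [h2, iteratedDeriv_mul (hidd.contDiffAt.of_le (by exact_mod_cast le_top))
        (hd.contDiffAt.of_le (by exact_mod_cast le_top)), Finset.sum_eq_single 1]
    · rw [hid, iteratedDeriv_succ' (n := m)]; simp
    · intro b _ hb
      rw [hid, if_neg hb]; simp
    · simp
  rw [← hB, h1]
  push_cast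
  field_simp

theorem gQ_formula (k : ℕ) : ∃ p : Polynomial ℝ, ∀ u : ℝ, 0 < u →
    iteratedDeriv (k+1) gQ u = (Real.exp u - 1)⁻¹ * p.eval (Real.exp u - 1)⁻¹
      + (-1) ^ (k+1) * (k.factorial : ℝ) * (u ^ (k+1))⁻¹ := by
  induction k with
  | zero =>
    refine ⟨1, fun u hu => ?_⟩
    have h := gQ_deriv_eq u
    have h1 : 0 < Real.exp u - 1 := by
      have := Real.one_lt_exp_iff.2 hu; linarith
    rw [zero_add, iteratedDeriv_one]
    simp
    field_simp
    linear_combination h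
  | succ k ih =>
    obtain ⟨p, hp⟩ := ih
    refine ⟨-(1 + Polynomial.X) * (p + Polynomial.X * p.derivative), fun u hu => ?_⟩
    have h1 : 0 < Real.exp u - 1 := by
      have := Real.one_lt_exp_iff.2 hu; linarith
    have hw : HasDerivAt (fun u : ℝ => (Real.exp u - 1)⁻¹)
        (-((Real.exp u - 1)⁻¹ * (1 + (Real.exp u - 1)⁻¹))) u := by
      have := ((Real.hasDerivAt_exp u).sub_const 1).fun_inv h1.ne'
      refine this.congr_deriv ?_
      field_simp
      ring
    have hpw : HasDerivAt (fun u : ℝ => p.eval (Real.exp u - 1)⁻¹) _ u :=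
      HasDerivAt.comp (h₂ := fun w => p.eval w) u (p.hasDerivAt ((Real.exp u - 1)⁻¹)) hw
    have hu' : HasDerivAt (fun u : ℝ => (u ^ (k+1))⁻¹) (-((k+1) * (u ^ (k+2))⁻¹)) u := by
      have := (hasDerivAt_pow (k+1) u).fun_inv (pow_ne_zero _ hu.ne')
      refine this.congr_deriv ?_
      rw [Nat.add_sub_cancel]
      push_cast
      field_simp
      ring
    have htot := (hw.fun_mul hpw).fun_add (hu'.const_mul ((-1) ^ (k+1) * (k.factorial : ℝ)))
    have heq : iteratedDeriv (k+1) gQ =ᶠ[𝓝 u] fun u => (Real.exp u - 1)⁻¹ * p.eval (Real.exp u - 1)⁻¹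
      + (-1) ^ (k+1) * (k.factorial : ℝ) * (u ^ (k+1))⁻¹ := by
      filter_upwards [lt_mem_nhds hu] with v hv using hp v hv
    rw [(gQ_hasDeriv (k+1) u).unique (htot.congr_of_eventuallyEq heq)]
    simp only [Polynomial.eval_mul, Polynomial.eval_neg, Polynomial.eval_add, Polynomial.eval_one,
      Polynomial.eval_X, Nat.factorial_succ]
    push_cast
    ring

theorem gQ_bound_large (k : ℕ) : ∃ C : ℝ, 0 ≤ C ∧ ∀ u : ℝ, 1 ≤ u →
    |iteratedDeriv (k+1) gQ u| ≤ C / u ^ 2 + (k.factorial : ℝ) / u ^ (k+1) := by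
  obtain ⟨p, hp⟩ := gQ_formula k
  obtain ⟨P, hP⟩ := (isCompact_Icc (a := (0:ℝ)) (b := 1)).exists_bound_of_continuousOn
    (f := fun w => p.eval w) p.continuous.continuousOn
  have hP0 : 0 ≤ P := (norm_nonneg _).trans (hP 0 ⟨le_refl _, zero_le_one⟩)
  refine ⟨2 * P, by positivity, fun u hu => ?_⟩
  have hu0 : 0 < u := by linarith
  have h1 : u ^ 2 / 2 ≤ Real.exp u - 1 := by
    have := Real.quadratic_le_exp_of_nonneg hu0.le; linarith
  have h2 : 1 ≤ Real.exp u - 1 := by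
    have := Real.add_one_le_exp u; linarith
  have h3 : (Real.exp u - 1)⁻¹ ≤ 2 / u ^ 2 := by
    rw [← inv_div]
    exact inv_anti₀ (by positivity) h1
  have h4 : (Real.exp u - 1)⁻¹ ≤ 1 := inv_le_one_of_one_le₀ h2
  have h5 : 0 ≤ (Real.exp u - 1)⁻¹ := inv_nonneg.2 (by linarith)
  rw [hp u hu0]
  refine (abs_add_le _ _).trans (add_le_add ?_ ?_)
  · rw [abs_mul, abs_of_nonneg h5]
    calc _ ≤ 2 / u ^ 2 * P := mul_le_mul h3 (hP _ ⟨h5, h4⟩) (abs_nonneg _) (by positivity)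
      _ = _ := by ring
  · rw [abs_mul, abs_mul, abs_pow, abs_neg, abs_one, one_pow, one_mul, Nat.abs_cast,
      abs_of_nonneg (by positivity : 0 ≤ (u ^ (k+1))⁻¹)]
    rfl

theorem gQ_bound (k : ℕ) : ∃ C : ℝ, 0 ≤ C ∧ ∀ u : ℝ, 0 ≤ u →
    |iteratedDeriv (k+2) gQ u| ≤ C / (1 + u ^ 2) := by
  obtain ⟨C, hC0, hC⟩ := gQ_bound_large (k+1)
  have hcont : Continuous (iteratedDeriv (k+2) gQ) :=
    continuous_iff_continuousAt.2 fun u => (gQ_hasDeriv (k+2) u).continuousAt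
  obtain ⟨P, hP⟩ := (isCompact_Icc (a := (0:ℝ)) (b := 1)).exists_bound_of_continuousOn
    hcont.continuousOn
  have hP0 : 0 ≤ P := (norm_nonneg _).trans (hP 0 ⟨le_refl _, zero_le_one⟩)
  set f : ℝ := ((k+1).factorial : ℝ) with hf
  have hf0 : 0 ≤ f := by positivity
  refine ⟨2 * (P + C + f), by positivity, fun u hu => ?_⟩
  rw [le_div_iff₀ (by positivity)]
  rcases le_total u 1 with h | h
  · have h1 : |iteratedDeriv (k+2) gQ u| ≤ P := hP u ⟨hu, h⟩
    calc |iteratedDeriv (k+2) gQ u| * (1 + u ^ 2) ≤ P * 2 := by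
          gcongr; nlinarith
      _ ≤ _ := by linarith
  · have h1 := hC u h
    have hu0 : 0 < u := by linarith
    have h2 : f / u ^ (k+1+1) ≤ f / u ^ 2 := by
      gcongr
      all_goals first | exact h | omega
    have h3 : |iteratedDeriv (k+2) gQ u| ≤ (C + f) / u ^ 2 := by
      rw [add_div]; exact h1.trans (add_le_add_right h2 _)
    calc |iteratedDeriv (k+2) gQ u| * (1 + u ^ 2) ≤ (C + f) / u ^ 2 * (2 * u ^ 2) := by
          gcongr; nlinarith
      _ = 2 * (C + f) := by field_simp
      _ ≤ _ := by linarith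

theorem gQ_tendsto (k : ℕ) : Tendsto (iteratedDeriv (k+1) gQ) atTop (𝓝 0) := by
  obtain ⟨C, hC0, hC⟩ := gQ_bound_large k
  have h1 : Tendsto (fun u : ℝ => C / u ^ 2 + (k.factorial : ℝ) / u ^ (k+1)) atTop (𝓝 (0 + 0)) :=
    (tendsto_const_nhds.div_atTop (tendsto_pow_atTop (by norm_num))).add
      (tendsto_const_nhds.div_atTop (tendsto_pow_atTop (by omega)))
  rw [add_zero] at h1
  apply squeeze_zero_norm' _ h1
  filter_upwards [eventually_ge_atTop 1] with u hu using hC u hu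

theorem gQ_add_log_tendsto : Tendsto (fun u => gQ u + Real.log u) atTop (𝓝 0) := by
  have h1 : Tendsto (fun u : ℝ => Real.log (1 - Real.exp (-u))) atTop (𝓝 (Real.log (1 - 0))) :=
    ((Real.tendsto_exp_neg_atTop_nhds_zero).const_sub 1).log (by norm_num)
  rw [sub_zero, Real.log_one] at h1
  apply h1.congr'
  filter_upwards [eventually_gt_atTop 0] with u hu
  rw [gQ_eq u hu]; ring

theorem em_sum_s10 (N : ℕ) : ∃ C : ℝ, ∀ t : ℝ, 0 < t → t ≤ 1 → ∀ M : ℕ, ∀ y ∈ Set.Icc (0:ℝ) 1,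
    |∑ n ∈ Finset.range M, gQ (((n:ℝ) + y) * t)
      - ∑ n ∈ Finset.range M, (∫ u in (0:ℝ)..1, gQ (((n:ℝ) + u) * t))
      - ∑ j ∈ Finset.range (N+2), bernoulliFun (j+1) y / ((j+1).factorial : ℝ) *
        (t ^ j * (iteratedDeriv j gQ (M * t) - iteratedDeriv j gQ 0))| ≤ C * t ^ N := by
  obtain ⟨C, hC0, hC⟩ := gQ_bound N
  have hsum : Summable (fun n : ℕ => 1 / (1 + (n:ℝ) ^ 2)) := by
    have h := Real.summable_one_div_nat_pow.2 (by norm_num : 1 < 2)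
    apply (summable_nat_add_iff 1).1
    refine Summable.of_nonneg_of_le (fun n => by positivity) (fun n => ?_)
      ((summable_nat_add_iff 1).2 h)
    gcongr
    linarith
  refine ⟨2 * C * ∑' n : ℕ, 1 / (1 + (n:ℝ) ^ 2), fun t ht ht1 M y hy => ?_⟩
  have key : ∀ n : ℕ, |gQ (((n:ℝ) + y) * t) - (∫ u in (0:ℝ)..1, gQ (((n:ℝ) + u) * t))
      - ∑ j ∈ Finset.range (N+2), bernoulliFun (j+1) y / ((j+1).factorial : ℝ) *
        (t ^ j * iteratedDeriv j gQ (((n:ℝ)+1) * t) - t ^ j * iteratedDeriv j gQ (((n:ℝ)+0) * t))|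
      ≤ 2 * (C * t ^ N * (1 / (1 + (n:ℝ) ^ 2))) := by
    intro n
    have := em_bound (N+2) (fun k u => t ^ k * iteratedDeriv k gQ (((n:ℝ) + u) * t)) ?_
      (C * t ^ N * (1 / (1 + (n:ℝ) ^ 2))) ?_ y hy
    · simpa using this
    · intro k u
      have h1 : HasDerivAt (fun u : ℝ => ((n:ℝ) + u) * t) (1 * t) u :=
        ((hasDerivAt_id u).const_add (n:ℝ)).mul_const t
      have h2 := ((gQ_hasDeriv k (((n:ℝ) + u) * t)).comp u h1).const_mul (t ^ k)
      refine h2.congr_deriv ?_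
      ring
    · intro u hu
      have h0 : 0 ≤ ((n:ℝ) + u) * t := mul_nonneg (add_nonneg (Nat.cast_nonneg n) hu.1) ht.le
      have h1 := hC _ h0
      rw [abs_mul, abs_of_nonneg (by positivity : 0 ≤ t ^ (N+2))]
      have h2 : C / (1 + (((n:ℝ) + u) * t) ^ 2) ≤ C / (1 + ((n:ℝ) * t) ^ 2) := by
        gcongr
        linarith [hu.1]
      have h3 : t ^ 2 / (1 + ((n:ℝ) * t) ^ 2) ≤ 1 / (1 + (n:ℝ) ^ 2) := by
        rw [div_le_div_iff₀ (by positivity) (by positivity)]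
        nlinarith [pow_le_one₀ ht.le ht1 (n := 2)]
      calc t ^ (N+2) * |iteratedDeriv (N+2) gQ (((n:ℝ) + u) * t)|
          ≤ t ^ (N+2) * (C / (1 + ((n:ℝ) * t) ^ 2)) := by gcongr; exact h1.trans h2
        _ = C * t ^ N * (t ^ 2 / (1 + ((n:ℝ) * t) ^ 2)) := by ring
        _ ≤ _ := by gcongr
  have hrew : ∑ n ∈ Finset.range M, gQ (((n:ℝ) + y) * t)
      - ∑ n ∈ Finset.range M, (∫ u in (0:ℝ)..1, gQ (((n:ℝ) + u) * t))
      - ∑ j ∈ Finset.range (N+2), bernoulliFun (j+1) y / ((j+1).factorial : ℝ) *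
        (t ^ j * (iteratedDeriv j gQ (M * t) - iteratedDeriv j gQ 0))
      = ∑ n ∈ Finset.range M, (gQ (((n:ℝ) + y) * t) - (∫ u in (0:ℝ)..1, gQ (((n:ℝ) + u) * t))
      - ∑ j ∈ Finset.range (N+2), bernoulliFun (j+1) y / ((j+1).factorial : ℝ) *
        (t ^ j * iteratedDeriv j gQ (((n:ℝ)+1) * t) - t ^ j * iteratedDeriv j gQ (((n:ℝ)+0) * t)))
      := by
    rw [Finset.sum_sub_distrib, Finset.sum_sub_distrib, Finset.sum_comm]
    congr 1
    apply Finset.sum_congr rfl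
    intro j _
    rw [← Finset.mul_sum]
    congr 1
    have := Finset.sum_range_sub (fun n : ℕ => t ^ j * iteratedDeriv j gQ ((n:ℝ) * t)) M
    push_cast at this
    simp only [add_zero]
    rw [this]
    simp [mul_sub]
  rw [hrew]
  calc _ ≤ ∑ n ∈ Finset.range M, 2 * (C * t ^ N * (1 / (1 + (n:ℝ) ^ 2))) :=
        (Finset.abs_sum_le_sum_abs _ _).trans (Finset.sum_le_sum fun n _ => key n)
    _ = 2 * C * t ^ N * ∑ n ∈ Finset.range M, (1 / (1 + (n:ℝ) ^ 2)) := by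
        rw [Finset.mul_sum]; apply Finset.sum_congr rfl; intros; ring
    _ ≤ 2 * C * t ^ N * ∑' n : ℕ, 1 / (1 + (n:ℝ) ^ 2) := by
        gcongr
        exact hsum.sum_le_tsum _ (fun n _ => by positivity)
    _ = _ := by ring

theorem log_qprod (t y : ℝ) (ht : 0 < t) (hy : 0 < y) :
    0 < (∏' n : ℕ, (1 - Real.exp (-(((n:ℝ) + y) * t)))) ∧
    Tendsto (fun M => ∑ n ∈ Finset.range M, Real.log (1 - Real.exp (-(((n:ℝ) + y) * t)))) atTop
      (𝓝 (Real.log (∏' n : ℕ, (1 - Real.exp (-(((n:ℝ) + y) * t)))))) := by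
  have hpos : ∀ n : ℕ, 0 < 1 - Real.exp (-(((n:ℝ) + y) * t)) := by
    intro n
    have : 0 < ((n:ℝ) + y) * t := by positivity
    have := Real.exp_lt_one_iff.2 (by linarith : -(((n:ℝ) + y) * t) < 0)
    linarith
  have hs : Summable (fun n : ℕ => -Real.exp (-(((n:ℝ) + y) * t))) := by
    apply Summable.neg
    have h1 : Summable (fun n : ℕ => Real.exp (-t) ^ n) :=
      summable_geometric_of_lt_one (Real.exp_pos _).le (Real.exp_lt_one_iff.2 (by linarith))
    refine (h1.mul_left (Real.exp (-(y * t)))).congr fun n => ?_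
    rw [← Real.exp_nat_mul, ← Real.exp_add]
    congr 1
    ring
  have hl : Summable (fun n : ℕ => Real.log (1 - Real.exp (-(((n:ℝ) + y) * t)))) := by
    have := Real.summable_log_one_add_of_summable hs
    simpa [sub_eq_add_neg] using this
  have he := Real.rexp_tsum_eq_tprod hpos hl
  rw [← he]
  refine ⟨Real.exp_pos _, ?_⟩
  rw [Real.log_exp]
  exact hl.hasSum.tendsto_sum_nat

theorem gamma_lim (x : ℝ) (hx0 : 0 < x) :
    Tendsto (fun M : ℕ => ∑ n ∈ Finset.range M, (Real.log ((n:ℝ)+1) - Real.log ((n:ℝ)+x))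
      - (1 - x) * Real.log M) atTop (𝓝 (Real.log (Real.Gamma x))) := by
  rw [← tendsto_add_atTop_iff_nat 1]
  have h1 := (Real.BohrMollerup.tendsto_log_gamma hx0).add
    (Real.tendsto_log_nat_add_one_sub_log.const_mul x)
  rw [mul_zero, add_zero] at h1
  refine h1.congr fun n => ?_
  have h2 : ∀ n : ℕ, ∑ m ∈ Finset.range (n+1), Real.log ((m:ℝ)+1)
      = Real.log (n.factorial : ℝ) + Real.log ((n:ℝ)+1) := by
    intro n
    induction n with
    | zero => simp
    | succ n ih =>
      rw [Finset.sum_range_succ, ih, Nat.factorial_succ]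
      push_cast
      rw [Real.log_mul (by positivity) (by positivity)]
      ring
  rw [Finset.sum_sub_distrib, h2, Real.BohrMollerup.logGammaSeq]
  simp only [add_comm x]
  push_cast
  ring

theorem key_log (x : ℝ) (hx0 : 0 < x) (hx1 : x ≤ 1) (N : ℕ) : ∃ C : ℝ, ∀ t : ℝ, 0 < t → t ≤ 1 →
    |Real.log (∏' n : ℕ, (1 - Real.exp (-(((n:ℝ) + 1) * t))))
      - Real.log (∏' n : ℕ, (1 - Real.exp (-(((n:ℝ) + x) * t))))
      - (Real.log (Real.Gamma x) + (x - 1) * Real.log t + ∑ j ∈ Finset.range (N+1),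
        (bernoulliFun (j+2) x - bernoulliFun (j+2) 1) / ((j+2).factorial : ℝ) * t ^ (j+1) *
          ((bernoulli (j+1) : ℝ) / (j+1)))| ≤ C * t ^ N := by
  obtain ⟨C, hC⟩ := em_sum_s10 N
  refine ⟨2 * C, fun t ht ht1 => ?_⟩
  set a : ℕ → ℝ := fun M => ∑ n ∈ Finset.range M, Real.log (1 - Real.exp (-(((n:ℝ) + 1) * t)))
    - ∑ n ∈ Finset.range M, Real.log (1 - Real.exp (-(((n:ℝ) + x) * t))) with ha
  set b : ℕ → ℝ := fun M => ∑ n ∈ Finset.range M, (Real.log ((n:ℝ)+1) - Real.log ((n:ℝ)+x))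
    + ∑ j ∈ Finset.range (N+2), (bernoulliFun (j+1) 1 - bernoulliFun (j+1) x) /
        ((j+1).factorial : ℝ) *
        (t ^ j * (iteratedDeriv j gQ (M * t) - iteratedDeriv j gQ 0)) with hb
  have halim := (log_qprod t 1 ht one_pos).2.sub (log_qprod t x ht hx0).2
  have hMt : Tendsto (fun M : ℕ => (M:ℝ) * t) atTop atTop :=
    tendsto_natCast_atTop_atTop.atTop_mul_const ht
  have hblim : Tendsto b atTop (𝓝 (Real.log (Real.Gamma x) + (x - 1) * Real.log t +
      ∑ j ∈ Finset.range (N+1),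
        (bernoulliFun (j+2) x - bernoulliFun (j+2) 1) / ((j+2).factorial : ℝ) * t ^ (j+1) *
          ((bernoulli (j+1) : ℝ) / (j+1)))) := by
    have h1 : Tendsto (fun M : ℕ => ∑ j ∈ Finset.range (N+1),
        (bernoulliFun (j+2) 1 - bernoulliFun (j+2) x) / ((j+2).factorial : ℝ) *
        (t ^ (j+1) * (iteratedDeriv (j+1) gQ (M * t) - iteratedDeriv (j+1) gQ 0))) atTop
        (𝓝 (∑ j ∈ Finset.range (N+1),
        (bernoulliFun (j+2) 1 - bernoulliFun (j+2) x) / ((j+2).factorial : ℝ) *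
        (t ^ (j+1) * (0 - iteratedDeriv (j+1) gQ 0)))) := by
      apply tendsto_finsetSum
      intro j _
      exact ((((gQ_tendsto j).comp hMt).sub_const _).const_mul _).const_mul _
    have h2 := (((gamma_lim x hx0).add_const ((x - 1) * Real.log t)).add
      ((gQ_add_log_tendsto.comp hMt).const_mul (1 - x))).add h1
    have h3 : Real.log (Real.Gamma x) + (x - 1) * Real.log t +
      ∑ j ∈ Finset.range (N+1),
        (bernoulliFun (j+2) x - bernoulliFun (j+2) 1) / ((j+2).factorial : ℝ) * t ^ (j+1) *
          ((bernoulli (j+1) : ℝ) / (j+1)) = Real.log (Real.Gamma x) + (x - 1) * Real.log t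
          + (1 - x) * 0 + ∑ j ∈ Finset.range (N+1),
        (bernoulliFun (j+2) 1 - bernoulliFun (j+2) x) / ((j+2).factorial : ℝ) *
        (t ^ (j+1) * (0 - iteratedDeriv (j+1) gQ 0)) := by
      rw [mul_zero, add_zero]
      congr 1
      apply Finset.sum_congr rfl
      intro j _
      rw [gQ_taylor (j+1) (by omega)]
      push_cast
      ring
    rw [h3]
    apply h2.congr'
    filter_upwards [eventually_gt_atTop 0] with M hM
    have hM' : (0:ℝ) < M := by exact_mod_cast hM
    simp only [hb]
    rw [Finset.sum_range_succ' _ (N+1)]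
    have hg0 : gQ 0 = 0 := by rw [gQ, GQ_zero, Real.log_one]
    simp only [Function.comp, zero_add, iteratedDeriv_zero, hg0, bernoulliFun_one, pow_zero,
      Nat.factorial_one, Nat.cast_one, Real.log_mul hM'.ne' ht.ne', add_assoc, one_add_one_eq_two]
    ring
  have hab : ∀ M, |a M - b M| ≤ 2 * C * t ^ N := by
    intro M
    have e1 := hC t ht ht1 M 1 ⟨zero_le_one, le_refl _⟩
    have e2 := hC t ht ht1 M x ⟨hx0.le, hx1⟩
    have hl : ∀ y : ℝ, 0 < y → ∑ n ∈ Finset.range M, Real.log (1 - Real.exp (-(((n:ℝ) + y) * t)))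
        = ∑ n ∈ Finset.range M, Real.log ((n:ℝ) + y) + M * Real.log t
          + ∑ n ∈ Finset.range M, gQ (((n:ℝ) + y) * t) := by
      intro y hy
      have : (M:ℝ) * Real.log t = ∑ n ∈ Finset.range M, Real.log t := by simp
      rw [this, ← Finset.sum_add_distrib, ← Finset.sum_add_distrib]
      apply Finset.sum_congr rfl
      intro n _
      rw [gQ_eq _ (by positivity), Real.log_mul (by positivity) ht.ne']
      ring
    have hsplit : ∑ j ∈ Finset.range (N+2), (bernoulliFun (j+1) 1 - bernoulliFun (j+1) x) /
        ((j+1).factorial : ℝ) *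
        (t ^ j * (iteratedDeriv j gQ (M * t) - iteratedDeriv j gQ 0))
        = ∑ j ∈ Finset.range (N+2), bernoulliFun (j+1) 1 / ((j+1).factorial : ℝ) *
        (t ^ j * (iteratedDeriv j gQ (M * t) - iteratedDeriv j gQ 0))
        - ∑ j ∈ Finset.range (N+2), bernoulliFun (j+1) x / ((j+1).factorial : ℝ) *
        (t ^ j * (iteratedDeriv j gQ (M * t) - iteratedDeriv j gQ 0)) := by
      rw [← Finset.sum_sub_distrib]
      apply Finset.sum_congr rfl
      intros; ring
    simp only [ha, hb]
    rw [hl 1 one_pos, hl x hx0, hsplit, Finset.sum_sub_distrib]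
    rw [abs_le] at e1 e2 ⊢
    constructor <;> linarith [e1.1, e1.2, e2.1, e2.2]
  exact le_of_tendsto (halim.sub hblim).abs (Eventually.of_forall hab)

theorem key_log2 (x : ℝ) (hx0 : 0 < x) (hx1 : x ≤ 1) (N : ℕ) (hN : 3 ≤ N) :
    ∃ C : ℝ, ∀ t : ℝ, 0 < t → t ≤ 1 →
    |Real.log (∏' n : ℕ, (1 - Real.exp (-(((n:ℝ) + 1) * t))))
      - Real.log (∏' n : ℕ, (1 - Real.exp (-(((n:ℝ) + x) * t))))
      - (Real.log (Real.Gamma x) + (x - 1) * Real.log t - (x - 1) * (x / 4) * t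
        - ∑ k ∈ Finset.Icc 3 N, (-1) ^ (k - 2) * (bernoulli (k - 2 + 1) : ℝ) / ((k - 2 : ℕ) + 1)
          / (k.factorial : ℝ) * bernoulliFun k x * (-t) ^ (k - 1))| ≤ C * t ^ N := by
  obtain ⟨C, hC⟩ := key_log x hx0 hx1 N
  obtain ⟨m, rfl⟩ : ∃ m, N = m + 2 := ⟨N - 2, by omega⟩
  set T : ℕ → ℝ → ℝ := fun j t =>
    (bernoulliFun (j+2) x - bernoulliFun (j+2) 1) / ((j+2).factorial : ℝ) * t ^ (j+1) *
          ((bernoulli (j+1) : ℝ) / (j+1)) with hT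
  have hTb : ∀ j t, T j t = T j 1 * t ^ (j+1) := by intro j t; simp only [hT]; ring
  refine ⟨C + |T (m+1) 1| + |T (m+2) 1|, fun t ht ht1 => ?_⟩
  have h0 := hC t ht ht1
  change |_ - (_ + _ + ∑ j ∈ Finset.range (m+2+1), T j t)| ≤ _ at h0
  have hI : Finset.Icc 3 (m+2) = Finset.Ico 3 (m+3) := by
    ext k; simp only [Finset.mem_Icc, Finset.mem_Ico]; omega
  have hterm : ∀ i, T (i+1) t = -((-1) ^ (3 + i - 2) * (bernoulli (3 + i - 2 + 1) : ℝ) /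
      ((3 + i - 2 : ℕ) + 1) / ((3+i).factorial : ℝ) * bernoulliFun (3+i) x * (-t) ^ (3 + i - 1)) := by
    intro i
    rw [show 3 + i - 2 = i + 1 by omega, show 3 + i - 1 = i + 2 by omega,
      show 3 + i = i + 3 by omega]
    have hz : bernoulliFun (i+3) 1 * (bernoulli (i+2) : ℝ) = 0 := by
      rw [bernoulliFun_endpoints_eq_of_ne_one (by omega), bernoulliFun_eval_zero]
      rcases Nat.even_or_odd i with h | h
      · rw [bernoulli_eq_zero_of_odd (n := i + 3) (by grind) (by omega)]; simp
      · rw [bernoulli_eq_zero_of_odd (n := i + 2) (by grind) (by omega)]; simp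
    have hs : (-t) ^ (i+2) = -(-1) ^ (i+1) * t ^ (i+2) := by rw [neg_pow]; ring
    have hs2 : ((-1:ℝ) ^ (i+1)) * (-1) ^ (i+1) = 1 := by rw [← mul_pow]; simp
    simp only [hT]
    rw [hs, show i + 1 + 2 = i + 3 by omega, show i + 1 + 1 = i + 2 by omega]
    have hf : ((i+3).factorial : ℝ) ≠ 0 := by positivity
    have hi : ((i + 1 : ℕ) : ℝ) + 1 ≠ 0 := by positivity
    field_simp
    linear_combination (-1 : ℝ) * hz - (bernoulli (i+2) : ℝ) * bernoulliFun (i+3) x * hs2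
  rw [Finset.sum_range_succ, Finset.sum_range_succ, Finset.sum_range_succ'] at h0
  rw [hI, Finset.sum_Ico_eq_sum_range, show m + 3 - 3 = m by omega]
  have hsum : ∑ i ∈ Finset.range m, T (i+1) t = -∑ i ∈ Finset.range m,
      ((-1) ^ (3 + i - 2) * (bernoulli (3 + i - 2 + 1) : ℝ) /
      ((3 + i - 2 : ℕ) + 1) / ((3+i).factorial : ℝ) * bernoulliFun (3+i) x * (-t) ^ (3 + i - 1)) := by
    rw [← Finset.sum_neg_distrib]
    exact Finset.sum_congr rfl fun i _ => hterm i
  have hT0 : T 0 t = -((x - 1) * (x / 4) * t) := by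
    simp [hT, bernoulli_one]
    ring
  rw [hsum, hT0, hTb (m+1), hTb (m+2)] at h0
  have b1 : |T (m+1) 1 * t ^ (m+1+1)| ≤ |T (m+1) 1| * t ^ (m+2) := by
    rw [abs_mul, abs_of_nonneg (by positivity : 0 ≤ t ^ (m+1+1))]
  have b2 : |T (m+2) 1 * t ^ (m+2+1)| ≤ |T (m+2) 1| * t ^ (m+2) := by
    rw [abs_mul, abs_of_nonneg (by positivity : 0 ≤ t ^ (m+2+1))]
    gcongr ?_ * ?_
    exact pow_le_pow_of_le_one ht.le ht1 (by omega)
  rw [abs_le] at h0 b1 b2 ⊢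
  constructor <;> nlinarith [h0.1, h0.2, b1.1, b1.2, b2.1, b2.2]

/-- Asymptotic expansion of the q-gamma function near `q = 1`:
`Γ_q(x) = Γ(x) ((log q)/(q-1) · q^{x/4})^{x-1}
  exp(−∑_{k=3}^N (ζ(2-k)/k!) B_k(x) (log q)^{k-1}) (1 + O((log(1/q))^N))`. -/
theorem qGamma_asymptotic (x : ℝ) (hx0 : 0 < x) (hx1 : x ≤ 1) (N : ℕ) (hN : 3 ≤ N) :
    (fun q : ℝ =>
        ((qGamma q x : ℝ) : ℂ) /
          (((Real.Gamma x * (Real.log q / (q - 1) * q ^ (x / 4)) ^ (x - 1) : ℝ) : ℂ) *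
            Complex.exp (-∑ k ∈ Finset.Icc 3 N,
              riemannZeta (2 - (k : ℂ)) / (Nat.factorial k : ℂ) *
                ((Polynomial.aeval x (Polynomial.bernoulli k) : ℝ) : ℂ) *
                ((Real.log q : ℂ)) ^ (k - 1))) - 1)
      =O[𝓝[Set.Ioo (0 : ℝ) 1] 1] fun q : ℝ => (Real.log (1 / q)) ^ N := by
  obtain ⟨C, hC⟩ := key_log2 x hx0 hx1 N hN
  apply IsBigO.of_bound (|C| * Real.exp |C|)
  have hev : ∀ᶠ q : ℝ in 𝓝[Set.Ioo (0:ℝ) 1] 1, Real.exp (-1) < q :=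
    nhdsWithin_le_nhds (lt_mem_nhds (Real.exp_lt_one_iff.2 (by norm_num)))
  filter_upwards [hev, self_mem_nhdsWithin] with q hq1 hq
  obtain ⟨t, rfl⟩ : ∃ t, q = Real.exp (-t) := ⟨-Real.log q, by rw [neg_neg, Real.exp_log hq.1]⟩
  have ht : 0 < t := by
    have := Real.exp_lt_one_iff.1 hq.2; linarith
  have ht1 : t ≤ 1 := by
    have := Real.exp_lt_exp.1 hq1; linarith
  have hb := hC t ht ht1
  obtain ⟨hP1, -⟩ := log_qprod t 1 ht one_pos
  obtain ⟨hPx, -⟩ := log_qprod t x ht hx0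
  have hqG : qGamma (Real.exp (-t)) x = (1 - Real.exp (-t)) ^ (1 - x) *
      (∏' n : ℕ, (1 - Real.exp (-(((n:ℝ) + 1) * t)))) /
      (∏' n : ℕ, (1 - Real.exp (-(((n:ℝ) + x) * t)))) := by
    rw [qGamma]
    congr 1
    · congr 1
      apply tprod_congr
      intro n
      rw [← Real.exp_nat_mul]
      push_cast
      congr 2
      ring
    · apply tprod_congr
      intro n
      rw [← Real.exp_mul]
      congr 2
      ring
  set P1 := ∏' n : ℕ, (1 - Real.exp (-(((n:ℝ) + 1) * t)))
  set Px := ∏' n : ℕ, (1 - Real.exp (-(((n:ℝ) + x) * t)))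
  set Z : ℝ := ∑ k ∈ Finset.Icc 3 N, (-1) ^ (k - 2) * (bernoulli (k - 2 + 1) : ℝ) /
    ((k - 2 : ℕ) + 1) / (k.factorial : ℝ) * bernoulliFun k x * (-t) ^ (k - 1) with hZ
  have hZC : ∑ k ∈ Finset.Icc 3 N,
              riemannZeta (2 - (k : ℂ)) / (Nat.factorial k : ℂ) *
                ((Polynomial.aeval x (Polynomial.bernoulli k) : ℝ) : ℂ) *
                ((Real.log (Real.exp (-t)) : ℂ)) ^ (k - 1) = (Z : ℂ) := by
    rw [hZ, Complex.ofReal_sum]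
    apply Finset.sum_congr rfl
    intro k hk
    rw [Finset.mem_Icc] at hk
    have h1 : (2 : ℂ) - (k : ℂ) = -((k - 2 : ℕ) : ℂ) := by
      rw [Nat.cast_sub (by omega)]; push_cast; ring
    have h2 : Polynomial.aeval x (Polynomial.bernoulli k) = bernoulliFun k x := by
      rw [bernoulliFun, Polynomial.eval_map_algebraMap]
    rw [h1, riemannZeta_neg_nat_eq_bernoulli, h2, Real.log_exp]
    push_cast
    ring
  have hq1 : 0 < 1 - Real.exp (-t) := by linarith [hq.2]
  have hG : 0 < Real.Gamma x := Real.Gamma_pos_of_pos hx0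
  set r : ℝ := Real.log (Real.exp (-t)) / (Real.exp (-t) - 1) * Real.exp (-t) ^ (x / 4) with hr
  have hr' : r = t / (1 - Real.exp (-t)) * Real.exp (-t) ^ (x / 4) := by
    rw [hr, Real.log_exp, ← neg_div_neg_eq, neg_neg, neg_sub]
  have hr0 : 0 < r := by rw [hr']; positivity
  have hlr : Real.log r = Real.log t - Real.log (1 - Real.exp (-t)) - x / 4 * t := by
    rw [hr', Real.log_mul (by positivity) (by positivity), Real.log_div ht.ne' hq1.ne',
      Real.log_rpow (Real.exp_pos _), Real.log_exp]
    ring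
  have hqpos : 0 < qGamma (Real.exp (-t)) x := by rw [hqG]; positivity
  have hlq : Real.log (qGamma (Real.exp (-t)) x) =
      (1 - x) * Real.log (1 - Real.exp (-t)) + Real.log P1 - Real.log Px := by
    rw [hqG, Real.log_div (by positivity) hPx.ne', Real.log_mul (by positivity) hP1.ne',
      Real.log_rpow hq1]
  have hlm : Real.log (Real.Gamma x * r ^ (x - 1)) = Real.log (Real.Gamma x) +
      (x - 1) * Real.log r := by
    rw [Real.log_mul hG.ne' (by positivity), Real.log_rpow hr0]
  have hmpos : 0 < Real.Gamma x * r ^ (x - 1) := by positivity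
  set δ : ℝ := Real.log (qGamma (Real.exp (-t)) x) - Real.log (Real.Gamma x * r ^ (x - 1)) + Z
    with hδ
  have hδb : |δ| ≤ C * t ^ N := by
    convert hb using 2
    rw [hδ, hlq, hlm, hlr]
    ring
  have hexp : ((qGamma (Real.exp (-t)) x : ℝ) : ℂ) /
      (((Real.Gamma x * r ^ (x - 1) : ℝ) : ℂ) * Complex.exp (-(Z:ℂ))) = Complex.exp (δ : ℂ) := by
    have h1 : Real.exp δ = qGamma (Real.exp (-t)) x / (Real.Gamma x * r ^ (x - 1) * Real.exp (-Z)) := by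
      rw [hδ, Real.exp_add, Real.exp_sub, Real.exp_log hqpos, Real.exp_log hmpos, Real.exp_neg Z,
        ← div_div _ _ (Real.exp Z)⁻¹, div_inv_eq_mul]
    rw [← Complex.ofReal_exp, h1]
    push_cast
    rfl
  rw [hZC, hexp]
  have h1 := Complex.norm_exp_sub_sum_le_norm_mul_exp (δ : ℂ) 1
  simp only [Finset.sum_range_one, pow_zero, Nat.factorial_zero, Nat.cast_one, div_one, pow_one,
    Complex.norm_real, Real.norm_eq_abs] at h1
  have h2 : Real.log (1 / Real.exp (-t)) = t := by
    rw [one_div, ← Real.exp_neg, Real.log_exp, neg_neg]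
  rw [h2, Real.norm_eq_abs, abs_of_nonneg (by positivity : 0 ≤ t ^ N)]
  have h3 : |δ| ≤ |C| * t ^ N := hδb.trans (by gcongr; exact le_abs_self C)
  have h4 : |δ| ≤ |C| := h3.trans (mul_le_of_le_one_right (abs_nonneg _) (pow_le_one₀ ht.le ht1))
  calc _ ≤ |δ| * Real.exp |δ| := h1
    _ ≤ (|C| * t ^ N) * Real.exp |C| := by gcongr
    _ = _ := by ring
end

section
/- Fix x ∈ ℝ with 0 < x < 1. Then for every natural number n, as q → 1⁻ (with q ∈ (0,1)), Γ_q(x)·Γ_q(1−x) − (π/sin(πx)) · ((q−1)/log q) · q^(x(x−1)/2) = O((1−q)^n). -/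
open Filter Topology Asymptotics Real

namespace QG

/-- finite q-Pochhammer `(q;q)_M`, `q = exp (-t)` -/
noncomputable def pq (t : ℝ) (M : ℕ) : ℝ := ∏ i ∈ Finset.range M, (1 - exp (-t * ((i : ℝ) + 1)))

/-- reciprocal of `(q;q)_k`, extended by zero -/
noncomputable def u (t : ℝ) (k : ℤ) : ℝ := if 0 ≤ k then (pq t k.toNat)⁻¹ else 0

/-- theta series weights -/
noncomputable def w (t x : ℝ) (j : ℤ) : ℝ :=
  (-1 : ℝ) ^ j * exp (-t * ((j : ℝ) * (j - 1) / 2 + j * x))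

noncomputable def c (t : ℝ) (N : ℕ) (j : ℤ) : ℝ := pq t (2 * N) * (u t (N + j) * u t (N - j))

lemma one_sub_exp_pos {t s : ℝ} (ht : 0 < t) (hs : 0 < s) : 0 < 1 - exp (-t * s) := by
  have : exp (-t * s) < 1 := by
    rw [exp_lt_one_iff]; nlinarith [mul_pos ht hs]
  linarith

lemma pq_pos {t : ℝ} (ht : 0 < t) (M : ℕ) : 0 < pq t M :=
  Finset.prod_pos fun i _ => one_sub_exp_pos ht (by positivity)

lemma u_rec {t : ℝ} (ht : 0 < t) (k : ℤ) : u t (k - 1) = (1 - exp (-t * k)) * u t k := by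
  rcases lt_trichotomy k 0 with h | h | h
  · rw [u, u, if_neg (by omega), if_neg (by omega)]; simp
  · subst h; simp [u]
  · obtain ⟨m, rfl⟩ : ∃ m : ℕ, k = m + 1 := ⟨(k - 1).toNat, by omega⟩
    rw [u, u, if_pos (by omega), if_pos (by omega)]
    have h1 : ((m : ℤ) + 1 - 1).toNat = m := by omega
    have h2 : ((m : ℤ) + 1).toNat = m + 1 := by omega
    rw [h1, h2]
    have h3 : pq t (m + 1) = pq t m * (1 - exp (-t * ((m : ℝ) + 1))) := by
      simp [pq, Finset.prod_range_succ]
    rw [h3]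
    have := (pq_pos ht m).ne'
    have h4 := (one_sub_exp_pos ht (by positivity : 0 < (m : ℝ) + 1)).ne'
    push_cast
    rw [mul_inv, mul_comm, mul_assoc, inv_mul_cancel₀ h4, mul_one]

lemma w_pred (t x : ℝ) (j : ℤ) : w t x (j - 1) = -(w t x j * exp (-t * (1 - j - x))) := by
  rw [w, w, zpow_sub_one₀ (by norm_num)]
  push_cast
  have : -t * (((j : ℝ) - 1) * (j - 1 - 1) / 2 + (j - 1) * x) =
    -t * ((j : ℝ) * (j - 1) / 2 + j * x) + -t * (1 - j - x) := by ring
  rw [this, exp_add]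
  norm_num
  ring

lemma w_succ (t x : ℝ) (j : ℤ) : w t x (j + 1) = -(w t x j * exp (-t * (j + x))) := by
  rw [w, w, zpow_add_one₀ (by norm_num)]
  push_cast
  have : -t * (((j : ℝ) + 1) * (j + 1 - 1) / 2 + (j + 1) * x) =
    -t * ((j : ℝ) * (j - 1) / 2 + j * x) + -t * (j + x) := by ring
  rw [this, exp_add]
  norm_num
  ring

lemma c_rec {t : ℝ} (ht : 0 < t) (N : ℕ) (j : ℤ) :
    c t (N + 1) j = (1 + exp (-t * (2 * N + 1))) * c t N j
      + exp (-t * (N + 1 - j)) * c t N (j - 1) + exp (-t * (N + 1 + j)) * c t N (j + 1) := by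
  have hU := u_rec ht (N + 1 + j)
  have hUp := u_rec ht (N + j)
  have hV := u_rec ht (N + 1 - j)
  have hVp := u_rec ht (N - j)
  have e1 : (N : ℤ) + 1 + j - 1 = N + j := by ring
  have e2 : (N : ℤ) + 1 - j - 1 = N - j := by ring
  rw [e1] at hU
  rw [e2] at hV
  have hp : pq t (2 * (N + 1)) =
      pq t (2 * N) * (1 - exp (-t * (2 * N + 1))) * (1 - exp (-t * (2 * N + 2))) := by
    rw [show 2 * (N + 1) = 2 * N + 1 + 1 by ring, pq, Finset.prod_range_succ,
      Finset.prod_range_succ, pq]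
    push_cast
    ring_nf
  simp only [c]
  rw [hp]
  have i1 : ((N + 1 : ℕ) : ℤ) + j = N + 1 + j := by push_cast; ring
  have i2 : ((N + 1 : ℕ) : ℤ) - j = N + 1 - j := by push_cast; ring
  have i3 : (N : ℤ) + (j - 1) = N + j - 1 := by ring
  have i4 : (N : ℤ) - (j - 1) = N + 1 - j := by ring
  have i5 : (N : ℤ) + (j + 1) = N + 1 + j := by ring
  have i6 : (N : ℤ) - (j + 1) = N - j - 1 := by ring
  rw [i1, i2, i3, i4, i5, i6, hUp, hVp, hU, hV]
  push_cast
  have hA : exp (-t * (N + j)) = exp (-t * (N + 1 + j)) * exp t := by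
    rw [← exp_add]; ring_nf
  have hB : exp (-t * (N - j)) = exp (-t * (N + 1 - j)) * exp t := by
    rw [← exp_add]; ring_nf
  have hC : exp (-t * (2 * N + 1)) = exp (-t * (N + 1 + j)) * exp (-t * (N + 1 - j)) * exp t := by
    rw [← exp_add, ← exp_add]; ring_nf
  have hD : exp (-t * (2 * N + 2)) = exp (-t * (N + 1 + j)) * exp (-t * (N + 1 - j)) := by
    rw [← exp_add]; ring_nf
  rw [hA, hB, hC, hD]
  ring

lemma finite_triple {t : ℝ} (ht : 0 < t) (x : ℝ) (N : ℕ) :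
    HasSum (fun j : ℤ => w t x j * c t N j)
      (∏ k ∈ Finset.range N, ((1 - exp (-t * (k + x))) * (1 - exp (-t * (k + (1 - x)))))) := by
  induction N with
  | zero =>
    have := hasSum_single (f := fun j : ℤ => w t x j * c t 0 j) 0 (by
      intro j hj
      rcases lt_or_gt_of_ne hj with h | h
      · simp [c, u, not_le.2 h]
      · simp [c, u, not_le.2 h])
    simpa [w, c, u, pq] using this
  | succ N ih =>
    rw [Finset.prod_range_succ]
    have h1 := (Equiv.addRight (-1 : ℤ)).hasSum_iff.2 ih
    have h2 := (Equiv.addRight (1 : ℤ)).hasSum_iff.2 ih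
    have h := ((ih.mul_left (1 + exp (-t * (2 * N + 1)))).sub
      (h1.mul_left (exp (-t * (N + x))))).sub (h2.mul_left (exp (-t * (N + (1 - x)))))
    refine Eq.mpr (congrArg₂ (fun (f : ℤ → ℝ) (a : ℝ) => HasSum f a) ?_ ?_) h
    · funext j
      simp only [Function.comp, Equiv.coe_addRight, ← sub_eq_add_neg]
      rw [c_rec ht, w_pred, w_succ]
      have e1 : exp (-t * (N + 1 - j)) = exp (-t * (N + x)) * exp (-t * (1 - j - x)) := by
        rw [← exp_add]; ring_nf
      have e2 : exp (-t * (N + 1 + j)) = exp (-t * (N + (1 - x))) * exp (-t * (j + x)) := by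
        rw [← exp_add]; ring_nf
      rw [e1, e2]; ring
    · have e1 : exp (-t * (2 * N + 1)) = exp (-t * (N + x)) * exp (-t * (N + (1 - x))) := by
        rw [← exp_add]; ring_nf
      rw [e1]; ring

/-- the infinite product `∏ (1 - q^(n+s))` -/
noncomputable def P (t s : ℝ) : ℝ := ∏' n : ℕ, (1 - exp (-t * (n + s)))

lemma summ_exp {t : ℝ} (ht : 0 < t) (s : ℝ) : Summable fun n : ℕ => exp (-t * (n + s)) := by
  have := (Real.summable_exp_nat_mul_iff (a := -t)).2 (by linarith)
  refine (this.mul_right (exp (-t * s))).congr fun n => ?_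
  rw [← exp_add]; ring_nf

lemma mult {t : ℝ} (ht : 0 < t) (s : ℝ) : Multipliable fun n : ℕ => (1 - exp (-t * (n + s))) := by
  simpa [sub_eq_add_neg] using Real.multipliable_one_add_of_summable (summ_exp ht s).neg

lemma P_tendsto {t : ℝ} (ht : 0 < t) (s : ℝ) :
    Tendsto (fun N => ∏ n ∈ Finset.range N, (1 - exp (-t * (n + s)))) atTop (𝓝 (P t s)) :=
  (mult ht s).hasProd.tendsto_prod_nat

lemma P_ne {t : ℝ} (ht : 0 < t) {s : ℝ} (hs : 0 < s) : P t s ≠ 0 := by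
  have := tprod_one_add_ne_zero_of_summable (f := fun n : ℕ => - exp (-t * (n + s)))
    (fun n => by
      have := one_sub_exp_pos ht (by positivity : 0 < (n : ℝ) + s)
      rw [← sub_eq_add_neg]; exact this.ne') (by simpa using (summ_exp ht s))
  simpa [P, sub_eq_add_neg] using this

lemma pq_anti {t : ℝ} (ht : 0 < t) : Antitone (pq t) := by
  refine antitone_nat_of_succ_le fun n => ?_
  have : pq t (n + 1) = pq t n * (1 - exp (-t * ((n : ℝ) + 1))) := by
    simp [pq, Finset.prod_range_succ]
  rw [this]
  exact mul_le_of_le_one_right (pq_pos ht n).le (by linarith [exp_pos (-t * ((n : ℝ) + 1))])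

lemma P_le_pq {t : ℝ} (ht : 0 < t) (M : ℕ) : P t 1 ≤ pq t M :=
  (pq_anti ht).le_of_tendsto (P_tendsto ht 1) M

lemma P_pos {t : ℝ} (ht : 0 < t) : 0 < P t 1 :=
  lt_of_le_of_ne (ge_of_tendsto' (P_tendsto ht 1) fun M => (pq_pos ht M).le)
    (P_ne ht one_pos).symm

lemma u_nonneg {t : ℝ} (ht : 0 < t) (k : ℤ) : 0 ≤ u t k := by
  rw [u]; split_ifs
  · exact (inv_pos.2 (pq_pos ht _)).le
  · exact le_rfl

lemma u_le {t : ℝ} (ht : 0 < t) (k : ℤ) : u t k ≤ (P t 1)⁻¹ := by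
  rw [u]; split_ifs
  · exact inv_anti₀ (P_pos ht) (P_le_pq ht _)
  · exact (inv_pos.2 (P_pos ht)).le

lemma toNat_tendsto : Tendsto Int.toNat atTop atTop := by
  refine tendsto_atTop.2 fun b => ?_
  filter_upwards [eventually_ge_atTop (b : ℤ)] with k hk
  omega

lemma u_tendsto {t : ℝ} (ht : 0 < t) : Tendsto (u t) atTop (𝓝 (P t 1)⁻¹) := by
  have h : Tendsto (fun k : ℤ => (pq t k.toNat)⁻¹) atTop (𝓝 (P t 1)⁻¹) :=
    ((P_tendsto ht 1).comp toNat_tendsto).inv₀ (P_ne ht one_pos)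
  refine h.congr' ?_
  filter_upwards [eventually_ge_atTop 0] with k hk
  rw [u, if_pos hk]

lemma c_tendsto {t : ℝ} (ht : 0 < t) (j : ℤ) :
    Tendsto (fun N => c t N j) atTop (𝓝 (P t 1)⁻¹) := by
  have hN : Tendsto (fun N : ℕ => (N : ℤ)) atTop atTop := tendsto_natCast_atTop_atTop
  have h1 := (u_tendsto ht).comp (tendsto_atTop_add_const_right _ j hN)
  have h2 := (u_tendsto ht).comp (tendsto_atTop_add_const_right _ (-j) hN)
  have h3 : Tendsto (fun N : ℕ => pq t (2 * N)) atTop (𝓝 (P t 1)) :=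
    (P_tendsto ht 1).comp (tendsto_id.const_mul_atTop' (by norm_num))
  have := h3.mul (h1.mul h2)
  rw [mul_inv_cancel_left₀ (P_ne ht one_pos)] at this
  simpa [c, sub_eq_add_neg] using this

lemma c_bound {t : ℝ} (ht : 0 < t) (N : ℕ) (j : ℤ) :
    |c t N j| ≤ (P t 1)⁻¹ * (P t 1)⁻¹ := by
  have h1 : pq t (2 * N) ≤ 1 := by simpa [pq] using pq_anti ht (Nat.zero_le (2 * N))
  have h0 := (pq_pos ht (2 * N)).le
  rw [c, abs_of_nonneg (mul_nonneg h0 (mul_nonneg (u_nonneg ht _) (u_nonneg ht _)))]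
  refine (mul_le_of_le_one_left (mul_nonneg (u_nonneg ht _) (u_nonneg ht _)) h1).trans ?_
  exact mul_le_mul (u_le ht _) (u_le ht _) (u_nonneg ht _) (inv_pos.2 (P_pos ht)).le

lemma gauss_summable {T : ℝ} (hT : 0 < T) (B : ℝ) (k : ℕ) :
    Summable fun n : ℤ => (|(n : ℝ)| ^ k) * exp (-(T * n ^ 2) + B * |(n : ℝ)|) := by
  have := summable_pow_mul_jacobiTheta₂_term_bound (B / (2 * π)) (div_pos hT pi_pos) k
  refine this.congr fun n => ?_
  push_cast
  congr 2
  field_simp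
  ring

lemma w_summable {t : ℝ} (ht : 0 < t) (x : ℝ) : Summable fun j => |w t x j| := by
  refine (gauss_summable (half_pos ht) (t * |x - 1 / 2|) 0).of_nonneg_of_le
    (fun _ => abs_nonneg _) fun j => ?_
  rw [w, abs_mul, abs_zpow, abs_neg, abs_one, one_zpow, one_mul, abs_of_pos (exp_pos _), pow_zero,
    one_mul, exp_le_exp]
  have h1 : -((x - 1 / 2) * j) ≤ |x - 1 / 2| * |(j : ℝ)| := by
    rw [← abs_mul]; exact neg_le_abs _
  nlinarith

/-- Jacobi triple product -/
lemma triple {t : ℝ} (ht : 0 < t) (x : ℝ) :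
    P t 1 * (P t x * P t (1 - x)) = ∑' j, w t x j := by
  have h1 : Tendsto (fun N : ℕ => ∑' j, w t x j * c t N j) atTop
      (𝓝 (∑' j, w t x j * (P t 1)⁻¹)) := by
    refine tendsto_tsum_of_dominated_convergence
      (bound := fun j => |w t x j| * ((P t 1)⁻¹ * (P t 1)⁻¹)) ((w_summable ht x).mul_right _)
      (fun j => (c_tendsto ht j).const_mul _) (Eventually.of_forall fun N j => ?_)
    rw [norm_eq_abs, abs_mul]
    exact mul_le_mul_of_nonneg_left (c_bound ht N j) (abs_nonneg _)
  have h2 : Tendsto (fun N : ℕ => ∑' j, w t x j * c t N j) atTop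
      (𝓝 (P t x * P t (1 - x))) := by
    have := (P_tendsto ht x).mul (P_tendsto ht (1 - x))
    refine this.congr fun N => ?_
    rw [(finite_triple ht x N).tsum_eq, Finset.prod_mul_distrib]
  have h3 := tendsto_nhds_unique h1 h2
  rw [← h3, tsum_mul_right]
  field_simp [P_ne ht one_pos]

/-- near zero -/
lemma P_succ {t : ℝ} (ht : 0 < t) (s : ℝ) : P t s = (1 - exp (-t * s)) * P t (1 + s) := by
  rw [P, P, tprod_eq_zero_mul' (f := fun n : ℕ => (1 - exp (-t * (n + s))))]
  · simp [add_assoc]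
  · simpa [add_assoc] using mult ht (1 + s)

lemma P_cont {t : ℝ} (ht : 0 < t) : ContinuousAt (P t) 1 := by
  have := tendsto_tprod_one_add_of_dominated_convergence (𝓕 := 𝓝 (1 : ℝ))
    (f := fun s (n : ℕ) => - exp (-t * (n + s))) (g := fun n : ℕ => - exp (-t * (n + 1)))
    (bound := fun n : ℕ => exp (-t * (n + 0))) (summ_exp ht 0)
    (fun n => by
      have : Continuous fun s : ℝ => - exp (-t * (n + s)) := by fun_prop
      exact this.tendsto 1)
    (by
      filter_upwards [lt_mem_nhds (zero_lt_one)] with s hs n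
      rw [norm_neg, norm_eq_abs, abs_of_pos (exp_pos _), exp_le_exp]
      nlinarith)
  simp only [← sub_eq_add_neg] at this
  exact this


/-- Gaussian weights on the dual side -/
noncomputable def g (t : ℝ) (n : ℤ) : ℝ := exp (-(2 * π ^ 2 / t) * ((n : ℝ) - 1 / 2) ^ 2)

noncomputable def S (t x : ℝ) : ℝ :=
  ∑' n : ℤ, g t n * cos ((2 * n - 1) * (π * x - π / 2))

noncomputable def K (t : ℝ) : ℝ := 1 / (t / (2 * π)) ^ (1 / 2 : ℝ)

lemma K_pos {t : ℝ} (ht : 0 < t) : 0 < K t := by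
  unfold K; positivity

lemma g_summable {t : ℝ} (ht : 0 < t) : Summable (g t) := by
  have hT : 0 < 2 * π ^ 2 / t := by positivity
  refine (gauss_summable hT (2 * π ^ 2 / t) 0).of_nonneg_of_le (fun _ => (exp_pos _).le) fun n => ?_
  rw [g, pow_zero, one_mul, exp_le_exp]
  have := le_abs_self (n : ℝ)
  nlinarith

lemma poisson {t : ℝ} (ht : 0 < t) (x : ℝ) :
    ∑' j, w t x j = K t * (exp (t / 2 * (x - 1 / 2) ^ 2) * S t x) := by
  have ha : 0 < ((t / (2 * π) : ℝ) : ℂ).re := by rw [Complex.ofReal_re]; positivity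
  have h := Complex.tsum_exp_neg_quadratic ha
    (Complex.I / 2 - ((t * (x - 1 / 2) / (2 * π) : ℝ) : ℂ))
  have hpi : (π : ℂ) ≠ 0 := by exact_mod_cast pi_ne_zero
  have htc : (t : ℂ) ≠ 0 := by exact_mod_cast ht.ne'
  have hl : ∀ n : ℤ, Complex.exp (-π * ((t / (2 * π) : ℝ) : ℂ) * n ^ 2 +
      2 * π * (Complex.I / 2 - ((t * (x - 1 / 2) / (2 * π) : ℝ) : ℂ)) * n) = ((w t x n : ℝ) : ℂ) := by
    intro n
    rw [w]
    push_cast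
    rw [← Complex.exp_pi_mul_I, ← Complex.exp_int_mul, ← Complex.exp_add]
    congr 1
    field_simp
    ring
  have hr : ∀ n : ℤ, Complex.exp (-π / ((t / (2 * π) : ℝ) : ℂ) *
      (n + Complex.I * (Complex.I / 2 - ((t * (x - 1 / 2) / (2 * π) : ℝ) : ℂ))) ^ 2) =
      ((exp (t / 2 * (x - 1 / 2) ^ 2) : ℝ) : ℂ) * (((g t n : ℝ) : ℂ) *
        Complex.exp ((((2 * n - 1) * (π * x - π / 2) : ℝ) : ℂ) * Complex.I)) := by
    intro n
    rw [g]
    push_cast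
    rw [← Complex.exp_add, ← Complex.exp_add]
    congr 1
    field_simp
    ring_nf
    simp only [show Complex.I ^ 3 = -Complex.I by rw [pow_succ, Complex.I_sq]; ring, show Complex.I ^ 4 = 1 from Complex.I_pow_four, Complex.I_sq]
    ring
  simp_rw [hl, hr] at h
  rw [tsum_mul_left] at h
  have hK : 1 / ((t / (2 * π) : ℝ) : ℂ) ^ (1 / 2 : ℂ) = ((K t : ℝ) : ℂ) := by
    rw [K]
    push_cast
    rw [Complex.ofReal_cpow (by positivity)]
    push_cast
    rfl
  rw [hK] at h
  have hs : Summable fun n : ℤ => ((g t n : ℝ) : ℂ) *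
        Complex.exp ((((2 * n - 1) * (π * x - π / 2) : ℝ) : ℂ) * Complex.I) := by
    refine Summable.of_norm ((g_summable ht).congr fun n => ?_)
    rw [norm_mul, Complex.norm_exp_ofReal_mul_I, mul_one, Complex.norm_real, norm_eq_abs, g,
      abs_of_pos (exp_pos _)]
  have h2 := congrArg Complex.re h
  rw [← Complex.ofReal_tsum, Complex.ofReal_re, Complex.re_ofReal_mul, Complex.re_ofReal_mul,
    Complex.re_tsum hs] at h2
  rw [h2, S]
  congr 3
  funext n
  rw [Complex.re_ofReal_mul, Complex.exp_ofReal_mul_I_re]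

lemma cos_nat_bound (φ : ℝ) (k : ℕ) : |cos ((2 * k + 1) * φ)| ≤ (2 * k + 1) * |cos φ| := by
  induction k with
  | zero => simp
  | succ k ih =>
    have : (2 * ((k + 1 : ℕ) : ℝ) + 1) * φ = (2 * k + 1) * φ + 2 * φ := by push_cast; ring
    rw [this, cos_add, sin_two_mul]
    refine (abs_sub _ _).trans ?_
    rw [abs_mul, abs_mul, abs_mul, abs_mul, abs_two]
    have h1 := mul_le_mul ih (abs_cos_le_one (2 * φ)) (abs_nonneg _) (by positivity)
    have h2 : |sin ((2 * k + 1) * φ)| * (2 * |sin φ| * |cos φ|) ≤ 1 * (2 * 1 * |cos φ|) := by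
      gcongr
      · exact abs_sin_le_one _
      · exact abs_sin_le_one _
    push_cast
    linarith

lemma cos_int_bound (φ : ℝ) (n : ℤ) :
    |cos ((2 * n - 1) * φ)| ≤ |(2 * n - 1 : ℝ)| * |cos φ| := by
  rcases le_or_gt n 0 with h | h
  · obtain ⟨k, rfl⟩ : ∃ k : ℕ, n = -(k : ℤ) := ⟨(-n).toNat, by omega⟩
    have := cos_nat_bound φ k
    push_cast
    rw [show (2 * (-(k : ℝ)) - 1) * φ = -((2 * k + 1) * φ) by ring, cos_neg,
      show (2 * (-(k : ℝ)) - 1) = -(2 * k + 1) by ring, abs_neg,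
      abs_of_nonneg (by positivity : (0 : ℝ) ≤ 2 * k + 1)]
    exact this
  · obtain ⟨k, rfl⟩ : ∃ k : ℕ, n = (k : ℤ) + 1 := ⟨(n - 1).toNat, by omega⟩
    have := cos_nat_bound φ k
    push_cast
    rw [show (2 * ((k : ℝ) + 1) - 1) = 2 * k + 1 by ring,
      abs_of_nonneg (by positivity : (0 : ℝ) ≤ 2 * k + 1)]
    exact this

noncomputable def r (t : ℝ) : ℝ := exp (-(2 * π ^ 2 / t) * (1 / 4))

/-- majorant -/
noncomputable def M (n : ℤ) : ℝ := |(2 * n - 1 : ℝ)| * exp (-((n : ℝ) * (n - 1)))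

lemma M_summable : Summable M := by
  have h1 := (gauss_summable one_pos 1 1).mul_left 2
  have h2 := gauss_summable one_pos 1 0
  refine (h1.add h2).of_nonneg_of_le (fun n => by unfold M; positivity) fun n => ?_
  have ha : |(2 * n - 1 : ℝ)| ≤ 2 * |(n : ℝ)| + 1 := by
    refine (abs_sub _ _).trans ?_
    rw [abs_mul, abs_two, abs_one]
  have hb : exp (-((n : ℝ) * (n - 1))) ≤ exp (-(1 * (n : ℝ) ^ 2) + 1 * |(n : ℝ)|) := by
    rw [exp_le_exp]
    have := le_abs_self (n : ℝ)
    nlinarith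
  have := mul_le_mul ha hb (exp_pos _).le (by positivity)
  rw [M]
  refine this.trans (le_of_eq ?_)
  ring

lemma g_bound {t : ℝ} (ht : 0 < t) (ht1 : t ≤ 1) {n : ℤ} (h0 : n ≠ 0) (h1 : n ≠ 1) :
    g t n * |(2 * n - 1 : ℝ)| ≤ r t * exp (-(1 / t)) * M n := by
  have hm : (2 : ℝ) ≤ (n : ℝ) * (n - 1) := by
    have : (2 : ℤ) ≤ n * (n - 1) := by
      rcases lt_or_ge n 0 with h | h
      · nlinarith
      · have : 2 ≤ n := by omega
        nlinarith
    exact_mod_cast this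
  have key : g t n ≤ r t * exp (-(1 / t)) * exp (-((n : ℝ) * (n - 1))) := by
    rw [g, r, ← exp_add, ← exp_add, exp_le_exp]
    have hp : 2 ≤ 2 * π ^ 2 := by nlinarith [pi_gt_three]
    have htp : 1 ≤ 1 / t := by rw [le_div_iff₀ ht]; linarith
    have e : 2 * π ^ 2 / t = 2 * π ^ 2 * (1 / t) := by ring
    rw [e]
    set v := 1 / t
    set m := (n : ℝ) * (n - 1) with hmdef
    have e2 : ((n : ℝ) - 1 / 2) ^ 2 = m + 1 / 4 := by rw [hmdef]; ring
    rw [e2]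
    have h3 : 2 * v * m ≤ 2 * π ^ 2 * v * m := by gcongr
    nlinarith
  rw [M]
  calc g t n * |(2 * n - 1 : ℝ)| ≤ (r t * exp (-(1 / t)) * exp (-((n : ℝ) * (n - 1)))) * |(2 * n - 1 : ℝ)| :=
        mul_le_mul_of_nonneg_right key (abs_nonneg _)
    _ = _ := by ring

lemma S_bound {t : ℝ} (ht : 0 < t) (ht1 : t ≤ 1) {x : ℝ} (hx : 0 ≤ sin (π * x)) :
    |S t x - 2 * (r t * sin (π * x))| ≤ r t * exp (-(1 / t)) * (∑' n, M n) * sin (π * x) := by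
  have hc : cos (π * x - π / 2) = sin (π * x) := cos_sub_pi_div_two _
  set φ := π * x - π / 2 with hφ
  have hs : Summable fun n : ℤ => g t n * cos ((2 * n - 1) * φ) := by
    refine Summable.of_norm_bounded (g_summable ht) fun n => ?_
    rw [norm_mul, norm_eq_abs, norm_eq_abs, g, abs_of_pos (exp_pos _)]
    exact mul_le_of_le_one_right (exp_pos _).le (abs_cos_le_one _)
  let f : ℤ → ℝ := fun n => if n = 0 ∨ n = 1 then r t * sin (π * x) else 0
  have hf : HasSum f (∑ n ∈ ({0, 1} : Finset ℤ), f n) :=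
    hasSum_sum_of_ne_finset_zero fun n hn => by
      simp only [Finset.mem_insert, Finset.mem_singleton] at hn
      simp [f, hn]
  have hfs : ∑ n ∈ ({0, 1} : Finset ℤ), f n = 2 * (r t * sin (π * x)) := by
    rw [Finset.sum_pair (by norm_num)]
    simp [f]; ring
  rw [hfs] at hf
  have hd := hs.hasSum.sub hf
  have hb := (M_summable.hasSum.mul_left (r t * exp (-(1 / t)))).mul_right (sin (π * x))
  have hr : 0 < r t := exp_pos _
  have := hd.norm_le_of_bounded hb (fun n => by
    by_cases h : n = 0 ∨ n = 1
    · have hz : g t n * cos ((2 * n - 1) * φ) = r t * sin (π * x) := by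
        rw [← hc, g, r]
        rcases h with rfl | rfl
        · norm_num
        · norm_num
      simp only [f, h, if_true, hz, sub_self, norm_zero]
      have : 0 ≤ M n := by unfold M; positivity
      positivity
    · have hfn : f n = 0 := by simp [f, h]
      push Not at h
      rw [hfn, sub_zero, norm_mul, norm_eq_abs, norm_eq_abs, abs_of_pos (show 0 < g t n from exp_pos _)]
      have h1 := cos_int_bound φ n
      rw [hc, abs_of_nonneg hx] at h1
      have h2 := g_bound ht ht1 h.1 h.2
      calc _ ≤ g t n * (|(2 * n - 1 : ℝ)| * sin (π * x)) :=
            mul_le_mul_of_nonneg_left h1 (exp_pos _).le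
        _ = g t n * |(2 * n - 1 : ℝ)| * sin (π * x) := by ring
        _ ≤ _ := mul_le_mul_of_nonneg_right h2 hx)
  exact this

lemma theta_eq {t : ℝ} (ht : 0 < t) (x : ℝ) :
    P t 1 * (P t x * P t (1 - x)) = K t * (exp (t / 2 * (x - 1 / 2) ^ 2) * S t x) := by
  rw [triple ht, poisson ht]

lemma cube_bound {t : ℝ} (ht : 0 < t) (ht1 : t ≤ 1) :
    |P t 1 ^ 3 * t - 2 * r t * (K t * exp (t / 8) * π)| ≤
      r t * exp (-(1 / t)) * (∑' n, M n) * (K t * exp (t / 8) * π) := by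
  have hd1 : HasDerivAt (fun y => sin (π * y)) π 0 := by
    have := ((hasDerivAt_id (0 : ℝ)).const_mul π).sin
    simpa using this
  have hd2 : HasDerivAt (fun y => 1 - exp (-t * y)) t 0 := by
    have := (((hasDerivAt_id (0 : ℝ)).const_mul (-t)).exp).const_sub 1
    simpa using this
  have l1 : Tendsto (fun y : ℝ => y⁻¹ * sin (π * y)) (𝓝[>] 0) (𝓝 π) := by
    simpa using hd1.tendsto_slope_zero_right
  have l2 : Tendsto (fun y : ℝ => y⁻¹ * (1 - exp (-t * y))) (𝓝[>] 0) (𝓝 t) := by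
    simpa using hd2.tendsto_slope_zero_right
  have l3 : Tendsto (fun y : ℝ => K t * exp (t / 2 * (y - 1 / 2) ^ 2)) (𝓝[>] 0)
      (𝓝 (K t * exp (t / 8))) := by
    have : Continuous fun y : ℝ => K t * exp (t / 2 * (y - 1 / 2) ^ 2) := by fun_prop
    have h := (this.tendsto 0).mono_left (nhdsWithin_le_nhds (s := Set.Ioi 0))
    convert h using 4
    ring
  have a1 : Tendsto (fun y : ℝ => 1 + y) (𝓝[>] 0) (𝓝 1) := by
    have : Continuous fun y : ℝ => 1 + y := by fun_prop
    simpa using (this.tendsto 0).mono_left (nhdsWithin_le_nhds (s := Set.Ioi 0))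
  have a2 : Tendsto (fun y : ℝ => 1 - y) (𝓝[>] 0) (𝓝 1) := by
    have : Continuous fun y : ℝ => 1 - y := by fun_prop
    simpa using (this.tendsto 0).mono_left (nhdsWithin_le_nhds (s := Set.Ioi 0))
  have l4 : Tendsto (fun y : ℝ => P t 1 * (P t (1 + y) * P t (1 - y))) (𝓝[>] 0)
      (𝓝 (P t 1 ^ 3)) := by
    have := ((P_cont ht).tendsto.comp a1).mul ((P_cont ht).tendsto.comp a2)
    have := this.const_mul (P t 1)
    rw [show P t 1 ^ 3 = P t 1 * (P t 1 * P t 1) by ring]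
    exact this
  have L := ((l4.mul l2).sub ((l3.mul l1).const_mul (2 * r t))).abs
  have R := (l3.mul l1).const_mul (r t * exp (-(1 / t)) * (∑' n, M n))
  refine le_of_tendsto_of_tendsto L R ?_
  filter_upwards [Ioo_mem_nhdsGT (zero_lt_one (α := ℝ))] with y hy
  have hsin : 0 ≤ sin (π * y) :=
    sin_nonneg_of_nonneg_of_le_pi (by nlinarith [pi_pos, hy.1]) (by nlinarith [pi_pos, hy.2])
  have hb := S_bound ht ht1 hsin
  have hth := theta_eq ht y
  rw [P_succ ht y] at hth
  have hyi : 0 < y⁻¹ := inv_pos.2 hy.1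
  have hpos : 0 < y⁻¹ * (K t * exp (t / 2 * (y - 1 / 2) ^ 2)) :=
    mul_pos hyi (mul_pos (K_pos ht) (exp_pos _))
  have e1 : P t 1 * (P t (1 + y) * P t (1 - y)) * (y⁻¹ * (1 - exp (-t * y))) -
      2 * r t * (K t * exp (t / 2 * (y - 1 / 2) ^ 2) * (y⁻¹ * sin (π * y))) =
      y⁻¹ * (K t * exp (t / 2 * (y - 1 / 2) ^ 2)) * (S t y - 2 * (r t * sin (π * y))) := by
    linear_combination y⁻¹ * hth
  show |_| ≤ _
  rw [e1, abs_mul, abs_of_pos hpos]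
  refine (mul_le_mul_of_nonneg_left hb hpos.le).trans (le_of_eq ?_)
  ring

lemma ratio_aux {a b s p X C η F G : ℝ} (hX : 0 < X) (hF : 0 < F) (hG : 0 < G) (hs : 0 < s)
    (hη0 : 0 ≤ η) (hη : η ≤ 1) (hp : 0 < p)
    (h1 : |a - 2 * X * (F * p)| ≤ X * η * (F * p)) (h2 : |b - 2 * X * (G * s)| ≤ X * η * (G * s)) 
    (hC : F = C * G) :
    |a / b - p / s * C| ≤ p / s * C * (2 * η) := by
  have hC0 : 0 < C := by
    by_contra h
    push Not at h
    nlinarith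
  subst hC
  rw [abs_le] at h1 h2
  have hXG : 0 < X * (G * s) := by positivity
  have hb : X * (G * s) ≤ b := by nlinarith
  have hbp : 0 < b := by linarith
  have e : a / b - p / s * C = (a * s - p * C * b) / (b * s) := by field_simp
  rw [e, abs_div, abs_of_pos (mul_pos hbp hs), div_le_iff₀ (mul_pos hbp hs)]
  have e2 : p / s * C * (2 * η) * (b * s) = p * C * (2 * η) * b := by field_simp
  rw [e2, abs_le]
  have hpC : 0 < p * C := by positivity
  have k1 : p * C * η * (X * (G * s)) ≤ p * C * η * b := by gcongr
  have q1 := mul_le_mul_of_nonneg_right h1.1 hs.le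
  have q2 := mul_le_mul_of_nonneg_right h1.2 hs.le
  have q3 := mul_le_mul_of_nonneg_left h2.1 hpC.le
  have q4 := mul_le_mul_of_nonneg_left h2.2 hpC.le
  constructor <;> nlinarith

lemma main_bound {t : ℝ} (ht : 0 < t) (ht1 : t ≤ 1) (hη : exp (-(1 / t)) * (∑' n, M n) ≤ 1)
    {x : ℝ} (hx0 : 0 < x) (hx1 : x < 1) :
    |P t 1 ^ 2 / (P t x * P t (1 - x)) - π / t / sin (π * x) * exp (-t * (x * (x - 1) / 2))| ≤
      π / t / sin (π * x) * exp (-t * (x * (x - 1) / 2)) * (2 * (exp (-(1 / t)) * (∑' n, M n))) := by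
  have hsin : 0 < sin (π * x) :=
    sin_pos_of_pos_of_lt_pi (by nlinarith [pi_pos]) (by nlinarith [pi_pos])
  have hM : 0 ≤ ∑' n, M n := tsum_nonneg fun n => by unfold M; positivity
  have h1 := cube_bound ht ht1
  have h2 := S_bound ht ht1 hsin.le
  have hth := theta_eq ht x
  have hG : 0 < K t * exp (t / 2 * (x - 1 / 2) ^ 2) := mul_pos (K_pos ht) (exp_pos _)
  have e0 : P t 1 ^ 2 / (P t x * P t (1 - x)) =
      P t 1 ^ 3 / (K t * (exp (t / 2 * (x - 1 / 2) ^ 2) * S t x)) := by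
    rw [← hth, pow_succ' (P t 1) 2, mul_div_mul_left _ _ (P_ne ht one_pos)]
  rw [e0]
  refine ratio_aux (X := r t) (F := K t * exp (t / 8)) (G := K t * exp (t / 2 * (x - 1 / 2) ^ 2))
    (exp_pos _) (mul_pos (K_pos ht) (exp_pos _)) hG hsin (by positivity) hη (by positivity) ?_ ?_ ?_
  · have e1 : P t 1 ^ 3 - 2 * r t * (K t * exp (t / 8) * (π / t)) =
        t⁻¹ * (P t 1 ^ 3 * t - 2 * r t * (K t * exp (t / 8) * π)) := by field_simp
    rw [e1, abs_mul, abs_of_pos (inv_pos.2 ht)]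
    refine (mul_le_mul_of_nonneg_left h1 (inv_pos.2 ht).le).trans (le_of_eq ?_)
    ring
  · have e1 : K t * (exp (t / 2 * (x - 1 / 2) ^ 2) * S t x) -
        2 * r t * (K t * exp (t / 2 * (x - 1 / 2) ^ 2) * sin (π * x)) =
        K t * exp (t / 2 * (x - 1 / 2) ^ 2) * (S t x - 2 * (r t * sin (π * x))) := by ring
    rw [e1, abs_mul, abs_of_pos hG]
    refine (mul_le_mul_of_nonneg_left h2 hG.le).trans (le_of_eq ?_)
    ring
  · rw [mul_left_comm, ← exp_add]
    ring_nf

end QG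


lemma QG.qGamma_eq {q t : ℝ} (hq : q = exp (-t)) (x : ℝ) :
    qGamma q x = (1 - q) ^ (1 - x) * QG.P t 1 / QG.P t x := by
  rw [qGamma, QG.P, QG.P]
  subst hq
  have h1 : ∀ n : ℕ, exp (-t) ^ (n + 1) = exp (-t * (n + 1)) := fun n => by
    rw [← exp_nat_mul]; push_cast; ring_nf
  have h2 : ∀ n : ℕ, exp (-t) ^ ((n : ℝ) + x) = exp (-t * (n + x)) := fun n => by
    rw [← exp_mul]
  simp_rw [h1, h2]

/-- Asymptotic reflection formula for the q-gamma function: for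
`0 < x < 1` and every `n : ℕ`,
`Γ_q(x) Γ_q(1-x) − (π/sin(πx)) ((q-1)/log q) q^{x(x-1)/2} = O((1-q)^n)` as `q → 1⁻`. -/
theorem qGamma_reflection (x : ℝ) (hx0 : 0 < x) (hx1 : x < 1) (n : ℕ) :
    (fun q : ℝ =>
        qGamma q x * qGamma q (1 - x) -
          Real.pi / Real.sin (Real.pi * x) * ((q - 1) / Real.log q) * q ^ (x * (x - 1) / 2))
      =O[𝓝[Set.Ioo (0 : ℝ) 1] 1] fun q : ℝ => (1 - q) ^ n := by
  have hsin : 0 < sin (π * x) :=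
    sin_pos_of_pos_of_lt_pi (by nlinarith [pi_pos]) (by nlinarith [pi_pos])
  set C := ∑' n, QG.M n with hCdef
  have hC : 0 ≤ C := tsum_nonneg fun n => by unfold QG.M; positivity
  refine IsBigO.of_bound (π / sin (π * x) * exp 1 * (2 * ((n.factorial : ℝ) * 2 ^ n * C))) ?_
  have hδ : exp (-(1 / (C + 1))) < 1 := by
    rw [exp_lt_one_iff]
    have : 0 < 1 / (C + 1) := by positivity
    linarith
  filter_upwards [self_mem_nhdsWithin, nhdsWithin_le_nhds (lt_mem_nhds hδ),
    nhdsWithin_le_nhds (lt_mem_nhds (by norm_num : (1 / 2 : ℝ) < 1))] with q hq hq1 hq2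
  obtain ⟨hq0, hql⟩ := hq
  obtain ⟨t, htq⟩ : ∃ t, t = -log q := ⟨_, rfl⟩
  have hqt : q = exp (-t) := by rw [htq, neg_neg, exp_log hq0]
  have ht : 0 < t := by rw [htq]; linarith [log_neg hq0 hql]
  have htC : t < 1 / (C + 1) := by
    rw [hqt, exp_lt_exp] at hq1
    linarith
  have hC1 : 1 / (C + 1) ≤ 1 := by
    rw [div_le_one (by positivity)]; linarith
  have ht1 : t ≤ 1 := by linarith
  have hexp : ∀ m : ℕ, exp (-(1 / t)) ≤ m.factorial * t ^ m := fun m => by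
    have := pow_div_factorial_le_exp (x := 1 / t) (by positivity) m
    rw [exp_neg]
    refine inv_le_of_inv_le₀ (by positivity) (le_trans (le_of_eq ?_) this)
    rw [mul_inv, one_div, inv_pow]
    ring
  have hη : exp (-(1 / t)) * C ≤ 1 := by
    have h1 := hexp 1
    simp only [Nat.factorial_one, Nat.cast_one, one_mul, pow_one] at h1
    have h2 : t * (C + 1) < 1 := by rwa [lt_div_iff₀ (by positivity)] at htC
    nlinarith
  have hb := QG.main_bound ht ht1 hη hx0 hx1
  have h1q : 0 < 1 - q := by linarith
  have hqt1 : 1 - q ≤ t := by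
    have := add_one_le_exp (-t)
    rw [← hqt] at this
    linarith
  have ht2 : t ≤ 2 * (1 - q) := by
    have := one_sub_inv_le_log_of_pos hq0
    have h3 : q⁻¹ - 1 ≤ 2 * (1 - q) := by
      have : q⁻¹ - 1 = (1 - q) * q⁻¹ := by field_simp
      rw [this, mul_comm 2]
      refine mul_le_mul_of_nonneg_left ?_ h1q.le
      rw [inv_le_comm₀ hq0 (by norm_num)]
      linarith
    linarith
  have hlq : log q = -t := by linarith
  have hpw : q ^ (x * (x - 1) / 2) = exp (-t * (x * (x - 1) / 2)) := by
    rw [hqt, ← exp_mul]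
  have hrw : (1 - q) ^ (1 - x) * (1 - q) ^ (1 - (1 - x)) = 1 - q := by
    rw [← rpow_add h1q, show 1 - x + (1 - (1 - x)) = 1 by ring, rpow_one]
  have heq : qGamma q x * qGamma q (1 - x) -
          π / sin (π * x) * ((q - 1) / log q) * q ^ (x * (x - 1) / 2) =
      (1 - q) * (QG.P t 1 ^ 2 / (QG.P t x * QG.P t (1 - x)) -
        π / t / sin (π * x) * exp (-t * (x * (x - 1) / 2))) := by
    rw [QG.qGamma_eq hqt, QG.qGamma_eq hqt, hlq, hpw, div_mul_div_comm, mul_mul_mul_comm, hrw]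
    have : (q - 1) / -t = (1 - q) / t := by rw [div_neg, ← neg_div, neg_sub]
    rw [this]
    ring
  rw [heq, norm_mul, norm_eq_abs, norm_eq_abs, norm_eq_abs, abs_of_pos h1q,
    abs_of_pos (pow_pos h1q n)]
  refine (mul_le_mul_of_nonneg_left hb h1q.le).trans ?_
  have e1 : (1 - q) * (π / t / sin (π * x) * exp (-t * (x * (x - 1) / 2)) *
      (2 * (exp (-(1 / t)) * C))) = ((1 - q) / t) * (π / sin (π * x)) *
        exp (-t * (x * (x - 1) / 2)) * (2 * (exp (-(1 / t)) * C)) := by ring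
  have b1 : (1 - q) / t ≤ 1 := by rwa [div_le_one ht]
  have b2 : exp (-t * (x * (x - 1) / 2)) ≤ exp 1 := by
    rw [exp_le_exp]
    have : 0 ≤ x * (1 - x) := mul_nonneg hx0.le (by linarith)
    have h4 : x * (1 - x) ≤ 1 := by nlinarith
    nlinarith
  have b3 : exp (-(1 / t)) ≤ n.factorial * (2 * (1 - q)) ^ n :=
    (hexp n).trans (by gcongr)
  rw [← hCdef, e1]
  calc _ ≤ 1 * (π / sin (π * x)) * exp 1 * (2 * ((n.factorial * (2 * (1 - q)) ^ n) * C)) := by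
        gcongr
    _ = _ := by rw [mul_pow]; ring
end

section
/- As q → 1⁻ (with q ∈ (0,1)), for every natural number n, Γ_q(1/2) − √( π · q^(−1/8) · (q−1)/log q ) = O((1−q)^n). -/
open Filter Topology Asymptotics Real

/-- Euler's product. -/
noncomputable def eulerP (x : ℝ) : ℝ := ∏' n : ℕ, (1 - x ^ (n + 1))

lemma eulerP_summable {x : ℝ} (h0 : 0 ≤ x) (h1 : x < 1) :
    Summable fun n : ℕ => x ^ (n + 1) :=
  (summable_nat_add_iff 1).mpr (summable_geometric_of_lt_one h0 h1)

lemma eulerP_multipliable {x : ℝ} (h0 : 0 ≤ x) (h1 : x < 1) :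
    Multipliable fun n : ℕ => (1 - x ^ (n + 1)) := by
  simpa [sub_eq_add_neg] using
    Real.multipliable_one_add_of_summable (eulerP_summable h0 h1).neg

lemma eulerP_tendsto {x : ℝ} (h0 : 0 ≤ x) (h1 : x < 1) :
    Tendsto (fun N => ∏ n ∈ Finset.range N, (1 - x ^ (n + 1))) atTop (𝓝 (eulerP x)) :=
  (eulerP_multipliable h0 h1).hasProd.tendsto_prod_nat

lemma eulerP_term {x : ℝ} (h0 : 0 ≤ x) (h1 : x < 1) (n : ℕ) : 0 < 1 - x ^ (n + 1) := by
  have := pow_lt_one₀ h0 h1 (Nat.succ_ne_zero n)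
  simp only [Nat.succ_eq_add_one] at this
  linarith

lemma eulerP_partial {x : ℝ} (h0 : 0 ≤ x) (h1 : x < 1) (N : ℕ) :
    0 ≤ ∏ n ∈ Finset.range N, (1 - x ^ (n + 1)) ∧
    ∏ n ∈ Finset.range N, (1 - x ^ (n + 1)) ≤ 1 ∧
    1 - 2 * x + x ^ (N + 1) ≤ (1 - x) * ∏ n ∈ Finset.range N, (1 - x ^ (n + 1)) := by
  induction N with
  | zero => simp; linarith
  | succ k ih =>
    obtain ⟨a, b, c⟩ := ih
    rw [Finset.prod_range_succ]
    set A := ∏ n ∈ Finset.range k, (1 - x ^ (n + 1))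
    have ht := eulerP_term h0 h1 k
    have hp : 0 ≤ x ^ (k + 1) := by positivity
    refine ⟨by positivity, by nlinarith, ?_⟩
    have e : x ^ (k + 1 + 1) = x * x ^ (k + 1) := by ring
    rw [e]
    nlinarith [mul_nonneg (mul_nonneg (sub_nonneg.2 b) hp) (sub_nonneg.2 h1.le)]

lemma eulerP_le_one {x : ℝ} (h0 : 0 ≤ x) (h1 : x < 1) : eulerP x ≤ 1 :=
  le_of_tendsto' (eulerP_tendsto h0 h1) fun N => (eulerP_partial h0 h1 N).2.1

lemma eulerP_ge {x : ℝ} (h0 : 0 ≤ x) (h1 : x < 1) : 1 - 2 * x ≤ (1 - x) * eulerP x :=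
  ge_of_tendsto' ((eulerP_tendsto h0 h1).const_mul (1 - x)) fun N => by
    have := (eulerP_partial h0 h1 N).2.2
    have hp : 0 ≤ x ^ (N + 1) := by positivity
    linarith

lemma eulerP_pos {x : ℝ} (h0 : 0 ≤ x) (h1 : x < 1) : 0 < eulerP x := by
  have h : 0 ≤ eulerP x :=
    ge_of_tendsto' (eulerP_tendsto h0 h1) fun N => (eulerP_partial h0 h1 N).1
  refine lt_of_le_of_ne h (Ne.symm ?_)
  have := tprod_one_add_ne_zero_of_summable (R := ℝ) (f := fun n : ℕ => -x ^ (n + 1))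
    (fun n => by have := eulerP_term h0 h1 n; simp only [← sub_eq_add_neg]; exact this.ne')
    (by simpa [abs_of_nonneg h0] using eulerP_summable h0 h1)
  simpa [eulerP, sub_eq_add_neg] using this

lemma eulerP_ratio {r : ℝ} (h0 : 0 ≤ r) (h1 : r ≤ 1 / 4) :
    |eulerP r ^ 2 / eulerP (r ^ 2) - 1| ≤ 4 * r := by
  have hr2 : r ^ 2 ≤ 1 / 16 := by nlinarith
  have hr2' : r ^ 2 ≤ r / 4 := by nlinarith
  have a1 := eulerP_ge h0 (by linarith)
  have a2 := eulerP_le_one h0 (by linarith)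
  have a3 := eulerP_pos h0 (by linarith)
  have b1 := eulerP_ge (sq_nonneg r) (by linarith)
  have b2 := eulerP_le_one (sq_nonneg r) (by linarith)
  have b3 := eulerP_pos (sq_nonneg r) (by linarith)
  set A := eulerP r
  set B := eulerP (r ^ 2)
  have hA : 1 - 4 / 3 * r ≤ A := by nlinarith
  have hB : 1 - 2 * r ^ 2 ≤ B := by nlinarith
  rw [abs_le]
  constructor
  · rw [neg_le_sub_iff_le_add, ← sub_le_iff_le_add, le_div_iff₀ b3]
    nlinarith
  · rw [sub_le_iff_le_add, div_le_iff₀ b3]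
    nlinarith

lemma norm_eta {y : ℝ} (hy : 0 < y) :
    ‖ModularForm.eta (Complex.I * y)‖ = exp (-(π * y / 12)) * eulerP (exp (-(2 * π * y))) := by
  have h1 : exp (-(2 * π * y)) < 1 := by
    rw [exp_lt_one_iff]; have := pi_pos; nlinarith [mul_pos pi_pos hy]
  have key : (∏' n, (1 - ModularForm.eta_q n (Complex.I * y))) =
      ((eulerP (exp (-(2 * π * y))) : ℝ) : ℂ) := by
    rw [eulerP]
    have := (eulerP_multipliable (exp_pos _).le h1).hasProd.map Complex.ofRealHom
      Complex.continuous_ofReal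
    refine Eq.trans ?_ this.tprod_eq
    congr 1
    ext n
    rw [ModularForm.eta_q_eq_pow]
    simp only [Function.comp, Complex.ofRealHom_eq_coe]
    push_cast
    congr 3
    ring_nf
    simp
  rw [ModularForm.eta, key, norm_mul, Complex.norm_real, Real.norm_of_nonneg
    (eulerP_pos (exp_pos _).le h1).le, Function.Periodic.qParam, Complex.norm_exp]
  congr 2
  have : 2 * (π : ℂ) * Complex.I * (Complex.I * y) / (24 : ℝ) = ((-(π * y / 12) : ℝ) : ℂ) := by
    push_cast
    ring_nf
    simp
    ring
  rw [this, Complex.ofReal_re]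

lemma norm_csqrt (z : ℂ) (hz : z ≠ 0) : ‖Complex.sqrt z‖ = Real.sqrt ‖z‖ := by
  have h : Complex.sqrt z ^ 2 = z := by
    rw [Complex.sqrt, ← Complex.cpow_nat_mul]
    norm_num
  have h2 : ‖Complex.sqrt z‖ ^ 2 = ‖z‖ := by rw [← norm_pow, h]
  rw [← h2, Real.sqrt_sq (norm_nonneg _)]

lemma eulerP_transf {y : ℝ} (hy : 0 < y) :
    exp (-(π / y / 12)) * eulerP (exp (-(2 * π / y))) =
      Real.sqrt y * (exp (-(π * y / 12)) * eulerP (exp (-(2 * π * y)))) := by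
  have hmem : Complex.I * y ∈ UpperHalfPlane.upperHalfPlaneSet := by
    simpa [UpperHalfPlane.upperHalfPlaneSet] using hy
  have h := ModularForm.eta_comp_eq_csqrt_I_inv hmem
  have hy0 : (y : ℂ) ≠ 0 := by exact_mod_cast hy.ne'
  have e : -1 / (Complex.I * y) = Complex.I * ((y⁻¹ : ℝ) : ℂ) := by
    push_cast
    field_simp
    simp
  simp only [Function.comp, Pi.smul_apply, Pi.mul_apply, smul_eq_mul] at h
  rw [e] at h
  have h' := congrArg norm h
  rw [norm_mul, norm_mul, norm_inv, norm_csqrt _ Complex.I_ne_zero,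
    norm_csqrt _ (mul_ne_zero Complex.I_ne_zero hy0), norm_eta hy, norm_eta (inv_pos.2 hy)] at h'
  simpa [abs_of_pos hy, div_eq_mul_inv] using h'

lemma eulerP_split {p : ℝ} (h0 : 0 < p) (h1 : p < 1) :
    (∏' n : ℕ, (1 - p ^ (2 * n + 1))) * eulerP (p ^ 2) = eulerP p := by
  have hs := eulerP_summable h0.le h1
  have he : Multipliable fun k : ℕ => 1 - p ^ (2 * k + 1) := by
    simpa [sub_eq_add_neg] using Real.multipliable_one_add_of_summable
      (hs.comp_injective (mul_right_injective₀ (two_ne_zero' ℕ))).neg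
  have ho : Multipliable fun k : ℕ => 1 - p ^ (2 * k + 1 + 1) := by
    simpa [sub_eq_add_neg] using Real.multipliable_one_add_of_summable
      (hs.comp_injective ((add_left_injective 1).comp (mul_right_injective₀ (two_ne_zero' ℕ)))).neg
  have := tprod_even_mul_odd (f := fun n : ℕ => 1 - p ^ (n + 1)) he ho
  rw [eulerP, eulerP, ← this]
  congr 2
  ext n
  ring

lemma qGamma_half_eq {t : ℝ} (ht : 0 < t) :
    qGamma (exp (-t)) (1 / 2) =
      Real.sqrt (π * exp (-t) ^ (-(1 : ℝ) / 8) * ((exp (-t) - 1) / Real.log (exp (-t)))) *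
      (eulerP (exp (-(4 * π ^ 2 / t))) ^ 2 / eulerP (exp (-(4 * π ^ 2 / t)) ^ 2)) := by
  have hpi := pi_pos
  set y : ℝ := t / (4 * π) with hydef
  have hy : 0 < y := by positivity
  have hty : t = 4 * π * y := by rw [hydef]; field_simp
  set p : ℝ := exp (-(t / 2)) with hp
  have hp0 : 0 < p := exp_pos _
  have hp1 : p < 1 := by rw [hp, exp_lt_one_iff]; linarith
  have hq : exp (-t) = p ^ 2 := by rw [hp, ← exp_nat_mul]; congr 1; push_cast; ring
  have hq1 : exp (-t) < 1 := by rw [exp_lt_one_iff]; linarith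
  set r : ℝ := exp (-(4 * π ^ 2 / t)) with hr
  have hr1 : r < 1 := by rw [hr, exp_lt_one_iff]; simp; positivity
  have T1 := eulerP_transf hy
  have T2 := eulerP_transf (y := 2 * y) (by positivity)
  have e1 : exp (-(2 * π * y)) = p := by rw [hp, hty]; congr 1; ring
  have e2 : exp (-(2 * π * (2 * y))) = p ^ 2 := by rw [← hq, hty]; congr 1; ring
  have e3 : exp (-(2 * π / (2 * y))) = r := by rw [hr, hty]; congr 1; field_simp
  have e4 : exp (-(2 * π / y)) = r ^ 2 := by
    rw [hr, ← exp_nat_mul, hty]; congr 1; push_cast; field_simp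
  rw [e1, e4] at T1
  rw [e2, e3] at T2
  have hP := eulerP_pos hp0.le hp1
  have hP2 := eulerP_pos (sq_nonneg p) (by rw [← hq]; exact hq1)
  have hR := eulerP_pos (exp_pos _).le hr1
  have hR2 := eulerP_pos (sq_nonneg r) (pow_lt_one₀ (exp_pos _).le hr1 two_ne_zero)
  have hsp := eulerP_split hp0 hp1
  have hlhs : qGamma (exp (-t)) (1 / 2) =
      Real.sqrt (1 - exp (-t)) * (eulerP (p ^ 2) ^ 2 / eulerP p) := by
    have hden : (∏' n : ℕ, (1 - exp (-t) ^ ((n : ℝ) + 1 / 2))) = ∏' n : ℕ, (1 - p ^ (2 * n + 1)) := by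
      congr 1
      ext n
      rw [hp, ← exp_mul, ← exp_nat_mul]
      congr 2
      push_cast
      ring
    rw [qGamma, hden, ← hsp, hq, Real.sqrt_eq_rpow]
    have hO : (∏' n : ℕ, (1 - p ^ (2 * n + 1))) ≠ 0 := by
      intro h; rw [h, zero_mul] at hsp; exact hP.ne hsp
    have : (1 : ℝ) - 1 / 2 = 1 / 2 := by norm_num
    rw [this, ← eulerP]
    field_simp
  have hS : Real.sqrt (π * exp (-t) ^ (-(1 : ℝ) / 8) * ((exp (-t) - 1) / Real.log (exp (-t)))) =
      Real.sqrt (1 - exp (-t)) * (exp (π * y / 4) / (2 * Real.sqrt y)) := by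
    have h4 : exp (π * y / 4) / (2 * Real.sqrt y) = Real.sqrt ((exp (π * y / 4) / (2 * Real.sqrt y)) ^ 2) := by
      rw [Real.sqrt_sq (by positivity)]
    rw [h4, ← Real.sqrt_mul (by linarith)]
    congr 1
    rw [div_pow, mul_pow, Real.sq_sqrt hy.le, Real.log_exp, ← exp_mul, ← exp_nat_mul]
    have : -t * (-1 / 8) = (2 : ℕ) * (π * y / 4) := by rw [hty]; push_cast; ring
    rw [this, hty]
    field_simp
    ring
  rw [hlhs, hS, mul_assoc]
  congr 1
  -- the modular identity
  set s := Real.sqrt y with hs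
  have hs0 : 0 < s := Real.sqrt_pos.2 hy
  have T2' := congrArg (fun x : ℝ => x ^ 2) T2
  simp only [mul_pow, Real.sq_sqrt (show (0 : ℝ) ≤ 2 * y by positivity), ← exp_nat_mul] at T2'
  have hss : y = s * s := (Real.mul_self_sqrt hy.le).symm
  have f1 : exp ((2 : ℕ) * -(π / (2 * y) / 12)) = exp (-(π / y / 12)) := by
    congr 1; push_cast; field_simp
  have f2 : exp (-(π * y / 12)) = exp (π * y / 4) * exp ((2 : ℕ) * -(π * (2 * y) / 12)) := by
    rw [← exp_add]; congr 1; push_cast; ring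
  rw [f1] at T2'
  rw [f2] at T1
  have g1 := exp_pos (-(π / y / 12))
  have g2 := exp_pos ((2 : ℕ) * -(π * (2 * y) / 12))
  have g3 := exp_pos (π * y / 4)
  generalize exp (-(π / y / 12)) = a at *
  generalize exp ((2 : ℕ) * -(π * (2 * y) / 12)) = b at *
  generalize exp (π * y / 4) = c at *
  generalize eulerP (p ^ 2) = B at *
  generalize eulerP p = A at *
  generalize eulerP (r ^ 2) = D at *
  generalize eulerP r = C at *
  rw [hss] at T2'
  have hD : D = s * (c * b * A) / a := by field_simp; linarith
  have hC : C ^ 2 = 2 * (s * s) * (b * B ^ 2) / a := by field_simp; linarith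
  rw [hC, hD]
  field_simp

/-- Asymptotically, `Γ_q(1/2) ≃ √(π q^{-1/8} (q-1)/log q)`: for every
`n : ℕ`, the difference is `O((1-q)^n)` as `q → 1⁻`. -/
theorem qGamma_half (n : ℕ) :
    (fun q : ℝ =>
        qGamma q (1 / 2) -
          Real.sqrt (Real.pi * q ^ (-(1 : ℝ) / 8) * ((q - 1) / Real.log q)))
      =O[𝓝[Set.Ioo (0 : ℝ) 1] 1] fun q : ℝ => (1 - q) ^ n := by
  have hpi := pi_pos
  have hpi3 := pi_gt_three
  refine IsBigO.of_bound (Real.sqrt (π * 2 * 1) * (4 * (n.factorial * 2 ^ n))) ?_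
  have hnear : ∀ᶠ q : ℝ in 𝓝[Set.Ioo (0 : ℝ) 1] 1, 1 / 2 < q :=
    mem_nhdsWithin_of_mem_nhds (lt_mem_nhds (by norm_num))
  filter_upwards [hnear, self_mem_nhdsWithin] with q hq2 hq
  obtain ⟨hq0, hq1⟩ := hq
  have hlog : Real.log q < 0 := Real.log_neg hq0 hq1
  obtain ⟨t, ht⟩ : ∃ t, t = -Real.log q := ⟨_, rfl⟩
  have ht0 : 0 < t := by linarith
  have hqe : q = exp (-t) := by rw [ht, neg_neg, Real.exp_log hq0]
  have ht2 : t ≤ 2 * (1 - q) := by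
    have h := Real.one_sub_inv_le_log_of_pos hq0
    have h3 : q⁻¹ - 1 ≤ 2 * (1 - q) := by
      have : q⁻¹ - 1 = (1 - q) * q⁻¹ := by field_simp
      rw [this, mul_comm]
      have h5 : q⁻¹ ≤ 2 := by rw [inv_le_comm₀ hq0 two_pos]; linarith
      exact mul_le_mul_of_nonneg_right h5 (by linarith)
    linarith
  have ht1 : t ≤ 1 := by linarith
  have hlog2 : 1 - q ≤ t := by
    have := Real.log_le_sub_one_of_pos hq0; linarith
  set r := exp (-(4 * π ^ 2 / t)) with hr
  have hx : 1 / t ≤ 4 * π ^ 2 / t := by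
    apply div_le_div_of_nonneg_right _ ht0.le; nlinarith
  have hr4 : r ≤ 1 / 4 := by
    rw [hr, exp_neg, inv_le_comm₀ (exp_pos _) (by norm_num)]
    have h1 := Real.add_one_le_exp (4 * π ^ 2 / t)
    have h2 : 4 ≤ 4 * π ^ 2 / t := by rw [le_div_iff₀ ht0]; nlinarith
    linarith
  have hrn : r ≤ n.factorial * t ^ n := by
    rw [hr, exp_neg, inv_le_comm₀ (exp_pos _) (by positivity)]
    have h1 := Real.pow_div_factorial_le_exp (x := 1 / t) (by positivity) n
    have h2 := Real.exp_le_exp.2 hx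
    refine le_trans (le_of_eq ?_) (h1.trans h2)
    rw [one_div, inv_pow, mul_inv, div_eq_mul_inv, mul_comm]
  have hpow : t ^ n ≤ 2 ^ n * (1 - q) ^ n := by
    rw [← mul_pow]; exact pow_le_pow_left₀ ht0.le ht2 n
  have hmain := qGamma_half_eq ht0
  rw [← hqe] at hmain
  have hS : Real.sqrt (π * q ^ (-(1 : ℝ) / 8) * ((q - 1) / Real.log q)) ≤ Real.sqrt (π * 2 * 1) := by
    apply Real.sqrt_le_sqrt
    have h1 : q ^ (-(1 : ℝ) / 8) ≤ 2 := by
      have : q ^ (-(1 : ℝ) / 8) ≤ q ^ (-1 : ℝ) :=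
        Real.rpow_le_rpow_of_exponent_ge hq0 hq1.le (by norm_num)
      rw [Real.rpow_neg_one] at this
      have h5 : q⁻¹ ≤ 2 := by rw [inv_le_comm₀ hq0 two_pos]; linarith
      linarith
    have h2 : (q - 1) / Real.log q ≤ 1 := by
      rw [div_le_one_of_neg hlog]; linarith
    have h3 : 0 ≤ (q - 1) / Real.log q := div_nonneg_of_nonpos (by linarith) hlog.le
    gcongr
  rw [hmain, ← hr]
  have hrat := eulerP_ratio (exp_pos _).le hr4
  rw [Real.norm_eq_abs, Real.norm_of_nonneg (pow_nonneg (by linarith) n)]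
  set S := Real.sqrt (π * q ^ (-(1 : ℝ) / 8) * ((q - 1) / Real.log q))
  have hS0 : 0 ≤ S := Real.sqrt_nonneg _
  rw [← mul_sub_one, abs_mul, abs_of_nonneg hS0]
  have hb : |eulerP r ^ 2 / eulerP (r ^ 2) - 1| ≤ 4 * (n.factorial * 2 ^ n) * (1 - q) ^ n := by
    refine hrat.trans ?_
    have : (n.factorial : ℝ) * t ^ n ≤ n.factorial * (2 ^ n * (1 - q) ^ n) := by gcongr
    linarith
  rw [mul_assoc]
  exact mul_le_mul hS hb (abs_nonneg _) (Real.sqrt_nonneg _)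
end
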